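/- arXiv:0911.0948 — 2 statements merged into one kernel-verified Lean document; each statement's English description precedes it below -/
import Mathlib

section
/- Let n ≥ 3 and a > 0, and set C_n(a) := (n-2)^{-2(n-1)/n} S_n if a ≥ 1/(n-2) and C_n(a) := a^{2(n-1)/n} S_n if 0 < a < 1/(n-2). Then for every u ∈ C_c^∞(B_1^c), where B_1^c is the complement of the closed unit ball, ∫_{B_1^c} |∇u|² dx ≥ ((n-2)/2)² ∫_{B_1^c} u²/|x|² dx + C_n(a) · ( ∫_{B_1^c} X_1(a, 1/|x|)^{2(n-1)/(n-2)} |u|^{2n/(n-2)} dx )^{(n-2)/n}. -/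
open MeasureTheory Real

/-- The best Sobolev constant `S_n = π n (n-2) (Γ(n/2)/Γ(n))^(2/n)`. -/
noncomputable def sobolevConst (n : ℕ) : ℝ :=
  Real.pi * n * ((n : ℝ) - 2) * (Real.Gamma ((n : ℝ) / 2) / Real.Gamma (n : ℝ)) ^ (2 / (n : ℝ))

/-- `X_1(a,s) = (a - ln s)⁻¹`. -/
noncomputable def X1 (a s : ℝ) : ℝ := (a - Real.log s)⁻¹

theorem exists_continuous_primitive_eq {X : Type*} [TopologicalSpace X] {R : ℝ} (hR : 0 < R)
    {p : X → ℝ → ℝ} (hp : Continuous (Function.uncurry p)) (hpos : ∀ x t, 0 < p x t)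
    {Z : X → ℝ} (hZ : Continuous Z) (hZ0 : ∀ x, 0 ≤ Z x)
    (hZ1 : ∀ x, Z x ≤ ∫ t in (-R)..R, p x t) :
    ∃ τ : X → ℝ, Continuous τ ∧ (∀ x, τ x ∈ Set.Icc (-R) R) ∧
      ∀ x, ∫ t in (-R)..(τ x), p x t = Z x := by
  have hpx : ∀ x, Continuous (p x) := fun x => hp.comp (by fun_prop : Continuous fun t => (x, t))
  have hmono : ∀ x, StrictMono fun c => ∫ t in (-R)..c, p x t := fun x =>
    strictMono_of_deriv_pos fun c => by
      rw [Continuous.deriv_integral _ (hpx x)]; exact hpos x c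
  have hcont : ∀ x, Continuous fun c => ∫ t in (-R)..c, p x t := fun x =>
    intervalIntegral.continuous_primitive (fun a b => (hpx x).intervalIntegrable a b) _
  have hex : ∀ x, ∃ c ∈ Set.Icc (-R) R, ∫ t in (-R)..c, p x t = Z x := fun x =>
    intermediate_value_Icc (by linarith : -R ≤ R) (hcont x).continuousOn
      ⟨by simpa using hZ0 x, hZ1 x⟩
  choose τ hτ hτZ using hex
  have hjoint : ∀ c, Continuous fun x => ∫ t in (-R)..c, p x t := fun c =>
    intervalIntegral.continuous_parametric_intervalIntegral_of_continuous' hp _ _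
  refine ⟨τ, OrderTopology.continuous_iff.2 fun c => ⟨?_, ?_⟩, hτ, hτZ⟩
  · have : τ ⁻¹' Set.Ioi c = {x | ∫ t in (-R)..c, p x t < Z x} := by
      ext x
      simp only [Set.mem_preimage, Set.mem_Ioi, Set.mem_ofPred_eq, ← hτZ x]
      exact (hmono x).lt_iff_lt.symm
    rw [this]
    exact isOpen_lt (hjoint c) hZ
  · have : τ ⁻¹' Set.Iio c = {x | Z x < ∫ t in (-R)..c, p x t} := by
      ext x
      simp only [Set.mem_preimage, Set.mem_Iio, Set.mem_ofPred_eq, ← hτZ x]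
      exact (hmono x).lt_iff_lt.symm
    rw [this]
    exact isOpen_lt hZ (hjoint c)

/-- The monotone transport of a positive density `F` on `[-R, R]` to a positive density `G`,
depending continuously on a parameter. -/
theorem exists_monotone_rearrangement {X : Type*} [TopologicalSpace X] {R : ℝ} (hR : 0 < R)
    {F G : X → ℝ → ℝ} (hF : Continuous (Function.uncurry F)) (hG : Continuous (Function.uncurry G))
    (hFpos : ∀ x t, 0 < F x t) (hGpos : ∀ x t, 0 < G x t) :
    ∃ τ : X → ℝ → ℝ, Continuous (Function.uncurry τ) ∧ (∀ x s, τ x s ∈ Set.Icc (-R) R) ∧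
      (∀ x, τ x (-R) = -R) ∧ (∀ x, τ x R = R) ∧
      ∀ x, ∀ s ∈ Set.Ioo (-R) R, HasDerivAt (τ x)
        (F x s / (∫ t in (-R)..R, F x t) * ((∫ t in (-R)..R, G x t) / G x (τ x s))) s := by
  have hFx : ∀ x, Continuous (F x) := fun x => hF.comp (by fun_prop : Continuous fun t => (x, t))
  have hGx : ∀ x, Continuous (G x) := fun x => hG.comp (by fun_prop : Continuous fun t => (x, t))
  have hFI : ∀ x, 0 < ∫ t in (-R)..R, F x t := fun x =>
    intervalIntegral.intervalIntegral_pos_of_pos ((hFx x).intervalIntegrable _ _) (hFpos x)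
      (by linarith)
  have hGI : ∀ x, 0 < ∫ t in (-R)..R, G x t := fun x =>
    intervalIntegral.intervalIntegral_pos_of_pos ((hGx x).intervalIntegrable _ _) (hGpos x)
      (by linarith)
  have hRR : -R ≤ R := by linarith
  let cl : ℝ → ℝ := fun s => max (-R) (min R s)
  have hcl : Continuous cl := by fun_prop
  have hcl0 : ∀ s, -R ≤ cl s := fun s => le_max_left _ _
  have hcl1 : ∀ s, cl s ≤ R := fun s => max_le hRR (min_le_left _ _)
  have hclid : ∀ s ∈ Set.Icc (-R) R, cl s = s := fun s hs => by
    simp only [cl, min_eq_right hs.2, max_eq_right hs.1]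
  let Z : X × ℝ → ℝ := fun y => (∫ t in (-R)..(cl y.2), F y.1 t) *
    ((∫ t in (-R)..R, G y.1 t) / ∫ t in (-R)..R, F y.1 t)
  have hZ : Continuous Z := by
    refine Continuous.mul ?_ (Continuous.div ?_ ?_ fun y => (hFI y.1).ne')
    · exact intervalIntegral.continuous_parametric_intervalIntegral_of_continuous
        (f := fun (y : X × ℝ) t => F y.1 t)
        (hF.comp (by fun_prop : Continuous fun q : (X × ℝ) × ℝ => (q.1.1, q.2)))
        (hcl.comp continuous_snd)
    · exact (intervalIntegral.continuous_parametric_intervalIntegral_of_continuous' hG _ _).comp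
        continuous_fst
    · exact (intervalIntegral.continuous_parametric_intervalIntegral_of_continuous' hF _ _).comp
        continuous_fst
  have hGu : Continuous (Function.uncurry fun (y : X × ℝ) t => G y.1 t) :=
    hG.comp (by fun_prop : Continuous fun q : (X × ℝ) × ℝ => (q.1.1, q.2))
  have hle : ∀ y : X × ℝ, (∫ t in (-R)..(cl y.2), F y.1 t) ≤ ∫ t in (-R)..R, F y.1 t := fun y => by
    refine intervalIntegral.integral_mono_interval le_rfl (hcl0 _) (hcl1 _) ?_
      ((hFx _).intervalIntegrable _ _)
    exact Filter.Eventually.of_forall fun t => (hFpos _ t).le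
  obtain ⟨τ, hτc, hτm, hτZ⟩ := exists_continuous_primitive_eq hR hGu (fun y t => hGpos y.1 t) hZ
    (fun y => mul_nonneg (intervalIntegral.integral_nonneg (hcl0 _) fun t _ => (hFpos _ t).le)
      (div_pos (hGI _) (hFI _)).le)
    (fun y => by
      have h := mul_le_mul_of_nonneg_right (hle y) (div_pos (hGI y.1) (hFI y.1)).le
      rwa [mul_div_cancel₀ _ (hFI y.1).ne'] at h)
  have hmono : ∀ x, StrictMono fun c => ∫ t in (-R)..c, G x t := fun x =>
    strictMono_of_deriv_pos fun c => by
      rw [Continuous.deriv_integral _ (hGx x)]; exact hGpos x c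
  refine ⟨fun x s => τ (x, s), hτc, fun x s => hτm _, fun x => ?_, fun x => ?_, fun x s hs => ?_⟩
  · apply (hmono x).injective
    have := hτZ (x, -R)
    simp only [Z, hclid (-R) ⟨le_rfl, hRR⟩] at this
    simpa using this
  · apply (hmono x).injective
    have := hτZ (x, R)
    simp only [Z, hclid R ⟨hRR, le_rfl⟩] at this
    rwa [mul_div_cancel₀ _ (hFI x).ne'] at this
  · have hGd := (hGx x).integral_hasStrictDerivAt (-R) (τ (x, s))
    have hne := (hGpos x (τ (x, s))).ne'
    have hτs : Filter.Tendsto (fun s' => τ (x, s')) (nhds s) (nhds (τ (x, s))) :=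
      (hτc.comp (by fun_prop : Continuous fun t => (x, t))).tendsto s
    have hev := hτs.eventually (HasStrictDerivAt.eventually_left_inverse hGd hne)
    have hZd : HasDerivAt (fun s' => Z (x, s')) (F x s *
        ((∫ t in (-R)..R, G x t) / ∫ t in (-R)..R, F x t)) s := by
      have h1 := ((hFx x).integral_hasStrictDerivAt (-R) s).hasDerivAt.mul_const
        ((∫ t in (-R)..R, G x t) / ∫ t in (-R)..R, F x t)
      refine h1.congr_of_eventuallyEq ?_
      filter_upwards [Ioo_mem_nhds hs.1 hs.2] with s' hs'
      simp only [Z, hclid s' ⟨hs'.1.le, hs'.2.le⟩]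
    have hinv := (HasStrictDerivAt.to_localInverse hGd hne).hasDerivAt
    rw [show (∫ t in (-R)..(τ (x, s)), G x t) = Z (x, s) from hτZ (x, s)] at hinv
    have hcomp := hinv.comp s hZd
    have hfin := hcomp.congr_of_eventuallyEq (f₁ := fun s' => τ (x, s')) (by
      filter_upwards [hev] with s' hs'
      simp only [Function.comp]
      rw [← hτZ (x, s')]
      exact hs'.symm)
    refine hfin.congr_deriv ?_
    generalize (∫ t in (-R)..R, G x t) = p
    generalize (∫ t in (-R)..R, F x t) = q
    change _ = F x s / q * (p / G x (τ (x, s)))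
    ring

theorem setIntegral_pi_Icc_eq {n : ℕ} (R : ℝ) (hR : 0 < R) (i : Fin (n + 1))
    {H : (Fin (n + 1) → ℝ) → ℝ} (hH : Continuous H) :
    ∫ x in Set.Icc (fun _ => -R) (fun _ => R), H x =
      ∫ x' in Set.Icc (fun _ : Fin n => -R) (fun _ => R),
        ∫ s in (-R)..R, H (i.insertNth (α := fun _ => ℝ) s x') := by
  have hRR : -R ≤ R := by linarith
  have hmp := (volume_preserving_piFinSuccAbove (fun _ : Fin (n + 1) => ℝ) i).symm
  rw [← hmp.setIntegral_preimage_emb (MeasurableEquiv.measurableEmbedding _)]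
  have hpre : (MeasurableEquiv.piFinSuccAbove (fun _ : Fin (n + 1) => ℝ) i).symm ⁻¹'
      Set.Icc (fun _ => -R) (fun _ => R) =
      Set.Icc (-R) R ×ˢ Set.Icc (fun _ : Fin n => -R) (fun _ => R) := by
    ext ⟨s, x'⟩
    change i.insertNth (α := fun _ => ℝ) s x' ∈ Set.Icc (fun _ => -R) (fun _ => R) ↔ _
    simp only [Set.mem_prod, Set.mem_Icc, Pi.le_def, i.forall_iff_succAbove,
      Fin.insertNth_apply_same, Fin.insertNth_apply_succAbove]
    tauto
  have hc : Continuous fun z : ℝ × (Fin n → ℝ) =>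
      H (i.insertNth (α := fun _ => ℝ) z.1 z.2) :=
    hH.comp (Continuous.finInsertNth i continuous_fst continuous_snd)
  rw [hpre, Measure.volume_eq_prod, ← Measure.prod_restrict, ← integral_prod_swap,
    integral_prod]
  · refine setIntegral_congr_fun measurableSet_Icc fun x' _ => ?_
    rw [intervalIntegral.integral_of_le hRR, ← integral_Icc_eq_integral_Ioc]
    rfl
  · rw [Measure.prod_restrict]
    refine ContinuousOn.integrableOn_compact (isCompact_Icc.prod isCompact_Icc) ?_
    exact (hc.comp continuous_swap).continuousOn

/-- The Knothe map between two positive densities on a cube. -/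
theorem exists_knothe_map {R : ℝ} (hR : 0 < R) (n : ℕ) (F G : (Fin n → ℝ) → ℝ)
    (hF : Continuous F) (hG : Continuous G) (hFpos : ∀ x, 0 < F x) (hGpos : ∀ x, 0 < G x)
    (hFG : ∫ x in Set.Icc (fun _ => -R) (fun _ => R), F x =
      ∫ x in Set.Icc (fun _ => -R) (fun _ => R), G x) :
    ∃ T D : (Fin n → ℝ) → (Fin n → ℝ), Continuous T ∧ Continuous D ∧
      (∀ x i, T x i ∈ Set.Icc (-R) R) ∧ (∀ x i, 0 < D x i) ∧
      (∀ x i, x i ∈ Set.Ioo (-R) R →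
        HasDerivAt (fun s => T (Function.update x i s) i) (D x i) (x i)) ∧
      (∀ x, (∏ i, D x i) * G (T x) = F x) ∧
      ∀ φ : (Fin n → ℝ) → ℝ, Continuous φ →
        ∫ x in Set.Icc (fun _ => -R) (fun _ => R), φ (T x) * F x =
          ∫ x in Set.Icc (fun _ => -R) (fun _ => R), φ x * G x := by
  have hRR : -R ≤ R := by linarith
  induction n with
  | zero =>
    have hv : volume (Set.Icc (fun _ : Fin 0 => -R) (fun _ => R)) = 1 := by
      rw [Real.volume_Icc_pi]; simp
    have hs : Set.Icc (fun _ : Fin 0 => -R) (fun _ => R) = Set.univ := by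
      ext x; simp
    have hc : ∀ φ : (Fin 0 → ℝ) → ℝ,
        ∫ x in Set.Icc (fun _ => -R) (fun _ => R), φ x = φ 0 := fun φ => by
      rw [setIntegral_congr_fun (g := fun _ => φ 0) measurableSet_Icc
        (fun x _ => by rw [Subsingleton.elim x 0]), setIntegral_const, Measure.real, hv]
      simp
    rw [hc, hc] at hFG
    refine ⟨id, fun _ _ => 1, continuous_id, by fun_prop, fun x i => i.elim0, fun x i => i.elim0,
      fun x i => i.elim0, fun x => ?_, fun φ _ => ?_⟩
    · rw [Subsingleton.elim x 0, Finset.prod_of_isEmpty, one_mul]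
      exact hFG.symm
    · rw [hc, hc, hFG]
      rfl
  | succ n ih =>
    have hcons : Continuous fun z : (Fin n → ℝ) × ℝ => (Fin.cons z.2 z.1 : Fin (n + 1) → ℝ) :=
      Continuous.finCons (A := fun _ => ℝ) continuous_snd continuous_fst
    have hcub : ∀ {H : (Fin (n + 1) → ℝ) → ℝ}, Continuous H →
        ∫ x in Set.Icc (fun _ => -R) (fun _ => R), H x =
          ∫ x' in Set.Icc (fun _ : Fin n => -R) (fun _ => R),
            ∫ s in (-R)..R, H (Fin.cons s x') := fun hH => by
      simpa only [Fin.insertNth_zero'] using setIntegral_pi_Icc_eq (n := n) R hR 0 hH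
    set F' : (Fin n → ℝ) → ℝ := fun x' => ∫ s in (-R)..R, F (Fin.cons s x') with hF'
    set G' : (Fin n → ℝ) → ℝ := fun x' => ∫ s in (-R)..R, G (Fin.cons s x') with hG'
    have hFu : Continuous (Function.uncurry fun (x' : Fin n → ℝ) (s : ℝ) =>
      F (Fin.cons s x')) := hF.comp hcons
    have hGu : Continuous (Function.uncurry fun (x' : Fin n → ℝ) (s : ℝ) =>
      G (Fin.cons s x')) := hG.comp hcons
    have hF'c : Continuous F' :=
      intervalIntegral.continuous_parametric_intervalIntegral_of_continuous' hFu _ _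
    have hG'c : Continuous G' :=
      intervalIntegral.continuous_parametric_intervalIntegral_of_continuous' hGu _ _
    have hF'p : ∀ x, 0 < F' x := fun x =>
      intervalIntegral.intervalIntegral_pos_of_pos
        ((hFu.comp (by fun_prop : Continuous fun s : ℝ => (x, s))).intervalIntegrable _ _)
        (fun s => hFpos _) (by linarith)
    have hG'p : ∀ x, 0 < G' x := fun x =>
      intervalIntegral.intervalIntegral_pos_of_pos
        ((hGu.comp (by fun_prop : Continuous fun s : ℝ => (x, s))).intervalIntegrable _ _)
        (fun s => hGpos _) (by linarith)
    obtain ⟨T', D', hT'c, hD'c, hT'm, hD'p, hT'd, hdet, hpush⟩ :=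
      ih F' G' hF'c hG'c hF'p hG'p (by rw [← hcub hF, ← hcub hG, hFG])
    obtain ⟨τ, hτc, hτm, hτl, hτr, hτd⟩ := exists_monotone_rearrangement hR
      (F := fun (x' : Fin n → ℝ) (s : ℝ) => F (Fin.cons s x'))
      (G := fun (x' : Fin n → ℝ) (s : ℝ) => G (Fin.cons s (T' x'))) hFu
      (hG.comp (hcons.comp (by fun_prop : Continuous fun z : (Fin n → ℝ) × ℝ => (T' z.1, z.2))))
      (fun _ _ => hFpos _) (fun _ _ => hGpos _)
    have htail : Continuous fun x : Fin (n + 1) → ℝ => (Fin.tail x : Fin n → ℝ) := by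
      unfold Fin.tail; fun_prop
    have hτ' : Continuous fun x : Fin (n + 1) → ℝ => τ (Fin.tail x) (x 0) :=
      hτc.comp (htail.prodMk (continuous_apply 0))
    have hTc : Continuous fun x : Fin (n + 1) → ℝ =>
        (Fin.cons (τ (Fin.tail x) (x 0)) (T' (Fin.tail x)) : Fin (n + 1) → ℝ) :=
      Continuous.finCons (A := fun _ => ℝ) hτ' (hT'c.comp htail)
    have hdc : Continuous fun x : Fin (n + 1) → ℝ => F x / F' (Fin.tail x) * (G' (T' (Fin.tail x)) /
          G (Fin.cons (τ (Fin.tail x) (x 0)) (T' (Fin.tail x)))) := by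
      refine (hF.div (hF'c.comp htail) fun x => (hF'p _).ne').mul
        (((hG'c.comp hT'c).comp htail).div (hG.comp hTc) fun x => (hGpos _).ne')
    refine ⟨fun x => Fin.cons (τ (Fin.tail x) (x 0)) (T' (Fin.tail x)),
      fun x => Fin.cons (F x / F' (Fin.tail x) * (G' (T' (Fin.tail x)) /
          G (Fin.cons (τ (Fin.tail x) (x 0)) (T' (Fin.tail x))))) (D' (Fin.tail x)),
      hTc, Continuous.finCons (A := fun _ => ℝ) hdc (hD'c.comp htail), fun x i => ?_, fun x i => ?_, fun x i hi => ?_,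
      fun x => ?_, fun φ hφ => ?_⟩
    · refine Fin.cases ?_ (fun j => ?_) i
      · simpa using hτm _ _
      · simpa using hT'm _ _
    · refine Fin.cases ?_ (fun j => ?_) i
      · simp only [Fin.cons_zero]
        exact mul_pos (div_pos (hFpos _) (hF'p _)) (div_pos (hG'p _) (hGpos _))
      · simpa using hD'p _ _
    · revert hi
      refine Fin.cases (fun hi => ?_) (fun j hi => ?_) i
      · simp only [Fin.cons_zero, Fin.tail_update_zero, Function.update_self]
        have := hτd (Fin.tail x) (x 0) hi
        rwa [Fin.cons_self_tail] at this
      · simp only [Fin.cons_succ, Fin.tail_update_succ]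
        exact hT'd (Fin.tail x) j hi
    · rw [Fin.prod_univ_succ]
      simp only [Fin.cons_zero, Fin.cons_succ]
      have h1 := hdet (Fin.tail x)
      have h2 := (hF'p (Fin.tail x)).ne'
      have h3 := (hGpos (Fin.cons (τ (Fin.tail x) (x 0)) (T' (Fin.tail x)))).ne'
      field_simp
      linear_combination (F x) * h1
    · have hTF : Continuous fun x : Fin (n + 1) → ℝ =>
          φ (Fin.cons (τ (Fin.tail x) (x 0)) (T' (Fin.tail x))) * F x := (hφ.comp hTc).mul hF
      rw [hcub hTF, hcub (H := fun x => φ x * G x) (hφ.mul hG)]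
      simp only [Fin.tail_cons, Fin.cons_zero]
      set ψ : (Fin n → ℝ) → ℝ := fun y =>
        (∫ t in (-R)..R, φ (Fin.cons t y) * G (Fin.cons t y)) / G' y with hψ
      have hψc : Continuous ψ :=
        (intervalIntegral.continuous_parametric_intervalIntegral_of_continuous'
          (f := fun (y : Fin n → ℝ) (t : ℝ) => φ (Fin.cons t y) * G (Fin.cons t y))
          ((hφ.mul hG).comp hcons) _ _).div hG'c fun y => (hG'p y).ne'
      have hp := hpush ψ hψc
      have e2 : ∀ y, ψ y * G' y = ∫ t in (-R)..R, φ (Fin.cons t y) * G (Fin.cons t y) :=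
        fun y => div_mul_cancel₀ _ (hG'p y).ne'
      simp only [e2] at hp
      rw [← hp]
      refine setIntegral_congr_fun measurableSet_Icc fun x' _ => ?_
      have hτx : Continuous (τ x') := hτc.comp (by fun_prop : Continuous fun s : ℝ => (x', s))
      have hgc : Continuous fun t : ℝ => φ (Fin.cons t (T' x')) * G (Fin.cons t (T' x')) :=
        (hφ.mul hG).comp (hcons.comp (by fun_prop : Continuous fun t : ℝ => (T' x', t)))
      have hdc' : Continuous fun s => F (Fin.cons s x') / F' x' * (G' (T' x') /
          G (Fin.cons (τ x' s) (T' x'))) := by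
        have := hdc.comp (hcons.comp (by fun_prop : Continuous fun t : ℝ => (x', t)))
        simpa [Function.comp_def] using this
      have hsub := intervalIntegral.integral_comp_mul_deriv''' (a := -R) (b := R) (f := τ x')
        (g := fun t => φ (Fin.cons t (T' x')) * G (Fin.cons t (T' x'))) hτx.continuousOn
        (f' := fun s => F (Fin.cons s x') / F' x' * (G' (T' x') /
          G (Fin.cons (τ x' s) (T' x'))))
        (fun s hs => (hτd x' s (by simpa [hRR] using hs)).hasDerivWithinAt)
        hgc.continuousOn
        (hgc.continuousOn.integrableOn_compact (isCompact_uIcc.image hτx))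
        ((((hgc.comp hτx).mul hdc').continuousOn).integrableOn_compact isCompact_uIcc)
      rw [hτl, hτr] at hsub
      simp only [hψ]
      rw [← hsub, div_mul_eq_mul_div, mul_div_assoc,
        ← intervalIntegral.integral_mul_const]
      refine intervalIntegral.integral_congr fun s _ => ?_
      have h1 := (hF'p x').ne'
      have h2 := (hG'p (T' x')).ne'
      have h3 := (hGpos (Fin.cons (τ x' s) (T' x'))).ne'
      simp only [Function.comp]
      field_simp

theorem sq_setIntegral_mul_le {α : Type*} [TopologicalSpace α] [MeasurableSpace α]
    [OpensMeasurableSpace α] [T2Space α] {μ : Measure α} [IsFiniteMeasureOnCompacts μ]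
    {K : Set α} (hK : IsCompact K)
    {a b : α → ℝ} (ha : Continuous a) (hb : Continuous b) :
    (∫ x in K, a x * b x ∂μ) ^ 2 ≤ (∫ x in K, a x ^ 2 ∂μ) * ∫ x in K, b x ^ 2 ∂μ := by
  have hi : ∀ {c : α → ℝ}, Continuous c → IntegrableOn c K μ := fun hc =>
    hc.continuousOn.integrableOn_compact hK
  have h := discrim_le_zero (a := ∫ x in K, b x ^ 2 ∂μ) (b := -(2 * ∫ x in K, a x * b x ∂μ))
    (c := ∫ x in K, a x ^ 2 ∂μ) fun t => by
      have h0 : 0 ≤ ∫ x in K, (a x - t * b x) ^ 2 ∂μ := integral_nonneg fun x => sq_nonneg _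
      have e : ∫ x in K, (a x - t * b x) ^ 2 ∂μ =
          ∫ x in K, ((a x ^ 2 - 2 * t * (a x * b x)) + t ^ 2 * b x ^ 2) ∂μ :=
        integral_congr_ae (Filter.Eventually.of_forall fun x => by ring)
      rw [e, integral_add (hi (by fun_prop)) (hi (by fun_prop)),
        integral_sub (hi (by fun_prop)) (hi (by fun_prop)), integral_const_mul,
        integral_const_mul] at h0
      linarith
  simp only [discrim] at h
  linarith

theorem setIntegral_mul_add_partial_le {k : ℕ} {R δ : ℝ} (hR : 0 < R) (i : Fin (k + 1))
    {g : (Fin (k + 1) → ℝ) → ℝ} (hg : ContDiff ℝ 1 g) (hg0 : ∀ x, 0 ≤ g x)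
    (hδ : ∀ x, x i ∉ Set.Ioo (-R) R → g x ≤ δ)
    {S D : (Fin (k + 1) → ℝ) → ℝ} (hS : Continuous S) (hD : Continuous D)
    (hSm : ∀ x, S x ∈ Set.Icc (-R) R)
    (hSd : ∀ x, x i ∈ Set.Ioo (-R) R →
      HasDerivAt (fun s => S (Function.update x i s)) (D x) (x i)) :
    ∫ x in Set.Icc (fun _ => -R) (fun _ => R),
      (g x * D x + fderiv ℝ g x (Pi.single i 1) * S x) ≤ (2 * R) ^ (k + 1) * δ := by
  have hRR : -R ≤ R := by linarith
  have hgc := hg.continuous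
  have hfd : Continuous fun x => fderiv ℝ g x (Pi.single i 1) :=
    (hg.continuous_fderiv one_ne_zero).clm_apply continuous_const
  have hH : Continuous fun x => g x * D x + fderiv ℝ g x (Pi.single i 1) * S x := by fun_prop
  rw [setIntegral_pi_Icc_eq R hR i hH]
  have hins : ∀ x' : Fin k → ℝ, Continuous fun s : ℝ => i.insertNth (α := fun _ => ℝ) s x' :=
    fun x' => Continuous.finInsertNth i continuous_id continuous_const
  have hupd : ∀ (x' : Fin k → ℝ) (s s' : ℝ),
      Function.update (i.insertNth (α := fun _ => ℝ) s x') i s' =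
        i.insertNth (α := fun _ => ℝ) s' x' := fun x' s s' => by
    simp
  have hinner : ∀ x' : Fin k → ℝ, ∫ s in (-R)..R,
      (g (i.insertNth (α := fun _ => ℝ) s x') * D (i.insertNth (α := fun _ => ℝ) s x') +
        fderiv ℝ g (i.insertNth (α := fun _ => ℝ) s x') (Pi.single i 1) *
          S (i.insertNth (α := fun _ => ℝ) s x')) ≤ 2 * R * δ := by
    intro x'
    have hftc := intervalIntegral.integral_eq_sub_of_hasDerivAt_of_le hRR
      (f := fun s => g (i.insertNth (α := fun _ => ℝ) s x') *
        S (i.insertNth (α := fun _ => ℝ) s x'))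
      ((hgc.comp (hins x')).mul (hS.comp (hins x'))).continuousOn
      (f' := fun s => (g (i.insertNth (α := fun _ => ℝ) s x') *
        D (i.insertNth (α := fun _ => ℝ) s x') +
        fderiv ℝ g (i.insertNth (α := fun _ => ℝ) s x') (Pi.single i 1) *
          S (i.insertNth (α := fun _ => ℝ) s x')))
      (fun s hs => by
        have h1 := hSd (i.insertNth (α := fun _ => ℝ) s x') (by simpa using hs)
        simp only [hupd, Fin.insertNth_apply_same] at h1
        have h2 : HasDerivAt (fun s' => g (i.insertNth (α := fun _ => ℝ) s' x'))
            (fderiv ℝ g (i.insertNth (α := fun _ => ℝ) s x') (Pi.single i 1)) s := by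
          have h3 : HasDerivAt (fun s' => i.insertNth (α := fun _ => ℝ) s' x')
              (Pi.single i 1) s := by
            have h4 := hasDerivAt_update (i.insertNth (α := fun _ => ℝ) s x') i s
            rwa [show Function.update (i.insertNth (α := fun _ => ℝ) s x') i =
              fun s' => i.insertNth (α := fun _ => ℝ) s' x' from funext (hupd x' s)] at h4
          exact ((hg.differentiable one_ne_zero).differentiableAt.hasFDerivAt).comp_hasDerivAt s h3
        refine (h2.mul h1).congr_deriv ?_
        exact add_comm _ _)
      ((hH.comp (hins x')).intervalIntegrable _ _)
    rw [hftc]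
    have e1 := hδ (i.insertNth (α := fun _ => ℝ) R x') (by simp)
    have e2 := hδ (i.insertNth (α := fun _ => ℝ) (-R) x') (by simp)
    have p1 := hg0 (i.insertNth (α := fun _ => ℝ) R x')
    have p2 := hg0 (i.insertNth (α := fun _ => ℝ) (-R) x')
    have s1 := hSm (i.insertNth (α := fun _ => ℝ) R x')
    have s2 := hSm (i.insertNth (α := fun _ => ℝ) (-R) x')
    have b1 := mul_le_mul_of_nonneg_left s1.2 p1
    have b2 := mul_le_mul_of_nonneg_left s2.1 p2
    have c1 := mul_le_mul_of_nonneg_right e1 hR.le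
    have c2 := mul_le_mul_of_nonneg_right e2 hR.le
    linarith
  have hvol : volume.real (Set.Icc (fun _ : Fin k => -R) (fun _ => R)) = (2 * R) ^ k := by
    rw [Measure.real, Real.volume_Icc_pi_toReal (fun _ => hRR)]
    simp; ring
  calc _ ≤ ∫ x' in Set.Icc (fun _ : Fin k => -R) (fun _ => R), 2 * R * δ := by
        refine setIntegral_mono_on ?_ ?_ measurableSet_Icc fun x' _ => hinner x'
        · refine ContinuousOn.integrableOn_compact isCompact_Icc (Continuous.continuousOn ?_)
          refine intervalIntegral.continuous_parametric_intervalIntegral_of_continuous'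
            (f := fun x' s => g (i.insertNth (α := fun _ => ℝ) s x') *
              D (i.insertNth (α := fun _ => ℝ) s x') +
              fderiv ℝ g (i.insertNth (α := fun _ => ℝ) s x') (Pi.single i 1) *
                S (i.insertNth (α := fun _ => ℝ) s x')) ?_ _ _
          exact hH.comp (Continuous.finInsertNth (A := fun _ => ℝ) i continuous_snd continuous_fst)
        · exact continuous_const.integrableOn_Icc
    _ = _ := by
      rw [setIntegral_const, hvol, smul_eq_mul]; ring

theorem exists_transport_inequality {k : ℕ} (hk : 0 < k) {R δ : ℝ} (hR : 0 < R)
    {g : (Fin (k + 1) → ℝ) → ℝ} (hg : ContDiff ℝ 1 g) (hg0 : ∀ x, 0 < g x)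
    (hδ : ∀ x i, x i ∉ Set.Ioo (-R) R → g x ≤ δ)
    {G w : (Fin (k + 1) → ℝ) → ℝ} (hG : Continuous G) (hw : Continuous w) (hw0 : ∀ x, 0 < w x)
    (hGw : ∀ x, G x = w x ^ (-((k : ℝ) + 1)))
    {κ : ℝ} (hκ : κ = (∫ x in Set.Icc (fun _ => -R) (fun _ => R), G x) /
      ∫ x in Set.Icc (fun _ => -R) (fun _ => R), g x ^ (((k : ℝ) + 1) / k)) :
    ∃ T : (Fin (k + 1) → ℝ) → (Fin (k + 1) → ℝ), Continuous T ∧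
      (∀ φ : (Fin (k + 1) → ℝ) → ℝ, Continuous φ →
        κ * ∫ x in Set.Icc (fun _ => -R) (fun _ => R), φ (T x) * g x ^ (((k : ℝ) + 1) / k) =
          ∫ x in Set.Icc (fun _ => -R) (fun _ => R), φ x * G x) ∧
      ((k : ℝ) + 1) * ∫ x in Set.Icc (fun _ => -R) (fun _ => R), w x * G x ≤
        κ ^ ((k : ℝ) / (k + 1)) * (((k : ℝ) + 1) * ((2 * R) ^ (k + 1) * δ) -
          ∫ x in Set.Icc (fun _ => -R) (fun _ => R),
            ∑ i, fderiv ℝ g x (Pi.single i 1) * T x i) := by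
  have hk' : (0 : ℝ) < k := by exact_mod_cast hk
  have hGpos : ∀ x, 0 < G x := fun x => by rw [hGw]; exact Real.rpow_pos_of_pos (hw0 x) _
  have hgpc : Continuous fun x => g x ^ (((k : ℝ) + 1) / k) :=
    hg.continuous.rpow_const fun x => Or.inl (hg0 x).ne'
  have hpos : ∀ {c : (Fin (k + 1) → ℝ) → ℝ}, Continuous c → (∀ x, 0 < c x) →
      0 < ∫ x in Set.Icc (fun _ => -R) (fun _ => R), c x := by
    intro c hc hc0
    rw [setIntegral_pos_iff_support_of_nonneg_ae (Filter.Eventually.of_forall fun x => (hc0 x).le)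
      (hc.continuousOn.integrableOn_compact isCompact_Icc)]
    have : Function.support c = Set.univ := by ext x; simp [(hc0 x).ne']
    rw [this, Set.univ_inter, Real.volume_Icc_pi]
    rw [Finset.prod_const]
    exact ENNReal.pow_pos (by simpa using hR) _
  have hκ0 : 0 < κ := by
    rw [hκ]
    exact div_pos (hpos hG hGpos) (hpos hgpc fun x => Real.rpow_pos_of_pos (hg0 x) _)
  obtain ⟨T, D, hT, hD, hTm, hD0, hTd, hdet, hpush⟩ := exists_knothe_map hR (k + 1)
    (fun x => κ * g x ^ (((k : ℝ) + 1) / k)) G (by fun_prop) hG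
    (fun x => mul_pos hκ0 (Real.rpow_pos_of_pos (hg0 x) _)) hGpos (by
      rw [integral_const_mul, hκ, div_mul_cancel₀]
      exact (hpos hgpc fun x => Real.rpow_pos_of_pos (hg0 x) _).ne')
  have hInt : ∀ {c : (Fin (k + 1) → ℝ) → ℝ}, Continuous c →
      IntegrableOn c (Set.Icc (fun _ => -R) (fun _ => R)) volume := fun hc =>
    hc.continuousOn.integrableOn_compact isCompact_Icc
  have hfd : ∀ i : Fin (k + 1), Continuous fun x => fderiv ℝ g x (Pi.single i 1) := fun i =>
    (hg.continuous_fderiv one_ne_zero).clm_apply continuous_const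
  have hgc := hg.continuous
  refine ⟨T, hT, fun φ hφ => ?_, ?_⟩
  · rw [← hpush φ hφ, ← integral_const_mul]
    refine integral_congr_ae (Filter.Eventually.of_forall fun x => ?_)
    ring
  · have hpt : ∀ x, ((k : ℝ) + 1) * (w (T x) * (κ * g x ^ (((k : ℝ) + 1) / k))) ≤
        κ ^ ((k : ℝ) / (k + 1)) * ∑ i, g x * D x i := by
      intro x
      have hwT := hw0 (T x)
      have hP : 0 < ∏ i, D x i := Finset.prod_pos fun i _ => hD0 x i
      have amgm := Real.geom_mean_le_arith_mean (Finset.univ : Finset (Fin (k + 1)))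
        (fun _ => 1) (D x) (fun _ _ => zero_le_one) (by simp; positivity) (fun i _ => (hD0 x i).le)
      simp only [Real.rpow_one, one_mul, Finset.sum_const, Finset.card_univ, Fintype.card_fin,
        nsmul_eq_mul, mul_one, Nat.cast_add, Nat.cast_one] at amgm
      have hF := hdet x
      have hgx := hg0 x
      have hF0 : 0 < κ * g x ^ (((k : ℝ) + 1) / k) := by positivity
      have e1 : w (T x) * (κ * g x ^ (((k : ℝ) + 1) / k)) =
          κ ^ ((k : ℝ) / (k + 1)) * g x * (∏ i, D x i) ^ (((k : ℝ) + 1)⁻¹) := by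
        have hPe : ∏ i, D x i = (κ * g x ^ (((k : ℝ) + 1) / k)) * w (T x) ^ ((k : ℝ) + 1) := by
          rw [← hF, hGw, mul_assoc, ← Real.rpow_add hwT]
          simp
        rw [hPe, Real.mul_rpow hF0.le (by positivity), ← Real.rpow_mul hwT.le,
          mul_inv_cancel₀ (by positivity), Real.rpow_one, Real.mul_rpow hκ0.le (by positivity),
          ← Real.rpow_mul hgx.le]
        have a1 : κ = κ ^ ((k : ℝ) / (k + 1)) * κ ^ (((k : ℝ) + 1)⁻¹) := by
          rw [← Real.rpow_add hκ0]
          conv_lhs => rw [← Real.rpow_one κ]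
          congr 1; field_simp
        have a2 : g x ^ (((k : ℝ) + 1) / k) =
            g x * g x ^ (((k : ℝ) + 1) / k * ((k : ℝ) + 1)⁻¹) := by
          conv_rhs => rw [← Real.rpow_one (g x), ← Real.rpow_mul hgx.le, ← Real.rpow_add hgx]
          congr 1; field_simp
        rw [a2]
        conv_lhs => rw [a1]
        ring
      rw [e1, ← Finset.mul_sum]
      have hA : 0 < κ ^ ((k : ℝ) / (k + 1)) * g x := by positivity
      have := (le_div_iff₀ (by positivity : (0 : ℝ) < (k : ℝ) + 1)).1 amgm
      calc _ = κ ^ ((k : ℝ) / (k + 1)) * g x *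
            ((∏ i, D x i) ^ (((k : ℝ) + 1)⁻¹) * ((k : ℝ) + 1)) := by ring
        _ ≤ κ ^ ((k : ℝ) / (k + 1)) * g x * ∑ i, D x i := by gcongr
        _ = _ := by ring
    rw [← hpush w hw, ← integral_const_mul]
    calc _ ≤ ∫ x in Set.Icc (fun _ => -R) (fun _ => R),
          κ ^ ((k : ℝ) / (k + 1)) * ∑ i, g x * D x i :=
          setIntegral_mono (hInt (by fun_prop)) (hInt (by fun_prop)) hpt
      _ ≤ _ := by
        rw [integral_const_mul]
        refine mul_le_mul_of_nonneg_left ?_ (Real.rpow_nonneg hκ0.le _)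
        rw [le_sub_iff_add_le, ← integral_add (hInt (by fun_prop)) (hInt (by fun_prop))]
        simp only [← Finset.sum_add_distrib]
        rw [integral_finsetSum _ fun i _ => hInt (by fun_prop)]
        calc _ ≤ ∑ i : Fin (k + 1), (2 * R) ^ (k + 1) * δ :=
              Finset.sum_le_sum fun i _ => setIntegral_mul_add_partial_le hR i hg
                (fun x => (hg0 x).le) (fun x => hδ x i) (by fun_prop) (by fun_prop)
                (fun x => hTm x i) (fun x hx => hTd x i hx)
          _ = _ := by simp

theorem integrable_and_integral_one_add_sum_sq_rpow {N : ℕ} {s : ℝ} (hs : (N : ℝ) / 2 < s) :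
    Integrable (fun y : Fin N → ℝ => (1 + ∑ i, y i ^ 2) ^ (-s)) ∧
    ∫ y : Fin N → ℝ, (1 + ∑ i, y i ^ 2) ^ (-s) =
      π ^ ((N : ℝ) / 2) * Real.Gamma (s - N / 2) / Real.Gamma s := by
  have hs0 : 0 < s := lt_of_le_of_lt (by positivity) hs
  have hw : ∀ y : Fin N → ℝ, 0 < 1 + ∑ i, y i ^ 2 := fun y => by positivity
  have hGs := Real.Gamma_pos_of_pos hs0
  have hinner : ∀ y : Fin N → ℝ,
      ∫ t in Set.Ioi (0 : ℝ), t ^ (s - 1) * Real.exp (-((1 + ∑ i, y i ^ 2) * t)) =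
        (1 + ∑ i, y i ^ 2) ^ (-s) * Real.Gamma s := fun y => by
    rw [Real.integral_rpow_mul_exp_neg_mul_Ioi hs0 (hw y), one_div, Real.inv_rpow (hw y).le,
      Real.rpow_neg (hw y).le]
  have hsplit : ∀ (t : ℝ) (y : Fin N → ℝ),
      t ^ (s - 1) * Real.exp (-((1 + ∑ i, y i ^ 2) * t)) =
        t ^ (s - 1) * Real.exp (-t) * ∏ i, Real.exp (-t * y i ^ 2) := fun t y => by
    rw [mul_assoc, ← Real.exp_sum, ← Real.exp_add, ← Finset.mul_sum]
    congr 2; ring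
  have hslice : ∀ t ∈ Set.Ioi (0 : ℝ), Integrable fun y : Fin N → ℝ =>
      t ^ (s - 1) * Real.exp (-((1 + ∑ i, y i ^ 2) * t)) := fun t ht => by
    simp only [hsplit]
    exact (Integrable.fintype_prod (f := fun (_ : Fin N) (x : ℝ) => Real.exp (-t * x ^ 2))
      fun _ => integrable_exp_neg_mul_sq ht).const_mul _
  have houter : ∀ t ∈ Set.Ioi (0 : ℝ), ∫ y : Fin N → ℝ,
      t ^ (s - 1) * Real.exp (-((1 + ∑ i, y i ^ 2) * t)) =
        π ^ ((N : ℝ) / 2) * (Real.exp (-t) * t ^ (s - N / 2 - 1)) := fun t ht => by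
    have ht' : 0 < t := ht
    simp only [hsplit]
    rw [integral_const_mul,
      integral_fintype_prod_volume_eq_pow (fun x : ℝ => Real.exp (-t * x ^ 2)),
      integral_gaussian, Fintype.card_fin, Real.sqrt_eq_rpow, ← Real.rpow_natCast,
      ← Real.rpow_mul (by positivity), Real.div_rpow Real.pi_pos.le ht'.le]
    have e : t ^ (s - 1) = t ^ (s - N / 2 - 1) * t ^ (1 / 2 * (N : ℝ)) := by
      rw [← Real.rpow_add ht']; congr 1; ring
    have hne : t ^ (1 / 2 * (N : ℝ)) ≠ 0 := (Real.rpow_pos_of_pos ht' _).ne'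
    rw [e]
    field_simp
  have hGint := Real.GammaIntegral_convergent (s := s - N / 2) (by linarith)
  have hprod : Integrable (Function.uncurry fun (y : Fin N → ℝ) (t : ℝ) =>
      t ^ (s - 1) * Real.exp (-((1 + ∑ i, y i ^ 2) * t)))
      (volume.prod (volume.restrict (Set.Ioi 0))) := by
    rw [integrable_prod_iff']
    · constructor
      · filter_upwards [ae_restrict_mem measurableSet_Ioi] with t ht
        exact hslice t ht
      · refine (hGint.const_mul (π ^ ((N : ℝ) / 2))).congr ?_
        filter_upwards [ae_restrict_mem measurableSet_Ioi] with t ht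
        rw [← houter t ht]
        refine integral_congr_ae (Filter.Eventually.of_forall fun y => ?_)
        have ht' : 0 < t := ht
        simp only [Function.uncurry]
        rw [Real.norm_of_nonneg (by positivity)]
    · refine Measurable.aestronglyMeasurable ?_
      unfold Function.uncurry
      fun_prop
  have hInt : Integrable fun y : Fin N → ℝ => (1 + ∑ i, y i ^ 2) ^ (-s) * Real.Gamma s := by
    refine hprod.integral_prod_left.congr (Filter.Eventually.of_forall fun y => ?_)
    exact hinner y
  have hInt' : Integrable fun y : Fin N → ℝ => (1 + ∑ i, y i ^ 2) ^ (-s) := by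
    refine (hInt.mul_const (Real.Gamma s)⁻¹).congr (Filter.Eventually.of_forall fun y => ?_)
    simp only
    rw [mul_assoc, mul_inv_cancel₀ hGs.ne', mul_one]
  refine ⟨hInt', ?_⟩
  rw [eq_div_iff hGs.ne', ← integral_mul_const]
  simp only [← hinner]
  rw [integral_integral_swap hprod, setIntegral_congr_fun measurableSet_Ioi houter,
    integral_const_mul, Real.Gamma_eq_integral (by linarith)]

theorem transport_bound_regularized {k : ℕ} (hk : 2 ≤ k) {R ε A I₀ I₂ : ℝ} (hR : 0 < R)
    (hε : 0 < ε) {f : (Fin (k + 1) → ℝ) → ℝ} (hf : ContDiff ℝ 1 f)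
    (hfR : ∀ x i, x i ∉ Set.Ioo (-R) R → f x = 0) {E : ℝ}
    (hE : ∫ x in Set.Icc (fun _ => -R) (fun _ => R),
      ∑ i, (fderiv ℝ f x (Pi.single i 1)) ^ 2 ≤ E)
    (hA : 0 < A)
    (hAf : A ≤ ∫ x in Set.Icc (fun _ => -R) (fun _ => R), (f x ^ 2) ^ (((k : ℝ) + 1) / (k - 1)))
    (hI₀ : ∫ y : Fin (k + 1) → ℝ in Set.Icc (fun _ => -R) (fun _ => R),
      (1 + ∑ i, y i ^ 2) ^ (-((k : ℝ) + 1)) ≤ I₀)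
    (hI₂ : ∫ y : Fin (k + 1) → ℝ in Set.Icc (fun _ => -R) (fun _ => R),
      (∑ i, y i ^ 2) * (1 + ∑ i, y i ^ 2) ^ (-((k : ℝ) + 1)) ≤ I₂) :
    ((k : ℝ) + 1) * ∫ y : Fin (k + 1) → ℝ in Set.Icc (fun _ => -R) (fun _ => R),
      (1 + ∑ i, y i ^ 2) ^ (-(k : ℝ)) ≤
    (I₀ / A) ^ ((k : ℝ) / (k + 1)) *
        (((k : ℝ) + 1) * ((2 * R) ^ (k + 1) * (ε ^ 2) ^ ((k : ℝ) / (k - 1)))) +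
      (I₀ / A) ^ (((k : ℝ) - 1) / (2 * (k + 1))) * (2 * k / (k - 1) * √(E * I₂)) := by
  have hk2 : (2 : ℝ) ≤ k := by exact_mod_cast hk
  have hk1 : (0 : ℝ) < (k : ℝ) - 1 := by linarith
  have hk0 : (0 : ℝ) < k := by linarith
  have hfc := hf.continuous
  have hRR : -R ≤ R := by linarith
  have hh : ∀ x, 0 < f x ^ 2 + ε ^ 2 := fun x => by positivity
  set g : (Fin (k + 1) → ℝ) → ℝ := fun x => (f x ^ 2 + ε ^ 2) ^ ((k : ℝ) / (k - 1)) with hgdef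
  have hg : ContDiff ℝ 1 g :=
    ((hf.pow 2).add contDiff_const).rpow_const_of_ne fun x => (hh x).ne'
  have hg0 : ∀ x, 0 < g x := fun x => Real.rpow_pos_of_pos (hh x) _
  have hgp : ∀ x, g x ^ (((k : ℝ) + 1) / k) = (f x ^ 2 + ε ^ 2) ^ (((k : ℝ) + 1) / (k - 1)) :=
    fun x => by
      simp only [hgdef]
      rw [← Real.rpow_mul (hh x).le]
      congr 1; field_simp
  have hgd : ∀ x i, fderiv ℝ g x (Pi.single i 1) = 2 * k / (k - 1) *
      ((f x ^ 2 + ε ^ 2) ^ (1 / ((k : ℝ) - 1)) * f x) * fderiv ℝ f x (Pi.single i 1) := by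
    intro x i
    have h1 := ((hf.differentiable one_ne_zero) x).hasFDerivAt
    have h2 := ((h1.pow 2).add_const (ε ^ 2)).rpow_const (p := (k : ℝ) / (k - 1))
      (Or.inl (hh x).ne')
    rw [show fderiv ℝ g x = _ from h2.fderiv]
    have e : (k : ℝ) / (k - 1) - 1 = 1 / (k - 1) := by field_simp; ring
    simp [e]
    ring
  set w : (Fin (k + 1) → ℝ) → ℝ := fun y => 1 + ∑ i, y i ^ 2 with hwdef
  have hw0 : ∀ y, 0 < w y := fun y => by positivity
  have hw : Continuous w := by fun_prop
  have hG : Continuous fun y => w y ^ (-((k : ℝ) + 1)) :=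
    hw.rpow_const fun y => Or.inl (hw0 y).ne'
  have hInt : ∀ {c : (Fin (k + 1) → ℝ) → ℝ}, Continuous c →
      IntegrableOn c (Set.Icc (fun _ => -R) (fun _ => R)) volume := fun hc =>
    hc.continuousOn.integrableOn_compact isCompact_Icc
  have hhc : ∀ p : ℝ, Continuous fun x => (f x ^ 2 + ε ^ 2) ^ p := fun p =>
    Continuous.rpow_const (by fun_prop) fun x => Or.inl (hh x).ne'
  have hq0 : 0 ≤ ((k : ℝ) + 1) / (k - 1) := by positivity
  have hden : A ≤ ∫ x in Set.Icc (fun _ => -R) (fun _ => R), g x ^ (((k : ℝ) + 1) / k) := by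
    refine hAf.trans (setIntegral_mono (hInt ?_) (hInt ?_) fun x => ?_)
    · exact Continuous.rpow_const (by fun_prop) fun x => Or.inr hq0
    · simp only [hgp]; exact hhc _
    · simp only [hgp]
      exact Real.rpow_le_rpow (by positivity) (by nlinarith [sq_nonneg ε]) hq0
  have hI₀n : 0 ≤ ∫ y in Set.Icc (fun _ => -R) (fun _ => R), w y ^ (-((k : ℝ) + 1)) :=
    integral_nonneg fun y => Real.rpow_nonneg (hw0 y).le _
  obtain ⟨T, hT, hpush, hmain⟩ := exists_transport_inequality (k := k) (by omega) hR hg hg0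
    (δ := (ε ^ 2) ^ ((k : ℝ) / (k - 1)))
    (fun x i hx => by simp [hgdef, hfR x i hx]) hG hw hw0 (fun _ => rfl) rfl
  set κ := (∫ y in Set.Icc (fun _ => -R) (fun _ => R), w y ^ (-((k : ℝ) + 1))) /
    ∫ x in Set.Icc (fun _ => -R) (fun _ => R), g x ^ (((k : ℝ) + 1) / k) with hκ
  have hκ0 : 0 ≤ κ := div_nonneg hI₀n (hA.le.trans hden)
  have hκK : κ ≤ I₀ / A := div_le_div₀ (hI₀n.trans hI₀) hI₀ hA hden
  have hwG : ∀ y, w y * w y ^ (-((k : ℝ) + 1)) = w y ^ (-(k : ℝ)) := fun y => by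
    conv_lhs => rw [← Real.rpow_one (w y), ← Real.rpow_mul (hw0 y).le, ← Real.rpow_add (hw0 y)]
    congr 1; ring
  simp only [hwG] at hmain
  have hfd : ∀ i : Fin (k + 1), Continuous fun x => fderiv ℝ f x (Pi.single i 1) := fun i =>
    (hf.continuous_fderiv one_ne_zero).clm_apply continuous_const
  set a : (Fin (k + 1) → ℝ) → ℝ := fun x => √(∑ i, (fderiv ℝ f x (Pi.single i 1)) ^ 2) with ha
  set b : (Fin (k + 1) → ℝ) → ℝ := fun x =>
    (f x ^ 2 + ε ^ 2) ^ (((k : ℝ) + 1) / (k - 1) / 2) * √(∑ i, T x i ^ 2) with hb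
  have hac : Continuous a := by fun_prop
  have hbc : Continuous b := (hhc _).mul (by fun_prop)
  have ha2 : ∀ x, a x ^ 2 = ∑ i, (fderiv ℝ f x (Pi.single i 1)) ^ 2 := fun x =>
    Real.sq_sqrt (by positivity)
  have hb2 : ∀ x, b x ^ 2 = (∑ i, T x i ^ 2) * g x ^ (((k : ℝ) + 1) / k) := fun x => by
    simp only [hb]
    rw [mul_pow, Real.sq_sqrt (by positivity), hgp, ← Real.rpow_natCast, ← Real.rpow_mul (hh x).le]
    rw [mul_comm]
    congr 2; push_cast; ring
  have hpt : ∀ x, -∑ i, fderiv ℝ g x (Pi.single i 1) * T x i ≤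
      2 * k / (k - 1) * (a x * b x) := by
    intro x
    have hcs := Finset.sum_mul_sq_le_sq_mul_sq Finset.univ
      (fun i => fderiv ℝ f x (Pi.single i 1)) (fun i => T x i)
    have habs : |∑ i, fderiv ℝ f x (Pi.single i 1) * T x i| ≤ a x * √(∑ i, T x i ^ 2) := by
      rw [ha, ← Real.sqrt_mul (by positivity)]
      exact Real.abs_le_sqrt hcs
    have hfa : |f x| ≤ (f x ^ 2 + ε ^ 2) ^ (1 / 2 : ℝ) := by
      rw [← Real.sqrt_eq_rpow]
      exact Real.abs_le_sqrt (by nlinarith [sq_nonneg ε])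
    have hexp : (f x ^ 2 + ε ^ 2) ^ (1 / ((k : ℝ) - 1)) * (f x ^ 2 + ε ^ 2) ^ (1 / 2 : ℝ) =
        (f x ^ 2 + ε ^ 2) ^ (((k : ℝ) + 1) / (k - 1) / 2) := by
      rw [← Real.rpow_add (hh x)]
      congr 1; field_simp; ring
    have hP : 0 < (f x ^ 2 + ε ^ 2) ^ (1 / ((k : ℝ) - 1)) := Real.rpow_pos_of_pos (hh x) _
    have hm : 0 < 2 * (k : ℝ) / (k - 1) := by positivity
    calc -∑ i, fderiv ℝ g x (Pi.single i 1) * T x i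
        = 2 * k / (k - 1) * ((f x ^ 2 + ε ^ 2) ^ (1 / ((k : ℝ) - 1)) *
          (-(f x * ∑ i, fderiv ℝ f x (Pi.single i 1) * T x i))) := by
          simp only [hgd, mul_assoc, ← Finset.mul_sum]
          ring
      _ ≤ 2 * k / (k - 1) * ((f x ^ 2 + ε ^ 2) ^ (1 / ((k : ℝ) - 1)) *
          ((f x ^ 2 + ε ^ 2) ^ (1 / 2 : ℝ) * (a x * √(∑ i, T x i ^ 2)))) := by
          have h1 : -(f x * ∑ i, fderiv ℝ f x (Pi.single i 1) * T x i) ≤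
              (f x ^ 2 + ε ^ 2) ^ (1 / 2 : ℝ) * (a x * √(∑ i, T x i ^ 2)) := by
            refine (neg_le_abs _).trans ?_
            rw [abs_mul]
            exact mul_le_mul hfa habs (abs_nonneg _) (Real.rpow_nonneg (hh x).le _)
          gcongr
      _ = _ := by
          simp only [hb]
          rw [← hexp]; ring
  have hcs := sq_setIntegral_mul_le (μ := volume)
    (isCompact_Icc (a := fun _ : Fin (k + 1) => -R) (b := fun _ => R)) hac hbc
  simp only [ha2] at hcs
  have hpI := hpush (fun y => ∑ i, y i ^ 2) (by fun_prop)
  simp only [← hb2] at hpI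
  set J := ∫ x in Set.Icc (fun _ => -R) (fun _ => R), a x * b x with hJ
  have hJ0 : 0 ≤ J := integral_nonneg fun x => by positivity
  have hb0 : 0 ≤ ∫ x in Set.Icc (fun _ => -R) (fun _ => R), b x ^ 2 :=
    integral_nonneg fun x => sq_nonneg _
  have hneg : -∫ x in Set.Icc (fun _ => -R) (fun _ => R),
      ∑ i, fderiv ℝ g x (Pi.single i 1) * T x i ≤ 2 * k / (k - 1) * J := by
    have hgfd : ∀ i : Fin (k + 1), Continuous fun x => fderiv ℝ g x (Pi.single i 1) := fun i =>
      (hg.continuous_fderiv one_ne_zero).clm_apply continuous_const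
    rw [← integral_neg, hJ, ← integral_const_mul]
    exact setIntegral_mono (hInt (by fun_prop)) (hInt (by fun_prop)) hpt
  have hκJ : κ ^ ((k : ℝ) / (k + 1)) * J ≤
      (I₀ / A) ^ (((k : ℝ) - 1) / (2 * (k + 1))) * √(E * I₂) := by
    have e1 : κ ^ ((k : ℝ) / (k + 1)) = κ ^ (((k : ℝ) - 1) / (2 * (k + 1))) * √κ := by
      rw [Real.sqrt_eq_rpow, ← Real.rpow_add' hκ0]
      · congr 1; field_simp; ring
      · have : 0 < ((k : ℝ) - 1) / (2 * (k + 1)) + 1 / 2 := by positivity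
        exact this.ne'
    have e2 : √κ * J ≤ √(E * I₂) := by
      apply Real.le_sqrt_of_sq_le
      rw [mul_pow, Real.sq_sqrt hκ0]
      have hE0 : 0 ≤ ∫ x in Set.Icc (fun _ => -R) (fun _ => R),
          ∑ i, (fderiv ℝ f x (Pi.single i 1)) ^ 2 := integral_nonneg fun x => by positivity
      calc κ * J ^ 2 ≤ κ * ((∫ x in Set.Icc (fun _ => -R) (fun _ => R),
            ∑ i, (fderiv ℝ f x (Pi.single i 1)) ^ 2) *
            ∫ x in Set.Icc (fun _ => -R) (fun _ => R), b x ^ 2) := by gcongr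
        _ = (∫ x in Set.Icc (fun _ => -R) (fun _ => R),
            ∑ i, (fderiv ℝ f x (Pi.single i 1)) ^ 2) *
            (κ * ∫ x in Set.Icc (fun _ => -R) (fun _ => R), b x ^ 2) := by ring
        _ ≤ E * I₂ := by
          refine mul_le_mul hE ?_ (mul_nonneg hκ0 hb0) (hE0.trans hE)
          rw [hpI]; exact hI₂
    rw [e1, mul_assoc]
    refine mul_le_mul (Real.rpow_le_rpow hκ0 hκK (by positivity)) e2 (by positivity) ?_
    exact Real.rpow_nonneg (hκ0.trans hκK) _
  refine hmain.trans ?_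
  rw [mul_sub, sub_eq_add_neg, ← mul_neg]
  refine add_le_add ?_ ?_
  · refine mul_le_mul_of_nonneg_right ?_ (by positivity)
    exact Real.rpow_le_rpow hκ0 hκK (by positivity)
  · calc _ ≤ κ ^ ((k : ℝ) / (k + 1)) * (2 * k / (k - 1) * J) :=
          mul_le_mul_of_nonneg_left hneg (Real.rpow_nonneg hκ0 _)
      _ = 2 * k / (k - 1) * (κ ^ ((k : ℝ) / (k + 1)) * J) := by ring
      _ ≤ 2 * k / (k - 1) *
          ((I₀ / A) ^ (((k : ℝ) - 1) / (2 * (k + 1))) * √(E * I₂)) := by gcongr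
      _ = _ := by ring

/-- The sharp Sobolev inequality in coordinates, proved by mass transport along the Knothe map. -/
theorem sobolev_pi {k : ℕ} (hk : 2 ≤ k) {f : (Fin (k + 1) → ℝ) → ℝ} (hf : ContDiff ℝ 1 f)
    (hfs : HasCompactSupport f) :
    sobolevConst (k + 1) *
        (∫ x, (f x ^ 2) ^ (((k : ℝ) + 1) / (k - 1))) ^ (((k : ℝ) - 1) / (k + 1)) ≤
      ∫ x, ∑ i, (fderiv ℝ f x (Pi.single i 1)) ^ 2 := by
  have hk2 : (2 : ℝ) ≤ k := by exact_mod_cast hk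
  have hk1 : (0 : ℝ) < (k : ℝ) - 1 := by linarith
  have hk0 : (0 : ℝ) < k := by linarith
  have hfc := hf.continuous
  set E := ∫ x, ∑ i, (fderiv ℝ f x (Pi.single i 1)) ^ 2 with hEdef
  set A := ∫ x, (f x ^ 2) ^ (((k : ℝ) + 1) / (k - 1)) with hAdef
  have hE0 : 0 ≤ E := integral_nonneg fun x => by positivity
  have hA0 : 0 ≤ A := integral_nonneg fun x => by positivity
  rcases hA0.eq_or_lt with hA | hA
  · rw [← hA, Real.zero_rpow (by positivity), mul_zero]
    exact hE0
  have hq0 : 0 < ((k : ℝ) + 1) / (k - 1) := by positivity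
  obtain ⟨R₀, hR₀⟩ := hfs.isCompact.isBounded.subset_ball (0 : Fin (k + 1) → ℝ)
  have hzero : ∀ R, R₀ ≤ R → 0 < R → ∀ x i, x i ∉ Set.Ioo (-R) R → f x = 0 := by
    intro R hR hRpos x i hx
    by_contra hne
    have h1 := hR₀ (subset_tsupport f hne)
    rw [mem_ball_zero_iff] at h1
    have h2 := abs_lt.1 (((norm_le_pi_norm x i).trans_lt h1).trans_le hR)
    exact hx h2
  set I₀ := ∫ y : Fin (k + 1) → ℝ, (1 + ∑ i, y i ^ 2) ^ (-((k : ℝ) + 1)) with hI₀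
  set I₁ := ∫ y : Fin (k + 1) → ℝ, (1 + ∑ i, y i ^ 2) ^ (-(k : ℝ)) with hI₁
  have hg₀ := integrable_and_integral_one_add_sum_sq_rpow (N := k + 1) (s := (k : ℝ) + 1)
    (by push_cast; linarith)
  have hg₁ := integrable_and_integral_one_add_sum_sq_rpow (N := k + 1) (s := (k : ℝ))
    (by push_cast; linarith)
  have hI₀v : I₀ = π ^ (((k : ℝ) + 1) / 2) * Real.Gamma (((k : ℝ) + 1) / 2) /
      Real.Gamma ((k : ℝ) + 1) := by
    rw [hI₀, hg₀.2]; push_cast; congr 3; ring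
  have hI₁v : I₁ = I₀ * (2 * k / (k - 1)) := by
    have e1 : Real.Gamma (((k : ℝ) + 1) / 2) =
        ((k : ℝ) - 1) / 2 * Real.Gamma (((k : ℝ) - 1) / 2) := by
      rw [← Real.Gamma_add_one (by positivity)]; congr 1; ring
    have hG : Real.Gamma (k : ℝ) ≠ 0 := (Real.Gamma_pos_of_pos hk0).ne'
    rw [hI₀v, hI₁, hg₁.2, e1, Real.Gamma_add_one hk0.ne']
    push_cast
    rw [show (k : ℝ) - (k + 1) / 2 = (k - 1) / 2 by ring]
    field_simp
  have hI₀p : 0 < I₀ := by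
    rw [hI₀v]
    have h1 := Real.Gamma_pos_of_pos (by positivity : 0 < ((k : ℝ) + 1) / 2)
    have h2 := Real.Gamma_pos_of_pos (by positivity : 0 < (k : ℝ) + 1)
    positivity
  have hwG : ∀ y : Fin (k + 1) → ℝ, (∑ i, y i ^ 2) * (1 + ∑ i, y i ^ 2) ^ (-((k : ℝ) + 1)) =
      (1 + ∑ i, y i ^ 2) ^ (-(k : ℝ)) - (1 + ∑ i, y i ^ 2) ^ (-((k : ℝ) + 1)) := fun y => by
    have hw0 : 0 < 1 + ∑ i, y i ^ 2 := by positivity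
    have : (1 + ∑ i, y i ^ 2) ^ (-(k : ℝ)) =
        (1 + ∑ i, y i ^ 2) * (1 + ∑ i, y i ^ 2) ^ (-((k : ℝ) + 1)) := by
      conv_rhs => rw [← Real.rpow_one (1 + ∑ i, y i ^ 2), ← Real.rpow_mul hw0.le,
        ← Real.rpow_add hw0]
      congr 1; ring
    rw [this]; ring
  have hI₂ : ∫ y : Fin (k + 1) → ℝ, (∑ i, y i ^ 2) * (1 + ∑ i, y i ^ 2) ^ (-((k : ℝ) + 1)) =
      I₁ - I₀ := by
    simp only [hwG]
    exact integral_sub hg₁.1 hg₀.1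
  have hgi₂ : Integrable fun y : Fin (k + 1) → ℝ =>
      (∑ i, y i ^ 2) * (1 + ∑ i, y i ^ 2) ^ (-((k : ℝ) + 1)) := by
    simp only [hwG]
    exact hg₁.1.sub hg₀.1
  have hEi : Integrable fun x => ∑ i, (fderiv ℝ f x (Pi.single i 1)) ^ 2 := by
    refine integrable_finsetSum _ fun i _ => Continuous.integrable_of_hasCompactSupport ?_ ?_
    · exact ((hf.continuous_fderiv one_ne_zero).clm_apply continuous_const).pow 2
    · exact (hfs.fderiv_apply (𝕜 := ℝ) (Pi.single i 1)).comp_left (g := fun t : ℝ => t ^ 2)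
        (by simp)
  have hfixR : ∀ R, R₀ ≤ R → 0 < R →
      ((k : ℝ) + 1) * ∫ y : Fin (k + 1) → ℝ in Set.Icc (fun _ => -R) (fun _ => R),
        (1 + ∑ i, y i ^ 2) ^ (-(k : ℝ)) ≤
      (I₀ / A) ^ (((k : ℝ) - 1) / (2 * (k + 1))) * (2 * k / (k - 1) * √(E * (I₁ - I₀))) := by
    intro R hRR₀ hR
    have hb : ∀ ε : ℝ, 0 < ε → _ := fun ε hε => transport_bound_regularized hk hR hε hf
      (hzero R hRR₀ hR)
      (setIntegral_le_integral hEi (Filter.Eventually.of_forall fun x => by positivity)) hA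
      (by
        rw [setIntegral_eq_integral_of_forall_compl_eq_zero]
        intro x hx
        obtain ⟨i, hi⟩ : ∃ i, x i ∉ Set.Ioo (-R) R := by
          by_contra! h
          exact hx ⟨fun i => (h i).1.le, fun i => (h i).2.le⟩
        rw [hzero R hRR₀ hR x i hi, zero_pow two_ne_zero, Real.zero_rpow hq0.ne'])
      (setIntegral_le_integral hg₀.1 (Filter.Eventually.of_forall fun x => by positivity))
      ((setIntegral_le_integral hgi₂ (Filter.Eventually.of_forall fun x => by positivity)).trans_eq
        hI₂)
    have hc : Continuous fun ε : ℝ => (I₀ / A) ^ ((k : ℝ) / (k + 1)) *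
        (((k : ℝ) + 1) * ((2 * R) ^ (k + 1) * (ε ^ 2) ^ ((k : ℝ) / (k - 1)))) +
      (I₀ / A) ^ (((k : ℝ) - 1) / (2 * (k + 1))) * (2 * k / (k - 1) * √(E * (I₁ - I₀))) := by
      have : Continuous fun ε : ℝ => (ε ^ 2) ^ ((k : ℝ) / (k - 1)) :=
        (continuous_pow 2).rpow_const fun _ => Or.inr (by positivity)
      fun_prop
    have ht := (hc.tendsto 0).mono_left (nhdsWithin_le_nhds (s := Set.Ioi 0))
    have hk3 : (k : ℝ) / (k - 1) ≠ 0 := by positivity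
    simp only [ne_eq, OfNat.ofNat_ne_zero, not_false_eq_true, zero_pow, Real.zero_rpow hk3,
      mul_zero, zero_add] at ht
    refine ge_of_tendsto ht ?_
    filter_upwards [self_mem_nhdsWithin] with ε hε using hb ε hε
  have hlim : ((k : ℝ) + 1) * I₁ ≤
      (I₀ / A) ^ (((k : ℝ) - 1) / (2 * (k + 1))) * (2 * k / (k - 1) * √(E * (I₁ - I₀))) := by
    have hcov : AECover (volume : Measure (Fin (k + 1) → ℝ)) Filter.atTop
        fun R : ℝ => Set.Icc (fun _ => -R) (fun _ => R) := by
      refine ⟨?_, fun _ => measurableSet_Icc⟩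
      refine Filter.Eventually.of_forall fun x => ?_
      filter_upwards [Filter.eventually_ge_atTop ‖x‖] with R hR
      have h := fun i => abs_le.1 ((norm_le_pi_norm x i).trans hR)
      exact ⟨fun i => (h i).1, fun i => (h i).2⟩
    have ht := (hcov.integral_tendsto_of_countably_generated hg₁.1).const_mul ((k : ℝ) + 1)
    refine le_of_tendsto ht ?_
    filter_upwards [Filter.eventually_ge_atTop R₀, Filter.eventually_gt_atTop 0] with R h1 h2
    exact hfixR R h1 h2
  have hdiff : I₁ - I₀ = I₀ * (((k : ℝ) + 1) / (k - 1)) := by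
    rw [hI₁v]; field_simp; ring
  have hsq := pow_le_pow_left₀ (by rw [hI₁v]; positivity) hlim 2
  have hK : ((I₀ / A) ^ (((k : ℝ) - 1) / (2 * (k + 1)))) ^ 2 =
      I₀ ^ (((k : ℝ) - 1) / (k + 1)) / A ^ (((k : ℝ) - 1) / (k + 1)) := by
    rw [← Real.rpow_natCast, ← Real.rpow_mul (by positivity), ← Real.div_rpow hI₀p.le hA0]
    congr 1; push_cast; field_simp
  have hX : 0 < A ^ (((k : ℝ) - 1) / (k + 1)) := Real.rpow_pos_of_pos hA _
  have hY : 0 < I₀ ^ (((k : ℝ) - 1) / (k + 1)) := Real.rpow_pos_of_pos hI₀p _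
  rw [mul_pow, mul_pow, mul_pow, Real.sq_sqrt (by rw [hdiff]; positivity), hK, hdiff,
    hI₁v] at hsq
  have hmain : ((k : ℝ) + 1) * (k - 1) * (I₀ / I₀ ^ (((k : ℝ) - 1) / (k + 1))) *
      A ^ (((k : ℝ) - 1) / (k + 1)) ≤ E := by
    set X := A ^ (((k : ℝ) - 1) / (k + 1))
    set Y := I₀ ^ (((k : ℝ) - 1) / (k + 1))
    have hc : 0 < (2 * (k : ℝ) / (k - 1)) ^ 2 * (I₀ * (((k : ℝ) + 1) / (k - 1))) * Y / X := by
      positivity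
    refine le_of_mul_le_mul_left ?_ hc
    calc _ = ((k : ℝ) + 1) ^ 2 * (I₀ * (2 * k / (k - 1))) ^ 2 := by field_simp
      _ ≤ _ := hsq
      _ = _ := by ring
  refine le_trans (le_of_eq ?_) hmain
  congr 1
  have e1 : I₀ / I₀ ^ (((k : ℝ) - 1) / (k + 1)) = I₀ ^ (2 / ((k : ℝ) + 1)) := by
    conv_lhs => rw [← Real.rpow_one I₀, ← Real.rpow_mul hI₀p.le, ← Real.rpow_sub hI₀p]
    congr 1; field_simp; ring
  have hΓ : 0 ≤ Real.Gamma (((k : ℝ) + 1) / 2) / Real.Gamma ((k : ℝ) + 1) :=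
    div_nonneg (Real.Gamma_nonneg_of_nonneg (by positivity))
      (Real.Gamma_nonneg_of_nonneg (by positivity))
  rw [e1, hI₀v, mul_div_assoc, Real.mul_rpow (by positivity) hΓ,
    ← Real.rpow_mul Real.pi_pos.le, sobolevConst]
  push_cast
  rw [show ((k : ℝ) + 1) / 2 * (2 / ((k : ℝ) + 1)) = 1 by field_simp, Real.rpow_one]
  ring

theorem norm_gradient_sq_eq_sum {n : ℕ} (w : EuclideanSpace ℝ (Fin n) → ℝ)
    (x : EuclideanSpace ℝ (Fin n)) :
    ‖gradient w x‖ ^ 2 = ∑ i, (fderiv ℝ w x (EuclideanSpace.single i 1)) ^ 2 := by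
  rw [EuclideanSpace.norm_sq_eq]
  refine Finset.sum_congr rfl fun i _ => ?_
  have h : fderiv ℝ w x (EuclideanSpace.single i 1) = gradient w x i := by
    simpa using EuclideanSpace.inner_single_right i (1 : ℝ) (gradient w x)
  rw [h, Real.norm_eq_abs, sq_abs]

/-- The sharp Sobolev inequality on Euclidean space. -/
theorem sobolev_euclidean {n : ℕ} (hn : 3 ≤ n) {w : EuclideanSpace ℝ (Fin n) → ℝ}
    (hw : ContDiff ℝ 1 w) (hws : HasCompactSupport w) :
    sobolevConst n * (∫ x, |w x| ^ (2 * (n : ℝ) / (n - 2))) ^ (((n : ℝ) - 2) / n) ≤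
      ∫ x, ‖gradient w x‖ ^ 2 := by
  obtain ⟨k, rfl⟩ : ∃ k, n = k + 1 := ⟨n - 1, by omega⟩
  have hmp := EuclideanSpace.volume_preserving_symm_measurableEquiv_toLp (Fin (k + 1))
  set e := (EuclideanSpace.equiv (Fin (k + 1)) ℝ).symm with he
  have hf : ContDiff ℝ 1 fun x => w (e x) := hw.comp e.contDiff
  have hfs : HasCompactSupport fun x => w (e x) := hws.comp_homeomorph e.toHomeomorph
  have hInt : ∀ g : EuclideanSpace ℝ (Fin (k + 1)) → ℝ, ∫ x, g (e x) = ∫ x, g x := fun g =>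
    MeasurePreserving.integral_comp' hmp.symm g
  have h := sobolev_pi (by omega) hf hfs
  have h1 : ∀ x, ∑ i, (fderiv ℝ (fun x => w (e x)) x (Pi.single i 1)) ^ 2 =
      ‖gradient w (e x)‖ ^ 2 := fun x => by
    rw [norm_gradient_sq_eq_sum]
    refine Finset.sum_congr rfl fun i _ => ?_
    rw [show (fun x => w (e x)) = w ∘ e from rfl, e.comp_right_fderiv]
    rfl
  simp only [h1] at h
  rw [hInt fun y => ‖gradient w y‖ ^ 2,
    hInt fun y => (w y ^ 2) ^ (((k : ℝ) + 1) / (k - 1))] at h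
  refine le_trans (le_of_eq ?_) h
  have h2 : ∀ x, |w x| ^ (2 * ((k + 1 : ℕ) : ℝ) / ((k + 1 : ℕ) - 2)) =
      (w x ^ 2) ^ (((k : ℝ) + 1) / (k - 1)) := fun x => by
    rw [← sq_abs, ← Real.rpow_natCast, ← Real.rpow_mul (abs_nonneg _)]
    congr 1; push_cast; ring
  simp only [h2]
  congr 2
  push_cast; ring

section Polar

variable {E : Type*} [NormedAddCommGroup E] [NormedSpace ℝ E] [FiniteDimensional ℝ E]
  [Nontrivial E] [MeasurableSpace E] [BorelSpace E] {μ : Measure E} [μ.IsAddHaarMeasure]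

theorem integral_volumeIoiPow (d : ℕ) (g : ℝ → ℝ) :
    ∫ r, g r.1 ∂Measure.volumeIoiPow d = ∫ r in Set.Ioi (0 : ℝ), r ^ d * g r := by
  simp only [Measure.volumeIoiPow, ENNReal.ofReal]
  rw [integral_withDensity_eq_integral_smul,
    integral_subtype_comap measurableSet_Ioi fun a ↦ Real.toNNReal (a ^ d) • g a,
    setIntegral_congr_fun measurableSet_Ioi fun x hx ↦ ?_]
  · change 0 < x at hx
    simp only [NNReal.smul_def, Real.coe_toNNReal _ (pow_nonneg hx.le _), smul_eq_mul]
  · exact (measurable_subtype_coe.pow_const _).real_toNNReal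

/-- Integration in polar coordinates. -/
theorem integrable_and_integral_eq_integral_sphere {f : E → ℝ} (hf : Integrable f μ) :
    Integrable (fun ω : Metric.sphere (0 : E) 1 =>
      ∫ r in Set.Ioi (0 : ℝ), r ^ (Module.finrank ℝ E - 1) * f (r • ω.1)) μ.toSphere ∧
    ∫ x, f x ∂μ = ∫ ω : Metric.sphere (0 : E) 1,
      (∫ r in Set.Ioi (0 : ℝ), r ^ (Module.finrank ℝ E - 1) * f (r • ω.1)) ∂μ.toSphere := by
  set g : Metric.sphere (0 : E) 1 × Set.Ioi (0 : ℝ) → ℝ := fun p => f (p.2.1 • p.1.1) with hg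
  have hmp := μ.measurePreserving_homeomorphUnitSphereProd
  have hemb := (homeomorphUnitSphereProd E).measurableEmbedding
  have hcomp : ∀ x : ({0}ᶜ : Set E), g (homeomorphUnitSphereProd E x) = f x := fun x => by
    have h := congrArg Subtype.val ((homeomorphUnitSphereProd E).symm_apply_apply x)
    rw [homeomorphUnitSphereProd_symm_apply_coe] at h
    rw [hg]
    exact congrArg f h
  have hgi : Integrable g (μ.toSphere.prod (Measure.volumeIoiPow (Module.finrank ℝ E - 1))) := by
    rw [← hmp.integrable_comp_emb hemb]
    rw [← restrict_compl_singleton (μ := μ) 0, ← IntegrableOn,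
      integrableOn_iff_comap_subtypeVal (measurableSet_singleton _).compl] at hf
    exact hf.congr (Filter.Eventually.of_forall fun x => (hcomp x).symm)
  have h1 := hgi.integral_prod_left
  simp only [hg, fun ω : Metric.sphere (0 : E) 1 =>
    integral_volumeIoiPow (Module.finrank ℝ E - 1) fun r => f (r • ω.1)] at h1
  refine ⟨h1, ?_⟩
  calc ∫ x, f x ∂μ = ∫ x : ({0}ᶜ : Set E), f x ∂(μ.comap (↑)) := by
        rw [integral_subtype_comap (measurableSet_singleton _).compl f,
          restrict_compl_singleton]
    _ = ∫ p, g p ∂μ.toSphere.prod (.volumeIoiPow (Module.finrank ℝ E - 1)) := by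
        rw [← hmp.integral_comp hemb g]
        exact integral_congr_ae (Filter.Eventually.of_forall fun x => (hcomp x).symm)
    _ = _ := by
        rw [integral_prod _ hgi]
        simp only [hg, fun ω : Metric.sphere (0 : E) 1 =>
          integral_volumeIoiPow (Module.finrank ℝ E - 1) fun r => f (r • ω.1)]

theorem integral_le_integral_of_forall_sphere {f g : E → ℝ} (hf : Integrable f μ)
    (hg : Integrable g μ)
    (h : ∀ ω : E, ‖ω‖ = 1 →
      ∫ r in Set.Ioi (0 : ℝ), r ^ (Module.finrank ℝ E - 1) * f (r • ω) ≤
        ∫ r in Set.Ioi (0 : ℝ), r ^ (Module.finrank ℝ E - 1) * g (r • ω)) :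
    ∫ x, f x ∂μ ≤ ∫ x, g x ∂μ := by
  obtain ⟨hf1, hf2⟩ := integrable_and_integral_eq_integral_sphere hf
  obtain ⟨hg1, hg2⟩ := integrable_and_integral_eq_integral_sphere hg
  rw [hf2, hg2]
  exact integral_mono hf1 hg1 fun ω => h ω.1 (mem_sphere_zero_iff_norm.1 ω.2)

end Polar

/-- The decreasing bijection `ρ` from `(0, 1)` onto `(1, ∞)` satisfying
`1 + (m + 1) * log (ρ r) = (r ^ (m + 1))⁻¹`. -/
noncomputable def radialMap (m : ℕ) (r : ℝ) : ℝ := rexp (((r ^ (m + 1))⁻¹ - 1) / (m + 1))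

theorem radialMap_pos (m : ℕ) (r : ℝ) : 0 < radialMap m r := Real.exp_pos _

theorem one_add_mul_log_radialMap (m : ℕ) (r : ℝ) :
    1 + ((m : ℝ) + 1) * Real.log (radialMap m r) = (r ^ (m + 1))⁻¹ := by
  rw [radialMap, Real.log_exp]
  field_simp
  ring

theorem hasDerivAt_radialMap (m : ℕ) {r : ℝ} (hr : 0 < r) :
    HasDerivAt (radialMap m) (-(radialMap m r / r ^ (m + 2))) r := by
  have h := ((((hasDerivAt_pow (m + 1) r).inv (by positivity)).sub_const 1).div_const
    ((m : ℝ) + 1)).exp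
  refine h.congr_deriv ?_
  change radialMap m r * _ = _
  simp only [Nat.add_sub_cancel]
  push_cast
  field_simp
  ring

theorem radialMap_le_one (m : ℕ) {r : ℝ} (hr : 1 ≤ r) : radialMap m r ≤ 1 := by
  rw [radialMap, Real.exp_le_one_iff]
  have h : (r ^ (m + 1))⁻¹ ≤ 1 := inv_le_one_of_one_le₀ (one_le_pow₀ hr)
  exact div_nonpos_of_nonpos_of_nonneg (by linarith) (by positivity)

theorem injOn_radialMap (m : ℕ) : Set.InjOn (radialMap m) (Set.Ioi 0) := by
  intro r hr s hs h
  have h1 := one_add_mul_log_radialMap m r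
  rw [h, one_add_mul_log_radialMap m s, inv_inj] at h1
  exact (pow_left_inj₀ (le_of_lt hr) (le_of_lt hs) (by omega)).1 h1.symm

theorem image_radialMap (m : ℕ) :
    radialMap m '' Set.Ioi 0 = Set.Ioi (rexp (-1 / ((m : ℝ) + 1))) := by
  ext s
  constructor
  · rintro ⟨r, hr, rfl⟩
    have hr' : 0 < (r ^ (m + 1))⁻¹ := inv_pos.2 (pow_pos hr _)
    refine Real.exp_lt_exp.2 ?_
    gcongr
    linarith
  · intro hs
    have hs0 : 0 < s := (Real.exp_pos _).trans hs
    have h1 : -1 / ((m : ℝ) + 1) < Real.log s := (Real.lt_log_iff_exp_lt hs0).2 hs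
    have h2 : 0 < 1 + ((m : ℝ) + 1) * Real.log s := by
      rw [div_lt_iff₀ (by positivity)] at h1
      linarith
    refine ⟨((1 + ((m : ℝ) + 1) * Real.log s)⁻¹) ^ (((m + 1 : ℕ) : ℝ)⁻¹),
      Real.rpow_pos_of_pos (inv_pos.2 h2) _, ?_⟩
    rw [radialMap, Real.rpow_inv_natCast_pow (inv_pos.2 h2).le (by omega), inv_inv,
      add_sub_cancel_left, mul_div_cancel_left₀ _ (by positivity), Real.exp_log hs0]

theorem setIntegral_radialMap (m : ℕ) {G : ℝ → ℝ} (hG : ∀ s, 0 < s → s ≤ 1 → G s = 0) :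
    ∫ r in Set.Ioi (0 : ℝ), radialMap m r / r ^ (m + 2) * G (radialMap m r) =
      ∫ s in Set.Ioi (0 : ℝ), G s := by
  have h := integral_image_eq_integral_abs_deriv_smul measurableSet_Ioi
    (fun r hr => (hasDerivAt_radialMap m (Set.mem_Ioi.1 hr)).hasDerivWithinAt)
    (injOn_radialMap m) G
  rw [image_radialMap] at h
  rw [setIntegral_eq_of_subset_of_forall_sdiff_eq_zero (f := G) measurableSet_Ioi
    (Set.Ioi_subset_Ioi (Real.exp_pos (-1 / ((m : ℝ) + 1))).le) fun s hs => ?_, h]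
  · refine setIntegral_congr_fun measurableSet_Ioi fun r hr => ?_
    have h1 : 0 ≤ radialMap m r / r ^ (m + 2) :=
      div_nonneg (radialMap_pos m r).le (pow_nonneg (Set.mem_Ioi.1 hr).le _)
    simp only [abs_neg, abs_of_nonneg h1, smul_eq_mul]
  · refine hG s hs.1 ((not_lt.1 hs.2).trans ?_)
    rw [Real.exp_le_one_iff]
    exact div_nonpos_of_nonpos_of_nonneg (by norm_num) (by positivity)

section RadialGradient

variable {E : Type*} [NormedAddCommGroup E] [InnerProductSpace ℝ E]

theorem hasFDerivAt_norm_of_ne_zero {y : E} (hy : y ≠ 0) :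
    HasFDerivAt (fun x : E => ‖x‖) (‖y‖⁻¹ • innerSL ℝ y) y := by
  have hn : 0 < ‖y‖ := norm_pos_iff.2 hy
  have h := (hasStrictFDerivAt_norm_sq y).hasFDerivAt.sqrt (by positivity)
  simp only [Real.sqrt_sq (norm_nonneg _)] at h
  refine h.congr_fderiv ?_
  ext v
  simp
  field_simp

/-- The gradient of `y ↦ A ‖y‖ * u (B ‖y‖ • y)`, split into radial and tangential parts. -/
theorem norm_gradient_radial_sq [CompleteSpace E] {A B : ℝ → ℝ} {A' B' r : ℝ} {u : E → ℝ} {ω : E}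
    (hω : ‖ω‖ = 1) (hr : 0 < r) (hA : HasDerivAt A A' r) (hB : HasDerivAt B B' r)
    (hu : DifferentiableAt ℝ u ((B r * r) • ω)) :
    ‖gradient (fun y => A ‖y‖ * u (B ‖y‖ • y)) (r • ω)‖ ^ 2 =
      (A r * (B' * r + B r) * inner ℝ (gradient u ((B r * r) • ω)) ω +
        A' * u ((B r * r) • ω)) ^ 2 +
      (A r * B r) ^ 2 * (‖gradient u ((B r * r) • ω)‖ ^ 2 -
        inner ℝ (gradient u ((B r * r) • ω)) ω ^ 2) := by
  have hn : ‖r • ω‖ = r := by rw [norm_smul, hω, mul_one, Real.norm_of_nonneg hr.le]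
  have hne : r • ω ≠ 0 := norm_pos_iff.1 (hr.trans_eq hn.symm)
  have hN := hasFDerivAt_norm_of_ne_zero hne
  rw [hn] at hN
  have hAN : HasFDerivAt (fun y : E => A ‖y‖) (A' • (r⁻¹ • innerSL ℝ (r • ω))) (r • ω) :=
    HasDerivAt.comp_hasFDerivAt_of_eq _ hA hN hn.symm
  have hBN : HasFDerivAt (fun y : E => B ‖y‖) (B' • (r⁻¹ • innerSL ℝ (r • ω))) (r • ω) :=
    HasDerivAt.comp_hasFDerivAt_of_eq _ hB hN hn.symm
  have hpt : B ‖r • ω‖ • (r • ω) = (B r * r) • ω := by rw [hn, smul_smul]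
  set h := gradient u ((B r * r) • ω) with hh
  have hU : HasFDerivAt u (InnerProductSpace.toDual ℝ E h) (B ‖r • ω‖ • (r • ω)) :=
    hpt ▸ hu.hasGradientAt.hasFDerivAt
  have hUN : HasFDerivAt (fun y : E => u (B ‖y‖ • y)) _ (r • ω) :=
    HasFDerivAt.comp (f := fun y : E => B ‖y‖ • y) (r • ω) hU
      (hBN.smul (hasFDerivAt_id (r • ω)))
  have hw : HasGradientAt (fun y => A ‖y‖ * u (B ‖y‖ • y))
      ((A r * B r) • h + (A' * u ((B r * r) • ω) + A r * B' * r * inner ℝ h ω) • ω) (r • ω) := by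
    rw [hasGradientAt_iff_hasFDerivAt]
    refine (hAN.mul hUN).congr_fderiv ?_
    ext v
    simp [hn, smul_smul]
    field_simp
    ring
  rw [hw.gradient, norm_add_sq_real, norm_smul, norm_smul, hω, mul_pow, mul_pow,
    Real.norm_eq_abs, Real.norm_eq_abs, sq_abs, sq_abs, real_inner_smul_left,
    real_inner_smul_right]
  ring

end RadialGradient

section Transplant

variable {E : Type*} [NormedAddCommGroup E] [InnerProductSpace ℝ E] {m : ℕ} {u : E → ℝ}

/-- The function obtained from `u` by the radial change of variables `radialMap`. -/
noncomputable def transplant (m : ℕ) (u : E → ℝ) (y : E) : ℝ :=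
  radialMap m ‖y‖ ^ (((m : ℝ) + 1) / 2) * u ((radialMap m ‖y‖ / ‖y‖) • y)

theorem tendsto_radialMap_nhdsGT_zero (m : ℕ) :
    Filter.Tendsto (radialMap m) (nhdsWithin 0 (Set.Ioi 0)) Filter.atTop := by
  have h1 : Filter.Tendsto (fun r : ℝ => r ^ (m + 1)) (nhdsWithin 0 (Set.Ioi 0))
      (nhdsWithin 0 (Set.Ioi 0)) := by
    refine tendsto_nhdsWithin_iff.2 ⟨?_, ?_⟩
    · have := (continuous_pow (M := ℝ) (m + 1)).tendsto 0
      rw [zero_pow (by omega)] at this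
      exact this.mono_left nhdsWithin_le_nhds
    · filter_upwards [self_mem_nhdsWithin] with r hr using pow_pos (Set.mem_Ioi.1 hr) _
  exact Real.tendsto_exp_atTop.comp
    ((Filter.tendsto_atTop_add_const_right _ (-1) (tendsto_inv_nhdsGT_zero.comp h1)).atTop_div_const
      (by positivity))

theorem norm_radialMap_div_smul {y : E} (hy : y ≠ 0) :
    ‖(radialMap m ‖y‖ / ‖y‖) • y‖ = radialMap m ‖y‖ := by
  rw [norm_smul, Real.norm_of_nonneg (div_nonneg (radialMap_pos m _).le (norm_nonneg _)),
    div_mul_cancel₀ _ (norm_ne_zero_iff.2 hy)]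

theorem transplant_eq_zero_of_one_le (hu : ∀ x, ‖x‖ ≤ 1 → u x = 0) {y : E} (hy : 1 ≤ ‖y‖) :
    transplant m u y = 0 := by
  have hy0 : y ≠ 0 := norm_pos_iff.1 (zero_lt_one.trans_le hy)
  rw [transplant, hu _ ((norm_radialMap_div_smul hy0).trans_le (radialMap_le_one m hy)), mul_zero]

theorem eventually_transplant_eq_zero (hu : ∀ x, ‖x‖ ≤ 1 → u x = 0) (hcs : HasCompactSupport u) :
    ∀ᶠ y in nhds (0 : E), transplant m u y = 0 := by
  obtain ⟨R, hR⟩ := hcs.isCompact.isBounded.subset_ball (0 : E)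
  have h1 : ∀ᶠ y in nhdsWithin (0 : E) {0}ᶜ, R ≤ radialMap m ‖y‖ :=
    ((tendsto_radialMap_nhdsGT_zero m).comp tendsto_norm_nhdsNE_zero).eventually_ge_atTop R
  rw [eventually_nhdsWithin_iff] at h1
  filter_upwards [h1] with y hy
  rw [transplant]
  by_cases hy0 : y = 0
  · rw [hu _ (by simp [hy0]), mul_zero]
  · rw [image_eq_zero_of_notMem_tsupport (f := u), mul_zero]
    intro h
    have h2 := hR h
    rw [mem_ball_zero_iff, norm_radialMap_div_smul hy0] at h2
    exact (hy hy0).not_gt h2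

theorem contDiff_transplant (hu : ∀ x, ‖x‖ ≤ 1 → u x = 0) (hcs : HasCompactSupport u)
    (hu1 : ContDiff ℝ 1 u) : ContDiff ℝ 1 (transplant m u) := by
  refine contDiff_iff_contDiffAt.2 fun y => ?_
  by_cases hy : y = 0
  · rw [hy]
    exact (contDiffAt_const (c := (0 : ℝ))).congr_of_eventuallyEq
      (eventually_transplant_eq_zero hu hcs)
  · have hN : ContDiffAt ℝ 1 (fun y : E => ‖y‖) y := contDiffAt_norm ℝ hy
    have hy' : ‖y‖ ≠ 0 := norm_ne_zero_iff.2 hy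
    have hρ : ContDiffAt ℝ 1 (fun y : E => radialMap m ‖y‖) y :=
      ((((hN.pow (m + 1)).inv (pow_ne_zero _ hy')).sub contDiffAt_const).div_const _).exp
    exact (hρ.rpow_const_of_ne (radialMap_pos m _).ne').mul
      (hu1.contDiffAt.comp y ((hρ.div hN hy').smul contDiffAt_id))

theorem hasCompactSupport_transplant [ProperSpace E] (hu : ∀ x, ‖x‖ ≤ 1 → u x = 0) :
    HasCompactSupport (transplant m u) := by
  refine HasCompactSupport.intro (isCompact_closedBall (0 : E) 1) fun y hy => ?_
  rw [mem_closedBall_zero_iff, not_le] at hy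
  exact transplant_eq_zero_of_one_le hu hy.le

theorem transplant_smul {ω : E} (hω : ‖ω‖ = 1) {r : ℝ} (hr : 0 < r) :
    transplant m u (r • ω) = radialMap m r ^ (((m : ℝ) + 1) / 2) * u (radialMap m r • ω) := by
  rw [transplant, norm_smul, hω, mul_one, Real.norm_of_nonneg hr.le, smul_smul,
    div_mul_cancel₀ _ hr.ne']

theorem pow_mul_abs_transplant_rpow {ω : E} (hω : ‖ω‖ = 1) {r : ℝ} (hr : 0 < r) :
    r ^ (m + 2) * |transplant m u (r • ω)| ^ (2 * ((m : ℝ) + 3) / (m + 1)) =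
      radialMap m r / r ^ (m + 2) * (radialMap m r ^ (m + 2) *
        (((1 + ((m : ℝ) + 1) * Real.log (radialMap m r))⁻¹) ^ (2 * ((m : ℝ) + 2) / (m + 1)) *
          |u (radialMap m r • ω)| ^ (2 * ((m : ℝ) + 3) / (m + 1)))) := by
  rw [transplant_smul hω hr, one_add_mul_log_radialMap, inv_inv]
  have hs := radialMap_pos m r
  set s := radialMap m r
  rw [abs_mul, abs_of_pos (Real.rpow_pos_of_pos hs _),
    Real.mul_rpow (Real.rpow_pos_of_pos hs _).le (abs_nonneg _), ← Real.rpow_mul hs.le,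
    show ((m : ℝ) + 1) / 2 * (2 * ((m : ℝ) + 3) / (m + 1)) = ((m + 3 : ℕ) : ℝ) by
      push_cast; field_simp, Real.rpow_natCast, ← Real.rpow_natCast_mul hr.le,
    show ((m + 1 : ℕ) : ℝ) * (2 * ((m : ℝ) + 2) / (m + 1)) = ((2 * (m + 2) : ℕ) : ℝ) by
      push_cast; field_simp, Real.rpow_natCast]
  field_simp
  ring

theorem pow_mul_norm_gradient_transplant_sq [CompleteSpace E] (hu : Differentiable ℝ u) {ω : E}
    (hω : ‖ω‖ = 1) {r : ℝ} (hr : 0 < r) :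
    r ^ (m + 2) * ‖gradient (transplant m u) (r • ω)‖ ^ 2 =
      radialMap m r / r ^ (m + 2) * (radialMap m r ^ m *
        (radialMap m r * inner ℝ (gradient u (radialMap m r • ω)) ω +
          ((m : ℝ) + 1) / 2 * u (radialMap m r • ω)) ^ 2 +
        radialMap m r ^ (m + 2) * ((1 + ((m : ℝ) + 1) * Real.log (radialMap m r))⁻¹) ^ 2 *
        (‖gradient u (radialMap m r • ω)‖ ^ 2 -
          inner ℝ (gradient u (radialMap m r • ω)) ω ^ 2)) := by
  have hs := radialMap_pos m r
  have hρ := hasDerivAt_radialMap m hr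
  have hBr : radialMap m r / r * r = radialMap m r := div_mul_cancel₀ _ hr.ne'
  have h := norm_gradient_radial_sq (u := u) hω hr
    (hρ.rpow_const (p := ((m : ℝ) + 1) / 2) (Or.inl hs.ne'))
    (hρ.div (hasDerivAt_id r) hr.ne') (hu _)
  simp only [Pi.div_apply, id, hBr] at h
  rw [one_add_mul_log_radialMap, inv_inv]
  have hA2 : (radialMap m r ^ (((m : ℝ) + 1) / 2)) ^ 2 = radialMap m r ^ (m + 1) := by
    rw [← Real.rpow_natCast, ← Real.rpow_mul hs.le, ← Real.rpow_natCast]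
    congr 1; push_cast; ring
  rw [Real.rpow_sub_one hs.ne'] at h
  refine (congrArg (r ^ (m + 2) * ·) h).trans ?_
  set A := radialMap m r ^ (((m : ℝ) + 1) / 2)
  set s := radialMap m r
  set p := inner ℝ (gradient u (s • ω)) ω
  set H := ‖gradient u (s • ω)‖ ^ 2
  set v := u (s • ω)
  have e : (A * ((-(s / r ^ (m + 2)) * r - s * 1) / r ^ 2 * r + s / r) * p +
        -(s / r ^ (m + 2)) * (((m : ℝ) + 1) / 2) * (A / s) * v) ^ 2 +
      (A * (s / r)) ^ 2 * (H - p ^ 2) =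
      A ^ 2 * ((s * p + ((m : ℝ) + 1) / 2 * v) ^ 2 / (r ^ (m + 2)) ^ 2 +
        (s / r) ^ 2 * (H - p ^ 2)) := by
    field_simp
    ring
  change r ^ (m + 2) * _ = _
  rw [e, hA2]
  field_simp
  ring

end Transplant

theorem continuous_sq_div_norm_sq {E : Type*} [NormedAddCommGroup E] {u : E → ℝ}
    (hu0 : ∀ x, ‖x‖ ≤ 1 → u x = 0) (hu : Continuous u) :
    Continuous fun x => u x ^ 2 / ‖x‖ ^ 2 := by
  have h : (fun x => u x ^ 2 / ‖x‖ ^ 2) = fun x => u x ^ 2 / max 1 ‖x‖ ^ 2 := by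
    ext x
    rcases le_total ‖x‖ 1 with hx | hx
    · simp [hu0 x hx]
    · rw [max_eq_right hx]
  rw [h]
  exact (hu.pow 2).div ((continuous_const.max continuous_norm).pow 2) fun x =>
    pow_ne_zero _ (zero_lt_one.trans_le (le_max_left _ _)).ne'

theorem continuous_inv_log_rpow_mul {E : Type*} [NormedAddCommGroup E] {u : E → ℝ}
    {c d p q : ℝ} (hc : 0 < c) (hd : 0 ≤ d) (hp : 0 ≤ p) (hq : 0 < q) (hu0 : ∀ x, ‖x‖ ≤ 1 → u x = 0) (hu : Continuous u) :
    Continuous fun x => ((c + d * Real.log ‖x‖)⁻¹) ^ p * |u x| ^ q := by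
  have h : (fun x => ((c + d * Real.log ‖x‖)⁻¹) ^ p * |u x| ^ q) =
      fun x => ((c + d * Real.log (max 1 ‖x‖))⁻¹) ^ p * |u x| ^ q := by
    ext x
    rcases le_total ‖x‖ 1 with hx | hx
    · simp [hu0 x hx, hq.ne']
    · rw [max_eq_right hx]
  rw [h]
  have h1 : Continuous fun x : E => max 1 ‖x‖ := continuous_const.max continuous_norm
  have h2 : ∀ x : E, 1 ≤ max 1 ‖x‖ := fun x => le_max_left _ _
  have h3 : Continuous fun x : E => Real.log (max 1 ‖x‖) :=
    h1.log fun x => (zero_lt_one.trans_le (h2 x)).ne'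
  have h4 : ∀ x : E, c + d * Real.log (max 1 ‖x‖) ≠ 0 := fun x =>
    (add_pos_of_pos_of_nonneg hc (mul_nonneg hd (Real.log_nonneg (h2 x)))).ne'
  exact (((continuous_const.add (continuous_const.mul h3)).inv₀ h4).rpow_const
    fun _ => Or.inr hp).mul (hu.abs.rpow_const fun _ => Or.inr hq.le)

section HardySobolev

variable {E : Type*} [NormedAddCommGroup E] [InnerProductSpace ℝ E] {m : ℕ} {u : E → ℝ}

theorem HasCompactSupport.comp_smul_unit {f : E → ℝ} (hf : HasCompactSupport f) {ω : E}
    (hω : ‖ω‖ = 1) : HasCompactSupport fun s : ℝ => f (s • ω) := by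
  obtain ⟨R, hR⟩ := hf.isCompact.isBounded.subset_closedBall (0 : E)
  refine HasCompactSupport.intro (isCompact_closedBall (0 : ℝ) R) fun s hs => ?_
  refine image_eq_zero_of_notMem_tsupport fun h => hs ?_
  simpa [mem_closedBall_zero_iff, norm_smul, hω] using hR h

theorem gradient_eq_zero_of_notMem_tsupport [CompleteSpace E] {x : E} (hx : x ∉ tsupport u) :
    gradient u x = 0 := by
  rw [gradient, fderiv_of_notMem_tsupport (𝕜 := ℝ) hx, map_zero]

theorem continuous_gradient [CompleteSpace E] (hu : ContDiff ℝ 1 u) : Continuous (gradient u) :=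
  (InnerProductSpace.toDual ℝ E).symm.continuous.comp (hu.continuous_fderiv one_ne_zero)

theorem hasCompactSupport_norm_gradient_sq [CompleteSpace E] (hcs : HasCompactSupport u) :
    HasCompactSupport fun x => ‖gradient u x‖ ^ 2 :=
  HasCompactSupport.intro hcs.isCompact fun x hx => by
    simp [gradient_eq_zero_of_notMem_tsupport hx]

variable [FiniteDimensional ℝ E]

theorem setIntegral_norm_gradient_transplant_le (hu : ContDiff ℝ 1 u) (hcs : HasCompactSupport u)
    (hsupp : ∀ x ∈ tsupport u, 1 < ‖x‖) {ω : E} (hω : ‖ω‖ = 1) :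
    ∫ r in Set.Ioi (0 : ℝ), r ^ (m + 2) * ‖gradient (transplant m u) (r • ω)‖ ^ 2 ≤
      ∫ r in Set.Ioi (0 : ℝ), r ^ (m + 2) *
        (‖gradient u (r • ω)‖ ^ 2 - (((m : ℝ) + 1) / 2) ^ 2 * (u (r • ω) ^ 2 / ‖r • ω‖ ^ 2)) := by
  have hu0 : ∀ x, ‖x‖ ≤ 1 → u x = 0 := fun x hx =>
    image_eq_zero_of_notMem_tsupport fun h => (hsupp x h).not_ge hx
  have hg0 : ∀ x, ‖x‖ ≤ 1 → gradient u x = 0 := fun x hx =>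
    gradient_eq_zero_of_notMem_tsupport fun h => (hsupp x h).not_ge hx
  have hud := hu.differentiable one_ne_zero
  set α := ((m : ℝ) + 1) / 2 with hα
  set G : ℝ → ℝ := fun s => s ^ m * (s * inner ℝ (gradient u (s • ω)) ω + α * u (s • ω)) ^ 2 +
    s ^ (m + 2) * ((1 + ((m : ℝ) + 1) * Real.log s)⁻¹) ^ 2 *
      (‖gradient u (s • ω)‖ ^ 2 - inner ℝ (gradient u (s • ω)) ω ^ 2) with hG
  set P : ℝ → ℝ := fun s => s ^ (m + 1) * u (s • ω) ^ 2 with hP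
  have hline : ∀ s : ℝ, HasDerivAt (fun s : ℝ => u (s • ω)) (inner ℝ (gradient u (s • ω)) ω) s :=
    fun s => by
      have h : HasDerivAt (fun s : ℝ => u (s • ω)) _ s :=
        HasFDerivAt.comp_hasDerivAt (f := fun s : ℝ => s • ω) s
          (hud (s • ω)).hasGradientAt.hasFDerivAt ((hasDerivAt_id s).smul_const ω)
      exact h.congr_deriv (by simp)
  have hPd : ∀ s, HasDerivAt P (((m : ℝ) + 1) * s ^ m * u (s • ω) ^ 2 +
      s ^ (m + 1) * (2 * u (s • ω) * inner ℝ (gradient u (s • ω)) ω)) s := fun s => by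
    refine ((hasDerivAt_pow (m + 1) s).mul ((hline s).pow 2)).congr_deriv ?_
    simp only [Nat.add_sub_cancel, Pi.pow_apply]
    push_cast
    ring
  have hur : ContDiff ℝ 1 fun s : ℝ => u (s • ω) := hu.comp (contDiff_id.smul contDiff_const)
  have hurs : HasCompactSupport fun s : ℝ => u (s • ω) := hcs.comp_smul_unit hω
  have hP1 : ContDiff ℝ 1 P := (contDiff_id.pow _).mul (hur.pow 2)
  have hPs : HasCompactSupport P := (hurs.comp_left (g := fun t : ℝ => t ^ 2) (by simp)).mul_left
  have hPint : ∫ s in Set.Ioi (0 : ℝ), deriv P s = 0 := by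
    rw [hPs.integral_Ioi_deriv_eq hP1]
    simp [hP]
  have hPi : IntegrableOn (deriv P) (Set.Ioi 0) :=
    ((hP1.continuous_deriv_one).integrable_of_hasCompactSupport hPs.deriv).integrableOn
  have hFi : IntegrableOn (fun r : ℝ => r ^ (m + 2) *
      (‖gradient u (r • ω)‖ ^ 2 - α ^ 2 * (u (r • ω) ^ 2 / ‖r • ω‖ ^ 2))) (Set.Ioi 0) := by
    refine (Continuous.integrable_of_hasCompactSupport ?_ ?_).integrableOn
    · have hc : Continuous fun r : ℝ => r • ω := continuous_id.smul continuous_const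
      exact (continuous_pow _).mul ((((continuous_gradient hu).comp hc).norm.pow 2).sub
        (continuous_const.mul ((continuous_sq_div_norm_sq hu0 hu.continuous).comp hc)))
    · refine HasCompactSupport.mul_left (HasCompactSupport.comp_smul_unit (f := fun x =>
        ‖gradient u x‖ ^ 2 - α ^ 2 * (u x ^ 2 / ‖x‖ ^ 2)) ?_ hω)
      refine HasCompactSupport.intro hcs.isCompact fun x hx => ?_
      simp [gradient_eq_zero_of_notMem_tsupport hx, image_eq_zero_of_notMem_tsupport hx]
  have hcs2 : ∀ s : ℝ, inner ℝ (gradient u (s • ω)) ω ^ 2 ≤ ‖gradient u (s • ω)‖ ^ 2 := fun s => by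
    rw [← sq_abs]
    refine pow_le_pow_left₀ (abs_nonneg _) ?_ 2
    simpa [hω] using abs_real_inner_le_norm (gradient u (s • ω)) ω
  calc _ = ∫ r in Set.Ioi (0 : ℝ), radialMap m r / r ^ (m + 2) * G (radialMap m r) :=
        setIntegral_congr_fun measurableSet_Ioi fun r hr =>
          pow_mul_norm_gradient_transplant_sq hud hω hr
    _ = ∫ s in Set.Ioi (0 : ℝ), G s := by
        refine setIntegral_radialMap m fun s hs0 hs => ?_
        have hn : ‖s • ω‖ ≤ 1 := by rwa [norm_smul, hω, mul_one, Real.norm_of_nonneg hs0.le]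
        simp only [hG, hu0 _ hn, hg0 _ hn, inner_zero_left, norm_zero]
        simp
    _ ≤ ∫ s in Set.Ioi (0 : ℝ), (s ^ (m + 2) *
          (‖gradient u (s • ω)‖ ^ 2 - α ^ 2 * (u (s • ω) ^ 2 / ‖s • ω‖ ^ 2)) + α * deriv P s) := by
        refine integral_mono_of_nonneg ?_ (hFi.add (hPi.const_mul α)) ?_
        · filter_upwards [ae_restrict_mem measurableSet_Ioi] with s hs
          have hs0 : 0 < s := hs
          have := hcs2 s
          have : 0 ≤ ‖gradient u (s • ω)‖ ^ 2 - inner ℝ (gradient u (s • ω)) ω ^ 2 := by linarith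
          simp only [hG, Pi.zero_apply]
          positivity
        · filter_upwards [ae_restrict_mem measurableSet_Ioi] with s hs
          have hs0 : 0 < s := hs
          rw [(hPd s).deriv]
          rcases le_or_gt s 1 with hs1 | hs1
          · have hn : ‖s • ω‖ ≤ 1 := by rwa [norm_smul, hω, mul_one, Real.norm_of_nonneg hs0.le]
            simp only [hG, hu0 _ hn, hg0 _ hn, inner_zero_left, norm_zero]
            simp
          · have hlog : 1 ≤ 1 + ((m : ℝ) + 1) * Real.log s := by
              have := Real.log_pos hs1
              have : 0 < ((m : ℝ) + 1) * Real.log s := by positivity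
              linarith
            have hk : ((1 + ((m : ℝ) + 1) * Real.log s)⁻¹) ^ 2 ≤ 1 :=
              pow_le_one₀ (inv_nonneg.2 (by linarith)) (inv_le_one_of_one_le₀ hlog)
            have h1 := hcs2 s
            rw [norm_smul, hω, mul_one, Real.norm_of_nonneg hs0.le]
            simp only [hG]
            have h2 : 0 ≤ s ^ (m + 2) * ((1 - ((1 + ((m : ℝ) + 1) * Real.log s)⁻¹) ^ 2) *
                (‖gradient u (s • ω)‖ ^ 2 - inner ℝ (gradient u (s • ω)) ω ^ 2)) :=
              mul_nonneg (by positivity) (mul_nonneg (by linarith) (by linarith))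
            refine le_of_sub_nonneg (h2.trans_eq ?_)
            generalize ((1 + ((m : ℝ) + 1) * Real.log s)⁻¹) = κ
            rw [hα]
            field_simp
            ring
    _ = _ := by
        rw [integral_add hFi (hPi.const_mul α), integral_const_mul, hPint, mul_zero, add_zero]

variable [MeasurableSpace E] [BorelSpace E]

theorem integral_norm_gradient_transplant_le (hm : Module.finrank ℝ E = m + 3)
    (hu : ContDiff ℝ 1 u) (hcs : HasCompactSupport u) (hsupp : ∀ x ∈ tsupport u, 1 < ‖x‖) :
    ∫ x, ‖gradient (transplant m u) x‖ ^ 2 ≤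
      (∫ x, ‖gradient u x‖ ^ 2) - (((m : ℝ) + 1) / 2) ^ 2 * ∫ x, u x ^ 2 / ‖x‖ ^ 2 := by
  have hu0 : ∀ x, ‖x‖ ≤ 1 → u x = 0 := fun x hx =>
    image_eq_zero_of_notMem_tsupport fun h => (hsupp x h).not_ge hx
  have : Nontrivial E := Module.nontrivial_of_finrank_pos (R := ℝ) (by omega)
  have i1 : Integrable fun x => ‖gradient u x‖ ^ 2 :=
    ((continuous_gradient hu).norm.pow 2).integrable_of_hasCompactSupport
      (hasCompactSupport_norm_gradient_sq hcs)
  have i2 : Integrable fun x => u x ^ 2 / ‖x‖ ^ 2 :=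
    (continuous_sq_div_norm_sq hu0 hu.continuous).integrable_of_hasCompactSupport
      (HasCompactSupport.intro hcs.isCompact fun x hx => by
        simp [image_eq_zero_of_notMem_tsupport hx])
  have hw := contDiff_transplant (m := m) hu0 hcs hu
  have i3 : Integrable fun x => ‖gradient (transplant m u) x‖ ^ 2 :=
    ((continuous_gradient hw).norm.pow 2).integrable_of_hasCompactSupport
      (hasCompactSupport_norm_gradient_sq (hasCompactSupport_transplant hu0))
  rw [← integral_const_mul, ← integral_sub i1 (i2.const_mul _)]
  refine integral_le_integral_of_forall_sphere i3 (i1.sub (i2.const_mul _)) fun ω hω => ?_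
  rw [hm]
  exact setIntegral_norm_gradient_transplant_le hu hcs hsupp hω

theorem integral_abs_rpow_le_integral_transplant (hm : Module.finrank ℝ E = m + 3)
    (hu : ContDiff ℝ 1 u) (hcs : HasCompactSupport u) (hsupp : ∀ x ∈ tsupport u, 1 < ‖x‖) :
    ∫ x, ((1 + ((m : ℝ) + 1) * Real.log ‖x‖)⁻¹) ^ (2 * ((m : ℝ) + 2) / (m + 1)) *
        |u x| ^ (2 * ((m : ℝ) + 3) / (m + 1)) ≤
      ∫ x, |transplant m u x| ^ (2 * ((m : ℝ) + 3) / (m + 1)) := by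
  have hu0 : ∀ x, ‖x‖ ≤ 1 → u x = 0 := fun x hx =>
    image_eq_zero_of_notMem_tsupport fun h => (hsupp x h).not_ge hx
  have : Nontrivial E := Module.nontrivial_of_finrank_pos (R := ℝ) (by omega)
  have hq : 0 < 2 * ((m : ℝ) + 3) / (m + 1) := by positivity
  have hw := contDiff_transplant (m := m) hu0 hcs hu
  refine integral_le_integral_of_forall_sphere ?_ ?_ fun ω hω => le_of_eq ?_
  · refine (continuous_inv_log_rpow_mul one_pos (by positivity) (by positivity) hq hu0
      hu.continuous).integrable_of_hasCompactSupport ?_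
    refine HasCompactSupport.intro hcs.isCompact fun x hx => ?_
    rw [image_eq_zero_of_notMem_tsupport hx, abs_zero, Real.zero_rpow hq.ne', mul_zero]
  · exact (hw.continuous.abs.rpow_const fun _ => Or.inr hq.le).integrable_of_hasCompactSupport
      ((hasCompactSupport_transplant hu0).comp_left (g := fun t : ℝ => |t| ^ _)
        (by rw [abs_zero, Real.zero_rpow hq.ne']))
  · rw [hm]
    set G : ℝ → ℝ := fun s => s ^ (m + 2) *
        (((1 + ((m : ℝ) + 1) * Real.log s)⁻¹) ^ (2 * ((m : ℝ) + 2) / (m + 1)) *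
          |u (s • ω)| ^ (2 * ((m : ℝ) + 3) / (m + 1))) with hG
    calc _ = ∫ s in Set.Ioi (0 : ℝ), G s := by
          refine setIntegral_congr_fun measurableSet_Ioi fun s hs => ?_
          simp only [norm_smul, hω, mul_one, Real.norm_of_nonneg (le_of_lt hs)]
          rfl
      _ = ∫ r in Set.Ioi (0 : ℝ), radialMap m r / r ^ (m + 2) * G (radialMap m r) := by
          refine (setIntegral_radialMap m fun s hs0 hs => ?_).symm
          have hn : ‖s • ω‖ ≤ 1 := by rwa [norm_smul, hω, mul_one, Real.norm_of_nonneg hs0.le]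
          simp only [hG, hu0 _ hn, abs_zero, Real.zero_rpow hq.ne', mul_zero]
      _ = _ := setIntegral_congr_fun measurableSet_Ioi fun r hr =>
          (pow_mul_abs_transplant_rpow hω hr).symm

end HardySobolev

theorem sobolevConst_nonneg {n : ℕ} (hn : 2 ≤ n) : 0 ≤ sobolevConst n := by
  have h2 : (0 : ℝ) ≤ (n : ℝ) - 2 := by
    have : (2 : ℝ) ≤ n := by exact_mod_cast hn
    linarith
  have h1 : 0 ≤ Real.Gamma ((n : ℝ) / 2) / Real.Gamma (n : ℝ) :=
    div_nonneg (Real.Gamma_nonneg_of_nonneg (by positivity))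
      (Real.Gamma_nonneg_of_nonneg (by positivity))
  unfold sobolevConst
  positivity

theorem mul_X1_rpow_le {m : ℕ} {a d s p : ℝ} (ha : 0 < a) (hd : 0 ≤ d) (hda : d ≤ a)
    (hdm : d * (m + 1) ≤ 1) (hs : 1 ≤ s) (hp : 0 ≤ p) :
    d ^ p * X1 a (1 / s) ^ p ≤ ((1 + ((m : ℝ) + 1) * Real.log s)⁻¹) ^ p := by
  have ht := Real.log_nonneg hs
  rw [X1, one_div, Real.log_inv, sub_neg_eq_add, ← Real.mul_rpow hd (by positivity)]
  refine Real.rpow_le_rpow (by positivity) ?_ hp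
  rw [← div_eq_mul_inv, ← one_div, div_le_div_iff₀ (by positivity) (by positivity)]
  nlinarith

/-- The improved Hardy-Sobolev inequality outside the unit ball. -/
theorem hardy_sobolev_exterior {m : ℕ} {a d : ℝ} (ha : 0 < a) (hd : 0 ≤ d) (hda : d ≤ a)
    (hdm : d * (m + 1) ≤ 1) {u : EuclideanSpace ℝ (Fin (m + 3)) → ℝ} (hu : ContDiff ℝ 1 u)
    (hcs : HasCompactSupport u) (hsupp : ∀ x ∈ tsupport u, 1 < ‖x‖) :
    (((m : ℝ) + 1) / 2) ^ 2 * (∫ x, u x ^ 2 / ‖x‖ ^ 2) +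
      d ^ (2 * ((m : ℝ) + 2) / (m + 3)) * sobolevConst (m + 3) *
        (∫ x, X1 a (1 / ‖x‖) ^ (2 * ((m : ℝ) + 2) / (m + 1)) *
          |u x| ^ (2 * ((m : ℝ) + 3) / (m + 1))) ^ (((m : ℝ) + 1) / (m + 3)) ≤
      ∫ x, ‖gradient u x‖ ^ 2 := by
  have hu0 : ∀ x, ‖x‖ ≤ 1 → u x = 0 := fun x hx =>
    image_eq_zero_of_notMem_tsupport fun h => (hsupp x h).not_ge hx
  have hm : Module.finrank ℝ (EuclideanSpace ℝ (Fin (m + 3))) = m + 3 := by simp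
  have hq : 0 < 2 * ((m : ℝ) + 3) / (m + 1) := by positivity
  have hp : 0 ≤ 2 * ((m : ℝ) + 2) / (m + 1) := by positivity
  have h1 := integral_norm_gradient_transplant_le hm hu hcs hsupp
  have h2 := integral_abs_rpow_le_integral_transplant hm hu hcs hsupp
  have h3 := sobolev_euclidean (by omega) (contDiff_transplant (m := m) hu0 hcs hu)
    (hasCompactSupport_transplant hu0)
  have hS : 0 ≤ sobolevConst (m + 3) := sobolevConst_nonneg (by omega)
  push_cast at h3
  rw [show (m : ℝ) + 3 - 2 = m + 1 by ring] at h3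
  set q := 2 * ((m : ℝ) + 3) / (m + 1)
  set p := 2 * ((m : ℝ) + 2) / (m + 1) with hpdef
  set J := ∫ x, X1 a (1 / ‖x‖) ^ p * |u x| ^ q with hJ
  have hnn : ∀ x, 0 ≤ X1 a (1 / ‖x‖) ^ p * |u x| ^ q := fun x => by
    rcases le_total ‖x‖ 1 with hx | hx
    · rw [hu0 x hx, abs_zero, Real.zero_rpow hq.ne', mul_zero]
    · have := Real.log_nonneg hx
      rw [X1, one_div, Real.log_inv, sub_neg_eq_add]
      positivity
  have h4 : d ^ p * J ≤ ∫ x, |transplant m u x| ^ q := by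
    refine le_trans ?_ h2
    rw [hJ, ← integral_const_mul]
    refine integral_mono_of_nonneg (Filter.Eventually.of_forall fun x =>
      mul_nonneg (Real.rpow_nonneg hd _) (hnn x)) ?_ (Filter.Eventually.of_forall fun x => ?_)
    · refine (continuous_inv_log_rpow_mul one_pos (by positivity) hp hq hu0
        hu.continuous).integrable_of_hasCompactSupport ?_
      refine HasCompactSupport.intro hcs.isCompact fun x hx => ?_
      rw [image_eq_zero_of_notMem_tsupport hx, abs_zero, Real.zero_rpow hq.ne', mul_zero]
    · rcases le_total ‖x‖ 1 with hx | hx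
      · simp only [hu0 x hx, abs_zero, Real.zero_rpow hq.ne', mul_zero, le_refl]
      · simp only [← mul_assoc]
        exact mul_le_mul_of_nonneg_right (mul_X1_rpow_le ha hd hda hdm hx hp) (by positivity)
  have hJ0 : 0 ≤ J := integral_nonneg hnn
  have h5 : d ^ (2 * ((m : ℝ) + 2) / (m + 3)) * sobolevConst (m + 3) *
      J ^ (((m : ℝ) + 1) / (m + 3)) =
      sobolevConst (m + 3) * (d ^ p * J) ^ (((m : ℝ) + 1) / (m + 3)) := by
    rw [Real.mul_rpow (Real.rpow_nonneg hd _) hJ0, ← Real.rpow_mul hd,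
      show p * (((m : ℝ) + 1) / (m + 3)) = 2 * ((m : ℝ) + 2) / (m + 3) by
        rw [hpdef]; field_simp]
    ring
  rw [h5]
  have h6 := mul_le_mul_of_nonneg_left (Real.rpow_le_rpow
    (mul_nonneg (Real.rpow_nonneg hd p) hJ0) h4
    (by positivity : (0 : ℝ) ≤ ((m : ℝ) + 1) / (m + 3))) hS
  linarith

theorem stmt12 (n : ℕ) (hn : 3 ≤ n) (a : ℝ) (ha0 : 0 < a)
    (Cna : ℝ)
    (hCna : Cna = if 1 / ((n : ℝ) - 2) ≤ a then ((n : ℝ) - 2) ^ (-(2 * ((n : ℝ) - 1)) / (n : ℝ)) * sobolevConst n else a ^ (2 * ((n : ℝ) - 1) / (n : ℝ)) * sobolevConst n)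
    (u : EuclideanSpace ℝ (Fin n) → ℝ) (hu : ContDiff ℝ (⊤ : ℕ∞) u)
    (hcs : HasCompactSupport u)
    (hsupp : tsupport u ⊆ (Metric.closedBall (0 : EuclideanSpace ℝ (Fin n)) 1)ᶜ) :
    (∫ x in (Metric.closedBall (0 : EuclideanSpace ℝ (Fin n)) 1)ᶜ, ‖gradient u x‖ ^ 2)
      ≥ (((n : ℝ) - 2) / 2) ^ 2 *
          (∫ x in (Metric.closedBall (0 : EuclideanSpace ℝ (Fin n)) 1)ᶜ, u x ^ 2 / ‖x‖ ^ 2)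
        + Cna *
          (∫ x in (Metric.closedBall (0 : EuclideanSpace ℝ (Fin n)) 1)ᶜ,
              (X1 a (1 / ‖x‖)) ^ (2 * ((n : ℝ) - 1) / ((n : ℝ) - 2)) *
                |u x| ^ (2 * (n : ℝ) / ((n : ℝ) - 2)))
            ^ (((n : ℝ) - 2) / (n : ℝ)) := by
  obtain ⟨m, rfl⟩ : ∃ m, n = m + 3 := ⟨n - 3, by omega⟩
  have hnorm : ∀ x ∈ tsupport u, 1 < ‖x‖ := fun x hx => by
    have h := hsupp hx
    rwa [Set.mem_compl_iff, mem_closedBall_zero_iff, not_le] at h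
  have hout : ∀ x ∉ (Metric.closedBall (0 : EuclideanSpace ℝ (Fin (m + 3))) 1)ᶜ,
      x ∉ tsupport u := fun x hx h => hx (hsupp h)
  have hu1 : ContDiff ℝ 1 u := hu.of_le (by exact_mod_cast le_top)
  push_cast at hCna ⊢
  rw [show (m : ℝ) + 3 - 2 = m + 1 by ring, show (m : ℝ) + 3 - 1 = m + 2 by ring] at hCna ⊢
  have hq : 2 * ((m : ℝ) + 3) / (m + 1) ≠ 0 := by positivity
  rw [setIntegral_eq_integral_of_forall_compl_eq_zero fun x hx => by
      rw [gradient_eq_zero_of_notMem_tsupport (hout x hx), norm_zero, zero_pow two_ne_zero],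
    setIntegral_eq_integral_of_forall_compl_eq_zero fun x hx => by
      rw [image_eq_zero_of_notMem_tsupport (hout x hx), zero_pow two_ne_zero, zero_div],
    setIntegral_eq_integral_of_forall_compl_eq_zero fun x hx => by
      rw [image_eq_zero_of_notMem_tsupport (hout x hx), abs_zero, Real.zero_rpow hq, mul_zero]]
  split_ifs at hCna with hab
  · have hC : Cna = (1 / ((m : ℝ) + 1)) ^ (2 * ((m : ℝ) + 2) / (m + 3)) *
        sobolevConst (m + 3) := by
      rw [hCna, one_div, Real.inv_rpow (by positivity), ← Real.rpow_neg (by positivity), neg_div]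
    rw [hC]
    exact hardy_sobolev_exterior ha0 (by positivity) hab
      (le_of_eq (one_div_mul_cancel (by positivity))) hu1 hcs hnorm
  · rw [hCna]
    rw [not_le, lt_div_iff₀ (by positivity)] at hab
    exact hardy_sobolev_exterior ha0 ha0.le le_rfl hab.le hu1 hcs hnorm
end

section
/- Let n ≥ 3 and a > 0, and set C_n(a) := (n-2)^{-2(n-1)/n} S_n if a ≥ 1/(n-2) and C_n(a) := a^{2(n-1)/n} S_n if 0 < a < 1/(n-2). Then C_n(a) is the best constant in the exterior-domain inequality: for every C > C_n(a) there exists a nonzero u ∈ C_c^∞(B_1^c) such that ∫_{B_1^c} |∇u|² dx − ((n-2)/2)² ∫_{B_1^c} u²/|x|² dx < C · ( ∫_{B_1^c} X_1(a, 1/|x|)^{2(n-1)/(n-2)} |u|^{2n/(n-2)} dx )^{(n-2)/n}. -/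
open MeasureTheory Real

lemma hasDerivAt_exp_div_two_cosh (t : ℝ) :
    HasDerivAt (fun t => exp t / (2 * cosh t)) (2 * (2 * cosh t) ^ (-2 : ℝ)) t := by
  have hc : 0 < 2 * cosh t := by have := cosh_pos t; positivity
  have h := (Real.hasDerivAt_exp t).div ((Real.hasDerivAt_cosh t).const_mul 2) hc.ne'
  refine h.congr_deriv ?_
  rw [rpow_neg hc.le, div_eq_mul_inv]
  norm_cast
  congr 1
  have h1 : exp t * exp (-t) = 1 := by rw [← exp_add]; simp
  rw [cosh_eq, sinh_eq]
  linear_combination 2 * h1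

lemma image_exp_div_two_cosh :
    (fun t => exp t / (2 * cosh t)) '' Set.univ = Set.Ioo 0 1 := by
  ext y
  constructor
  · rintro ⟨t, -, rfl⟩
    have hc := cosh_pos t
    refine ⟨by positivity, ?_⟩
    show exp t / (2 * cosh t) < 1
    rw [div_lt_one (by positivity), cosh_eq]
    have := exp_pos (-t)
    linarith
  · rintro ⟨h0, h1⟩
    have h2 : 0 < 1 - y := by linarith
    refine ⟨log (y / (1 - y)) / 2, trivial, ?_⟩
    have hpos : 0 < y / (1 - y) := by positivity
    set t := log (y / (1 - y)) / 2
    have ht : exp t * exp t = y / (1 - y) := by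
      rw [← exp_add, show t + t = log (y / (1 - y)) by ring, exp_log hpos]
    have h3 : exp t * exp (-t) = 1 := by rw [← exp_add]; simp
    show exp t / (2 * cosh t) = y
    rw [div_eq_iff (by have := cosh_pos t; positivity), cosh_eq]
    rw [eq_div_iff h2.ne'] at ht
    apply mul_left_cancel₀ (exp_pos t).ne'
    linear_combination ht - y * h3

lemma integral_two_cosh_rpow (s : ℝ) (hs : 0 < s) :
    ∫ t : ℝ, (2 * cosh t) ^ (-(2 * s)) = Gamma s ^ 2 / Gamma (2 * s) / 2 := by
  have hinj : Set.InjOn (fun t => exp t / (2 * cosh t)) Set.univ := by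
    rw [Set.injOn_univ]
    refine (strictMono_of_deriv_pos fun t => ?_).injective
    rw [(hasDerivAt_exp_div_two_cosh t).deriv]
    have := cosh_pos t
    positivity
  have hcv := integral_image_eq_integral_abs_deriv_smul MeasurableSet.univ
    (fun t _ => (hasDerivAt_exp_div_two_cosh t).hasDerivWithinAt) hinj
    (fun y : ℝ => (y * (1 - y)) ^ (s - 1))
  rw [image_exp_div_two_cosh, setIntegral_univ] at hcv
  have h1 : ∀ t : ℝ, |2 * (2 * cosh t) ^ (-2 : ℝ)| •
      (exp t / (2 * cosh t) * (1 - exp t / (2 * cosh t))) ^ (s - 1) =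
      2 * (2 * cosh t) ^ (-(2 * s)) := by
    intro t
    have hc : 0 < 2 * cosh t := by have := cosh_pos t; positivity
    have h3 : exp t * exp (-t) = 1 := by rw [← exp_add]; simp
    have h2 : exp t / (2 * cosh t) * (1 - exp t / (2 * cosh t)) = (2 * cosh t) ^ (-2 : ℝ) := by
      rw [rpow_neg hc.le]
      norm_cast
      field_simp
      rw [cosh_eq]
      linear_combination h3
    rw [h2, abs_of_pos (by positivity), smul_eq_mul, mul_assoc, ← rpow_mul hc.le,
      ← rpow_add hc]
    congr 2
    ring
  simp_rw [h1] at hcv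
  rw [integral_const_mul] at hcv
  have hb := ProbabilityTheory.beta_eq_betaIntegralReal s s hs hs
  have hre : Complex.betaIntegral s s = ((∫ y in Set.Ioo (0:ℝ) 1, (y * (1 - y)) ^ (s - 1) : ℝ) : ℂ) := by
    rw [Complex.betaIntegral, intervalIntegral.integral_of_le zero_le_one,
      integral_Ioc_eq_integral_Ioo, ← integral_complex_ofReal]
    refine setIntegral_congr_fun measurableSet_Ioo fun y hy => ?_
    have h4 : 0 ≤ 1 - y := by linarith [hy.2]
    rw [mul_rpow hy.1.le h4, Complex.ofReal_mul, Complex.ofReal_cpow hy.1.le,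
      Complex.ofReal_cpow h4]
    push_cast
    rfl
  rw [hre, Complex.ofReal_re, hcv, ProbabilityTheory.beta, ← two_mul s] at hb
  rw [sq, hb]
  ring

/-- The surface area of the unit sphere of `ℝ^n`. -/
noncomputable def sphereArea (n : ℕ) : ℝ :=
  n * (volume : Measure (EuclideanSpace ℝ (Fin n))).real (Metric.ball 0 1)

lemma sphereArea_eq (n : ℕ) (hn : 3 ≤ n) :
    sphereArea n = 2 * π ^ ((n : ℝ) / 2) / Gamma ((n : ℝ) / 2) := by
  have : Nonempty (Fin n) := ⟨⟨0, by omega⟩⟩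
  have hn0 : (0 : ℝ) < n := by positivity
  have hG : 0 < Gamma ((n : ℝ) / 2) := Gamma_pos_of_pos (by positivity)
  have hp : √π ^ n = π ^ ((n : ℝ) / 2) := by
    rw [sqrt_eq_rpow, ← rpow_natCast, ← rpow_mul pi_pos.le]
    congr 1
    ring
  rw [sphereArea, Measure.real, EuclideanSpace.volume_ball]
  simp only [Fintype.card_fin, ENNReal.ofReal_one, one_pow, one_mul]
  rw [Gamma_add_one (by positivity), ENNReal.toReal_ofReal (by positivity), hp]
  field_simp

lemma sphereArea_pos (n : ℕ) (hn : 3 ≤ n) : 0 < sphereArea n := by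
  rw [sphereArea_eq n hn]
  have hG : 0 < Gamma ((n : ℝ) / 2) := Gamma_pos_of_pos (by positivity)
  positivity

/-- The Aubin–Talenti extremal in Emden–Fowler coordinates. -/
noncomputable def sechBubble (k t : ℝ) : ℝ := (2 * cosh t) ^ (-k)

lemma two_cosh_pos (t : ℝ) : 0 < 2 * cosh t := by have := cosh_pos t; positivity

lemma sechBubble_pos (k t : ℝ) : 0 < sechBubble k t := rpow_pos_of_pos (two_cosh_pos t) _

lemma contDiff_sechBubble (k : ℝ) : ContDiff ℝ (⊤ : ℕ∞) (sechBubble k) :=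
  (contDiff_const.mul contDiff_cosh).rpow_const_of_ne fun t => (two_cosh_pos t).ne'

lemma hasDerivAt_sechBubble (k t : ℝ) :
    HasDerivAt (sechBubble k) (-k * tanh t * sechBubble k t) t := by
  have hc := two_cosh_pos t
  have h := ((Real.hasDerivAt_cosh t).const_mul 2).rpow_const (p := -k) (Or.inl hc.ne')
  refine h.congr_deriv ?_
  rw [sechBubble, rpow_sub_one hc.ne', tanh_eq_sinh_div_cosh]
  have := (cosh_pos t).ne'
  field_simp

lemma sechBubble_sq (k t : ℝ) : sechBubble k t ^ 2 = (2 * cosh t) ^ (-(2 * k)) := by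
  rw [sechBubble, ← rpow_natCast, ← rpow_mul (two_cosh_pos t).le]
  congr 1
  push_cast
  ring

lemma integrable_two_cosh_rpow {s : ℝ} (hs : 1 ≤ s) :
    Integrable fun t : ℝ => (2 * cosh t) ^ (-s) := by
  refine (integrable_inv_one_add_sq.const_mul 2).mono' ?_ (.of_forall fun t => ?_)
  · exact Continuous.aestronglyMeasurable <|
      (continuous_const.mul continuous_cosh).rpow_const fun t => Or.inl (two_cosh_pos t).ne'
  · have hc := two_cosh_pos t
    have h1 : 1 ≤ 2 * cosh t := by linarith [one_le_cosh t]
    rw [norm_of_nonneg (by positivity)]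
    have h2 : 1 + t ^ 2 ≤ 2 * (2 * cosh t) := by
      have h3 := quadratic_le_exp_of_nonneg (abs_nonneg t)
      rw [← cosh_abs, cosh_eq]
      have := exp_pos (-|t|)
      have := abs_nonneg t
      rw [← sq_abs t]
      linarith
    calc (2 * cosh t) ^ (-s) ≤ (2 * cosh t) ^ (-1 : ℝ) :=
          rpow_le_rpow_of_exponent_le h1 (by linarith)
      _ = (2 * cosh t)⁻¹ := rpow_neg_one _
      _ ≤ 2 * (1 + t ^ 2)⁻¹ := by
          rw [← div_eq_mul_inv, le_div_iff₀ (by positivity), inv_mul_le_iff₀ hc]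
          linarith

lemma abs_tanh_le_one (t : ℝ) : |tanh t| ≤ 1 := (abs_tanh_lt_one t).le

lemma integral_sechBubble_energy {k : ℝ} (hk : 1 ≤ 2 * k) :
    ∫ t, ((-k * tanh t * sechBubble k t) ^ 2 + k ^ 2 * sechBubble k t ^ 2) =
      4 * k * (k + 1) * ∫ t : ℝ, (2 * cosh t) ^ (-(2 * (k + 1))) := by
  have hi2 : Integrable fun t => sechBubble k t ^ 2 := by
    simp_rw [sechBubble_sq]; exact integrable_two_cosh_rpow hk
  have hcont : Continuous (sechBubble k) := (contDiff_sechBubble k).continuous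
  have htanh : Continuous tanh := by
    simp_rw [funext tanh_eq_sinh_div_cosh]
    exact continuous_sinh.div continuous_cosh fun t => (cosh_pos t).ne'
  have hd : ∀ t, HasDerivAt (fun t => -k * tanh t * sechBubble k t * sechBubble k t)
      (((-k * tanh t * sechBubble k t) ^ 2 + k ^ 2 * sechBubble k t ^ 2) -
        4 * k * (k + 1) * (2 * cosh t) ^ (-(2 * (k + 1)))) t := by
    intro t
    have hc := cosh_pos t
    have ht : HasDerivAt tanh (1 / cosh t ^ 2) t := by
      have := (Real.hasDerivAt_sinh t).div (Real.hasDerivAt_cosh t) hc.ne'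
      simp_rw [funext tanh_eq_sinh_div_cosh]
      refine this.congr_deriv ?_
      rw [← sq, ← sq, cosh_sq]; ring
    have hp := hasDerivAt_sechBubble k t
    refine (((ht.const_mul (-k)).mul hp).mul hp).congr_deriv ?_
    have e : (2 * cosh t) ^ (-(2 * (k + 1))) = sechBubble k t ^ 2 * (2 * cosh t)⁻¹ ^ 2 := by
      rw [sechBubble_sq, show -(2 * (k + 1)) = -(2 * k) + -2 by ring, rpow_add (two_cosh_pos t),
        rpow_neg (two_cosh_pos t).le 2]
      norm_cast
      rw [inv_pow]
    rw [e]
    simp only [Pi.mul_apply, tanh_eq_sinh_div_cosh]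
    have hsq := cosh_sq t
    field_simp
    have : sinh t ^ 2 = cosh t ^ 2 - 1 := by linarith
    ring_nf
    rw [this]
    ring
  have hiE : Integrable fun t => (-k * tanh t * sechBubble k t) ^ 2 + k ^ 2 * sechBubble k t ^ 2 := by
    refine Integrable.add ?_ (hi2.const_mul _)
    refine (hi2.const_mul (k ^ 2)).mono' (by fun_prop) (.of_forall fun t => ?_)
    rw [norm_of_nonneg (sq_nonneg _), mul_pow, mul_pow, neg_sq]
    have : tanh t ^ 2 ≤ 1 := by
      rw [← sq_abs]; exact pow_le_one₀ (abs_nonneg _) (abs_tanh_le_one t)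
    have h5 := mul_nonneg (sq_nonneg k) (sq_nonneg (sechBubble k t))
    nlinarith
  have hiP := (integrable_two_cosh_rpow (s := 2 * (k + 1)) (by linarith)).const_mul (4 * k * (k + 1))
  have h0 := integral_eq_zero_of_hasDerivAt_of_integrable hd (hiE.sub hiP) (by
    refine (hi2.const_mul |k|).mono' (by fun_prop) (.of_forall fun t => ?_)
    rw [mul_assoc, ← sq, norm_mul, norm_mul, norm_neg, norm_eq_abs, norm_eq_abs, norm_eq_abs,
      abs_of_nonneg (sq_nonneg (sechBubble k t))]
    have h6 := mul_nonneg (abs_nonneg k) (sq_nonneg (sechBubble k t))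
    nlinarith [abs_tanh_le_one t])
  rw [integral_sub hiE hiP, integral_const_mul] at h0
  linarith

open Filter Topology in
lemma exists_compactSupport_near_extremal (n : ℕ) (hn : 3 ≤ n) (C : ℝ) (hC : sobolevConst n < C) :
    ∃ φ : ℝ → ℝ, ContDiff ℝ (⊤ : ℕ∞) φ ∧ HasCompactSupport φ ∧
      sphereArea n * (∫ t, (deriv φ t ^ 2 + (((n : ℝ) - 2) / 2) ^ 2 * φ t ^ 2)) <
        C * (sphereArea n * ∫ t, |φ t| ^ (2 * (n : ℝ) / ((n : ℝ) - 2))) ^ (((n : ℝ) - 2) / n) := by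
  have hn3 : (3 : ℝ) ≤ n := by exact_mod_cast hn
  set k : ℝ := ((n : ℝ) - 2) / 2 with hk
  have hk1 : 1 ≤ 2 * k := by rw [hk]; linarith
  have hkn : 2 * (k + 1) = n := by rw [hk]; ring
  set p : ℝ := 2 * (n : ℝ) / ((n : ℝ) - 2) with hp
  have hp0 : 0 < p := by rw [hp]; exact div_pos (by linarith) (by linarith)
  have hkp : k * p = n := by
    rw [hk, hp]; field_simp [show (n : ℝ) - 2 ≠ 0 by linarith]
  have hσ := sphereArea_pos n hn
  let f : ContDiffBump (0 : ℝ) := ⟨1, 2, one_pos, one_lt_two⟩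
  have hfs : ContDiff ℝ (⊤ : ℕ∞) f := f.contDiff
  obtain ⟨D, hD⟩ := (hfs.continuous_deriv (by simp)).bounded_above_of_compact_support
    f.hasCompactSupport.deriv
  let φ : ℕ → ℝ → ℝ := fun N t => sechBubble k t * f (((N : ℝ) + 1)⁻¹ * t)
  have hN : ∀ N : ℕ, 0 < ((N : ℝ) + 1)⁻¹ := fun N => by positivity
  have hφs : ∀ N, ContDiff ℝ (⊤ : ℕ∞) (φ N) := fun N =>
    (contDiff_sechBubble k).mul (hfs.comp (contDiff_const.mul contDiff_id))
  have hφc : ∀ N, HasCompactSupport (φ N) := fun N =>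
    (f.hasCompactSupport.comp_homeomorph (Homeomorph.mulLeft₀ _ (hN N).ne')).mul_left
  have hφd : ∀ N t, deriv (φ N) t = -k * tanh t * sechBubble k t * f (((N : ℝ) + 1)⁻¹ * t) +
      sechBubble k t * (deriv f (((N : ℝ) + 1)⁻¹ * t) * ((N : ℝ) + 1)⁻¹) := by
    intro N t
    have h1 : HasDerivAt f (deriv f (((N : ℝ) + 1)⁻¹ * t)) (((N : ℝ) + 1)⁻¹ * t) :=
      (hfs.differentiable (by simp)).differentiableAt.hasDerivAt
    have h2 : HasDerivAt (fun t : ℝ => ((N : ℝ) + 1)⁻¹ * t) (((N : ℝ) + 1)⁻¹) t := by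
      simpa using (hasDerivAt_id t).const_mul (((N : ℝ) + 1)⁻¹)
    exact ((hasDerivAt_sechBubble k t).mul (h1.comp t h2)).deriv
  have hNlim : Tendsto (fun N : ℕ => ((N : ℝ) + 1)⁻¹) atTop (𝓝 0) := by
    simpa using tendsto_one_div_add_atTop_nhds_zero_nat (𝕜 := ℝ)
  have harg : ∀ t : ℝ, Tendsto (fun N : ℕ => ((N : ℝ) + 1)⁻¹ * t) atTop (𝓝 0) := fun t => by
    simpa using hNlim.mul_const t
  have hf0 : f 0 = 1 := f.one_of_mem_closedBall (by simp [f])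
  have hflim : ∀ t : ℝ, Tendsto (fun N : ℕ => f (((N : ℝ) + 1)⁻¹ * t)) atTop (𝓝 1) := fun t => by
    have := (hfs.continuous.tendsto 0).comp (harg t)
    rwa [hf0] at this
  have hi2 : Integrable fun t => sechBubble k t ^ 2 := by
    simp_rw [sechBubble_sq]; exact integrable_two_cosh_rpow hk1
  have hA : Tendsto (fun N => ∫ t, (deriv (φ N) t ^ 2 + k ^ 2 * φ N t ^ 2)) atTop
      (𝓝 (∫ t, ((-k * tanh t * sechBubble k t) ^ 2 + k ^ 2 * sechBubble k t ^ 2))) := by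
    refine tendsto_integral_of_dominated_convergence
      (fun t => ((k + D) ^ 2 + k ^ 2) * sechBubble k t ^ 2) (fun N => ?_) (hi2.const_mul _)
      (fun N => .of_forall fun t => ?_) (.of_forall fun t => ?_)
    · have h1 := (hφs N).continuous_deriv (by simp)
      have h2 := (hφs N).continuous
      fun_prop
    · rw [norm_of_nonneg (by positivity), add_mul]
      have hb := sechBubble_pos k t
      have hf1 : |f (((N : ℝ) + 1)⁻¹ * t)| ≤ 1 := by
        rw [abs_of_nonneg f.nonneg]; exact f.le_one
      have hNle : ((N : ℝ) + 1)⁻¹ ≤ 1 := inv_le_one_of_one_le₀ (by linarith [N.cast_nonneg (α := ℝ)])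
      have hD1 : |deriv f (((N : ℝ) + 1)⁻¹ * t)| ≤ D := hD _
      have hD0 : 0 ≤ D := (abs_nonneg _).trans hD1
      have hk0 : 0 ≤ k := by linarith
      have e1 : |deriv (φ N) t| ≤ (k + D) * sechBubble k t := by
        rw [hφd]
        refine (abs_add_le _ _).trans ?_
        rw [abs_mul, abs_mul, abs_mul, abs_mul, abs_mul, abs_neg, abs_of_pos hb, abs_of_nonneg hk0,
          abs_of_pos (hN N), add_mul]
        refine add_le_add ?_ ?_
        · calc k * |tanh t| * sechBubble k t * |f (((N : ℝ) + 1)⁻¹ * t)|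
              ≤ k * 1 * sechBubble k t * 1 := by
                gcongr
                exact abs_tanh_le_one t
            _ = k * sechBubble k t := by ring
        · calc sechBubble k t * (|deriv f (((N : ℝ) + 1)⁻¹ * t)| * ((N : ℝ) + 1)⁻¹)
              ≤ sechBubble k t * (D * 1) := by gcongr
            _ = D * sechBubble k t := by ring
      have e2 : |φ N t| ≤ sechBubble k t := by
        show |sechBubble k t * f (((N : ℝ) + 1)⁻¹ * t)| ≤ _
        rw [abs_mul, abs_of_pos hb]
        exact mul_le_of_le_one_right hb.le hf1
      refine add_le_add ?_ ?_
      · rw [← mul_pow, ← sq_abs (deriv (φ N) t)]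
        exact pow_le_pow_left₀ (abs_nonneg _) e1 2
      · rw [← sq_abs (φ N t)]
        gcongr
    · have h2 : Tendsto (fun N : ℕ => deriv f (((N : ℝ) + 1)⁻¹ * t) * ((N : ℝ) + 1)⁻¹) atTop
          (𝓝 (deriv f 0 * 0)) :=
        (((hfs.continuous_deriv (by simp)).tendsto 0).comp (harg t)).mul hNlim
      have h3 := ((hflim t).const_mul (-k * tanh t * sechBubble k t)).add
        (h2.const_mul (sechBubble k t))
      have h4 := (hflim t).const_mul (sechBubble k t)
      simp only [mul_zero, mul_one, add_zero] at h3 h4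
      simp_rw [hφd]
      exact (h3.pow 2).add ((h4.pow 2).const_mul _)
  have habs : ∀ t, |sechBubble k t| ^ p = (2 * cosh t) ^ (-(2 * (k + 1))) := fun t => by
    rw [abs_of_pos (sechBubble_pos k t), sechBubble, ← rpow_mul (two_cosh_pos t).le, hkn, neg_mul,
      hkp]
  have hB : Tendsto (fun N => ∫ t, |φ N t| ^ p) atTop
      (𝓝 (∫ t : ℝ, (2 * cosh t) ^ (-(2 * (k + 1))))) := by
    refine tendsto_integral_of_dominated_convergence _ (fun N => ?_)
      (integrable_two_cosh_rpow (s := 2 * (k + 1)) (by linarith))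
      (fun N => .of_forall fun t => ?_) (.of_forall fun t => ?_)
    · exact ((hφs N).continuous.abs.rpow_const fun t => Or.inr hp0.le).aestronglyMeasurable
    · rw [norm_of_nonneg (by positivity), ← habs]
      refine rpow_le_rpow (abs_nonneg _) ?_ hp0.le
      show |sechBubble k t * f (((N : ℝ) + 1)⁻¹ * t)| ≤ _
      rw [abs_mul, abs_of_nonneg f.nonneg]
      exact mul_le_of_le_one_right (abs_nonneg _) f.le_one
    · rw [← habs]
      have h4 := (hflim t).const_mul (sechBubble k t)
      rw [mul_one] at h4
      exact h4.abs.rpow_const (Or.inr hp0.le)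
  rw [integral_sechBubble_energy hk1] at hA
  set J := ∫ t : ℝ, (2 * cosh t) ^ (-(2 * (k + 1))) with hJ
  have hJv : sphereArea n * J = π ^ ((n : ℝ) / 2) * (Gamma ((n : ℝ) / 2) / Gamma n) := by
    have hG : 0 < Gamma ((n : ℝ) / 2) := Gamma_pos_of_pos (by positivity)
    rw [hJ, integral_two_cosh_rpow _ (by linarith), hkn, sphereArea_eq n hn,
      show k + 1 = (n : ℝ) / 2 by linarith]
    field_simp
  have hG1 : 0 < Gamma ((n : ℝ) / 2) := Gamma_pos_of_pos (by positivity)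
  have hG2 : 0 < Gamma (n : ℝ) := Gamma_pos_of_pos (by positivity)
  have hZ : 0 < sphereArea n * J := by rw [hJv]; positivity
  have hlim1 := hA.const_mul (sphereArea n)
  have hlim2 := ((hB.const_mul (sphereArea n)).rpow_const (p := ((n : ℝ) - 2) / n)
    (Or.inl hZ.ne')).const_mul C
  have hlt : sphereArea n * (4 * k * (k + 1) * J) <
      C * (sphereArea n * J) ^ (((n : ℝ) - 2) / n) := by
    have e1 : sphereArea n * (4 * k * (k + 1) * J) =
        sobolevConst n * (sphereArea n * J) ^ (((n : ℝ) - 2) / n) := by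
      have e2 : (sphereArea n * J) ^ (2 / (n : ℝ)) =
          π * (Gamma ((n : ℝ) / 2) / Gamma n) ^ (2 / (n : ℝ)) := by
        rw [hJv, mul_rpow (by positivity) (by positivity), ← rpow_mul pi_pos.le,
          show (n : ℝ) / 2 * (2 / n) = 1 by field_simp, rpow_one]
      have e3 : (sphereArea n * J) ^ (2 / (n : ℝ)) * (sphereArea n * J) ^ (((n : ℝ) - 2) / n) =
          sphereArea n * J := by
        rw [← rpow_add hZ, show 2 / (n : ℝ) + ((n : ℝ) - 2) / n = 1 by field_simp; ring, rpow_one]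
      have e4 : sobolevConst n = n * ((n : ℝ) - 2) * (sphereArea n * J) ^ (2 / (n : ℝ)) := by
        rw [e2, sobolevConst]; ring
      rw [e4, mul_assoc (n * ((n : ℝ) - 2)), e3, hk]
      ring
    rw [e1]
    exact mul_lt_mul_of_pos_right hC (rpow_pos_of_pos hZ _)
  obtain ⟨N, hNlt⟩ := (hlim1.eventually_lt hlim2 hlt).exists
  exact ⟨φ N, hφs N, hφc N, hNlt⟩

section Radial

variable {n : ℕ} {g : ℝ → ℝ} {α β : ℝ}

lemma contDiff_radial (hα : 0 < α) (hg : ∀ r, 0 < r → ContDiffAt ℝ (⊤ : ℕ∞) g r)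
    (h0 : ∀ r, 0 ≤ r → r < α → g r = 0) :
    ContDiff ℝ (⊤ : ℕ∞) fun x : EuclideanSpace ℝ (Fin n) => g ‖x‖ := by
  rw [contDiff_iff_contDiffAt]
  intro x
  by_cases hx : x = 0
  · have : (fun x : EuclideanSpace ℝ (Fin n) => g ‖x‖) =ᶠ[nhds x] fun _ => 0 := by
      filter_upwards [Metric.ball_mem_nhds x hα] with y hy
      rw [hx, mem_ball_zero_iff] at hy
      exact h0 _ (norm_nonneg _) hy
    exact contDiffAt_const.congr_of_eventuallyEq this
  · exact (hg _ (norm_pos_iff.2 hx)).comp x (contDiffAt_norm ℝ hx)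

lemma tsupport_radial_subset (h0 : ∀ r, 0 ≤ r → r < α → g r = 0) (h1 : ∀ r, β < r → g r = 0) :
    tsupport (fun x : EuclideanSpace ℝ (Fin n) => g ‖x‖) ⊆ {x | α ≤ ‖x‖ ∧ ‖x‖ ≤ β} := by
  refine closure_minimal (fun x hx => ?_) ?_
  · by_contra h
    simp only [Set.mem_ofPred_eq, not_and_or, not_le] at h
    exact hx (h.elim (h0 _ (norm_nonneg _)) (h1 _))
  · exact (isClosed_le continuous_const continuous_norm).inter
      (isClosed_le continuous_norm continuous_const)

lemma hasCompactSupport_radial (h1 : ∀ r, β < r → g r = 0) :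
    HasCompactSupport fun x : EuclideanSpace ℝ (Fin n) => g ‖x‖ := by
  refine HasCompactSupport.intro (isCompact_closedBall 0 β) fun x hx => h1 _ ?_
  rwa [mem_closedBall_zero_iff, not_le] at hx

lemma norm_gradient_radial_sq_s13 (hn : 3 ≤ n) (hg : ∀ r, 0 < r → ContDiffAt ℝ (⊤ : ℕ∞) g r)
    {x : EuclideanSpace ℝ (Fin n)} (hx : x ≠ 0) :
    ‖gradient (fun x : EuclideanSpace ℝ (Fin n) => g ‖x‖) x‖ ^ 2 = deriv g ‖x‖ ^ 2 := by
  have : Nonempty (Fin n) := ⟨⟨0, by omega⟩⟩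
  have hd : DifferentiableAt ℝ (fun x : EuclideanSpace ℝ (Fin n) => ‖x‖) x :=
    (contDiffAt_norm ℝ hx (n := 1)).differentiableAt (by simp)
  have hgd : HasDerivAt g (deriv g ‖x‖) ‖x‖ :=
    ((hg _ (norm_pos_iff.2 hx)).differentiableAt (by simp)).hasDerivAt
  have h := (hgd.comp_hasFDerivAt x hd.hasFDerivAt).fderiv
  have h' : fderiv ℝ (fun x : EuclideanSpace ℝ (Fin n) => g ‖x‖) x =
    deriv g ‖x‖ • fderiv ℝ (fun x : EuclideanSpace ℝ (Fin n) => ‖x‖) x := h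
  rw [gradient, LinearIsometryEquiv.norm_map, h', norm_smul, norm_fderiv_norm hd, mul_one,
    norm_eq_abs, sq_abs]

end Radial

lemma integral_Ioi_comp {ρ ρ' : ℝ → ℝ} (hρ : ∀ t, HasDerivAt ρ (ρ' t) t) (hρ' : ∀ t, 0 < ρ' t)
    (hpos : ∀ t, 0 < ρ t) {F : ℝ → ℝ} (hF : ∀ y, 0 < y → y ∉ Set.range ρ → F y = 0) :
    ∫ y in Set.Ioi 0, F y = ∫ t, ρ' t * F (ρ t) := by
  have hinj : Function.Injective ρ :=
    (strictMono_of_deriv_pos fun t => by rw [(hρ t).deriv]; exact hρ' t).injective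
  have h := integral_image_eq_integral_abs_deriv_smul MeasurableSet.univ
    (fun t _ => (hρ t).hasDerivWithinAt) hinj.injOn F
  rw [Set.image_univ, setIntegral_univ] at h
  have hsub : Set.range ρ ⊆ Set.Ioi 0 := by
    rintro _ ⟨t, rfl⟩
    exact hpos t
  rw [setIntegral_eq_of_subset_of_forall_sdiff_eq_zero measurableSet_Ioi hsub
    (fun y hy => hF y hy.1 hy.2), h]
  refine integral_congr_ae (.of_forall fun t => ?_)
  simp only [abs_of_pos (hρ' t), smul_eq_mul]

lemma integral_radial_comp {n : ℕ} (hn : 3 ≤ n) {ρ ρ' : ℝ → ℝ}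
    (hρ : ∀ t, HasDerivAt ρ (ρ' t) t) (hρ' : ∀ t, 0 < ρ' t)
    (hpos : ∀ t, 0 < ρ t) {F : ℝ → ℝ} (hF : ∀ y, 0 < y → y ∉ Set.range ρ → F y = 0) :
    ∫ x : EuclideanSpace ℝ (Fin n), F ‖x‖ =
      sphereArea n * ∫ t, ρ' t * (ρ t ^ (n - 1) * F (ρ t)) := by
  have : Nonempty (Fin n) := ⟨⟨0, by omega⟩⟩
  rw [integral_fun_norm_addHaar, finrank_euclideanSpace_fin, sphereArea]
  simp only [smul_eq_mul, nsmul_eq_mul]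
  rw [mul_assoc, integral_Ioi_comp hρ hρ' hpos fun y hy hy' => by rw [hF y hy hy', mul_zero]]

lemma integral_eq_zero_of_hasDerivAt_of_hasCompactSupport {H H' : ℝ → ℝ}
    (hd : ∀ t, HasDerivAt H (H' t) t) (hc : HasCompactSupport H) (h' : Continuous H') :
    ∫ t, H' t = 0 := by
  have e : H' = deriv H := funext fun t => (hd t).deriv.symm
  have hcont : Continuous H :=
    continuous_iff_continuousAt.2 fun t => (hd t).continuousAt
  refine integral_eq_zero_of_hasDerivAt_of_integrable hd
    (h'.integrable_of_hasCompactSupport ?_) (hcont.integrable_of_hasCompactSupport hc)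
  rw [e]
  exact hc.deriv

lemma exists_forall_lt_abs_eq_zero {φ : ℝ → ℝ} (hc : HasCompactSupport φ) :
    ∃ M : ℝ, ∀ t, M < |t| → φ t = 0 := by
  obtain ⟨M, hM⟩ := hc.isCompact.isBounded.exists_norm_le
  refine ⟨M, fun t ht => ?_⟩
  by_contra h
  exact absurd (hM t (subset_tsupport _ h)) (not_le.2 ht)

lemma exists_bubble_in_ball {n : ℕ} (hn : 3 ≤ n) {φ : ℝ → ℝ} (hφ : ContDiff ℝ (⊤ : ℕ∞) φ)
    (hφc : HasCompactSupport φ) {δ : ℝ} (hδ : 0 < δ) :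
    ∃ w : EuclideanSpace ℝ (Fin n) → ℝ, ContDiff ℝ (⊤ : ℕ∞) w ∧
      tsupport w ⊆ Metric.closedBall 0 δ ∧
      ∫ x, ‖gradient w x‖ ^ 2 =
        sphereArea n * (∫ t, (deriv φ t ^ 2 + (((n : ℝ) - 2) / 2) ^ 2 * φ t ^ 2)) ∧
      ∫ x, |w x| ^ (2 * (n : ℝ) / ((n : ℝ) - 2)) =
        sphereArea n * ∫ t, |φ t| ^ (2 * (n : ℝ) / ((n : ℝ) - 2)) := by
  have hn3 : (3 : ℝ) ≤ n := by exact_mod_cast hn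
  set k : ℝ := ((n : ℝ) - 2) / 2 with hk
  have hk1 : 0 < k := by rw [hk]; linarith
  set p : ℝ := 2 * (n : ℝ) / ((n : ℝ) - 2) with hp
  have hp0 : 0 < p := by rw [hp]; exact div_pos (by linarith) (by linarith)
  have hkp : k * p = n := by
    rw [hk, hp]; field_simp [show (n : ℝ) - 2 ≠ 0 by linarith]
  have hcast : ((n - 1 : ℕ) : ℝ) = 2 * k + 1 := by
    rw [Nat.cast_sub (by omega), hk]; push_cast; ring
  have hnk : (n : ℝ) = 2 * k + 2 := by rw [hk]; ring
  obtain ⟨M, hM⟩ := exists_forall_lt_abs_eq_zero hφc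
  set T : ℝ := log δ - M with hT
  let g : ℝ → ℝ := fun r => r ^ (-k) * φ (log r - T)
  have hgs : ∀ r, 0 < r → ContDiffAt ℝ (⊤ : ℕ∞) g r := fun r hr =>
    (contDiffAt_id.rpow_const_of_ne hr.ne').mul
      (hφ.contDiffAt.comp r ((contDiffAt_id.log hr.ne').sub contDiffAt_const))
  have h0 : ∀ r, 0 ≤ r → r < exp (T - M) → g r = 0 := by
    intro r hr hr'
    rcases hr.eq_or_lt with rfl | hr
    · simp [g, zero_rpow (neg_ne_zero.2 hk1.ne')]
    · have : log r < T - M := by rwa [log_lt_iff_lt_exp hr]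
      simp only [g]
      rw [hM _ (by rw [lt_abs]; right; linarith), mul_zero]
  have h1 : ∀ r, δ < r → g r = 0 := by
    intro r hr
    have : log δ < log r := log_lt_log hδ hr
    simp only [g]
    rw [hM _ (by rw [lt_abs]; left; linarith), mul_zero]
  have hρ : ∀ t, HasDerivAt (fun t => exp (t + T)) (exp (t + T)) t := fun t => by
    simpa using ((hasDerivAt_id t).add_const T).exp
  have hrange : ∀ y : ℝ, 0 < y → y ∉ Set.range (fun t => exp (t + T)) → False := fun y hy h =>
    h ⟨log y - T, by simp [exp_log hy]⟩
  have hgρ : ∀ t, g (exp (t + T)) = exp (-k * (t + T)) * φ t := fun t => by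
    simp only [g, log_exp, add_sub_cancel_right]
    rw [← exp_mul, mul_comm (t + T)]
  have hφd : ∀ t, HasDerivAt φ (deriv φ t) t := fun t =>
    (hφ.differentiable (by simp)).differentiableAt.hasDerivAt
  have hφdc : Continuous (deriv φ) := hφ.continuous_deriv (by simp)
  have hgd : ∀ t, deriv g (exp (t + T)) * exp (t + T) =
      exp (-k * (t + T)) * (deriv φ t - k * φ t) := by
    intro t
    have a1 := ((hgs _ (exp_pos (t + T))).differentiableAt (by simp)).hasDerivAt.comp t (hρ t)
    have a2 : HasDerivAt (fun t => exp (-k * (t + T))) (exp (-k * (t + T)) * (-k)) t := by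
      simpa using (((hasDerivAt_id t).add_const T).const_mul (-k)).exp
    have a3 := a2.mul (hφd t)
    have e : g ∘ (fun t => exp (t + T)) = fun t => exp (-k * (t + T)) * φ t := funext hgρ
    rw [e] at a1
    rw [a1.unique a3]
    ring
  refine ⟨fun x => g ‖x‖, contDiff_radial (exp_pos _) hgs h0, fun x hx => ?_, ?_, ?_⟩
  · exact mem_closedBall_zero_iff.2 (tsupport_radial_subset h0 h1 hx).2
  · have : Nonempty (Fin n) := ⟨⟨0, by omega⟩⟩
    have hae : ∀ᵐ x : EuclideanSpace ℝ (Fin n),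
        ‖gradient (fun x : EuclideanSpace ℝ (Fin n) => g ‖x‖) x‖ ^ 2 = deriv g ‖x‖ ^ 2 := by
      filter_upwards [compl_mem_ae_iff.2 (measure_singleton (0 : EuclideanSpace ℝ (Fin n)))]
        with x hx
      exact norm_gradient_radial_sq_s13 hn hgs hx
    rw [integral_congr_ae hae, integral_radial_comp hn hρ (fun t => exp_pos _) (fun t => exp_pos _)
      (F := fun r => deriv g r ^ 2) fun y hy h => (hrange y hy h).elim]
    congr 1
    have e : ∀ t, exp (t + T) * (exp (t + T) ^ (n - 1) * deriv g (exp (t + T)) ^ 2) =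
        (deriv φ t - k * φ t) ^ 2 := by
      intro t
      have : exp (t + T) * (exp (t + T) ^ (n - 1) * deriv g (exp (t + T)) ^ 2) =
        (exp (t + T) ^ (n - 1) * exp (-(t + T))) * (deriv g (exp (t + T)) * exp (t + T)) ^ 2 := by
        rw [exp_neg]
        field_simp [(exp_pos (t + T)).ne']
      rw [this, hgd, mul_pow, ← mul_assoc, ← exp_nat_mul, ← exp_nat_mul, ← exp_add, ← exp_add,
        hcast]
      rw [show (2 * k + 1) * (t + T) + -(t + T) + ((2 : ℕ) : ℝ) * (-k * (t + T)) = 0 by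
        push_cast; ring, exp_zero, one_mul]
    simp_rw [e]
    have hz := integral_eq_zero_of_hasDerivAt_of_hasCompactSupport
      (H := fun t => k * (φ t * φ t)) (H' := fun t => k * (deriv φ t * φ t + φ t * deriv φ t))
      (fun t => ((hφd t).mul (hφd t)).const_mul k) (hφc.mul_left.mul_left)
      (by have := hφ.continuous; fun_prop)
    have hint1 : Integrable fun t => deriv φ t ^ 2 + k ^ 2 * φ t ^ 2 := by
      refine Continuous.integrable_of_hasCompactSupport
        (by have := hφ.continuous; fun_prop) (HasCompactSupport.add ?_ ?_)
      · simp_rw [sq]; exact hφc.deriv.mul_left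
      · simp_rw [sq]; exact hφc.mul_left.mul_left
    have hint2 : Integrable fun t => k * (deriv φ t * φ t + φ t * deriv φ t) :=
      Continuous.integrable_of_hasCompactSupport
        (by have := hφ.continuous; fun_prop) (hφc.mul_left.add hφc.mul_right).mul_left
    rw [← sub_zero (∫ t, (deriv φ t ^ 2 + k ^ 2 * φ t ^ 2)), ← hz, ← integral_sub hint1 hint2]
    congr 1 with t
    ring
  · rw [integral_radial_comp hn hρ (fun t => exp_pos _) (fun t => exp_pos _)
      (F := fun r => |g r| ^ p) fun y hy h => (hrange y hy h).elim]
    congr 2 with t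
    rw [hgρ, abs_mul, abs_of_pos (exp_pos _), mul_rpow (exp_pos _).le (abs_nonneg _), ← exp_mul,
      ← exp_nat_mul, ← mul_assoc, ← mul_assoc, ← exp_add, ← exp_add, hcast]
    rw [show t + T + (2 * k + 1) * (t + T) + -k * (t + T) * p = 0 by
      linear_combination (-(t + T)) * hkp - (t + T) * hnk.symm, exp_zero, one_mul]

lemma continuous_norm_gradient_sq {n : ℕ} {u : EuclideanSpace ℝ (Fin n) → ℝ}
    (hu : ContDiff ℝ (⊤ : ℕ∞) u) : Continuous fun x => ‖gradient u x‖ ^ 2 := by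
  simp only [gradient, LinearIsometryEquiv.norm_map]
  have := hu.continuous_fderiv (by simp)
  fun_prop

/-- The concentration estimate at a boundary point of the unit ball. -/
lemma exists_test_function_concentrating {n : ℕ} (hn : 3 ≤ n) {a : ℝ} (ha : 0 < a) {C : ℝ}
    (hC : a ^ (2 * ((n : ℝ) - 1) / (n : ℝ)) * sobolevConst n < C) :
    ∃ u : EuclideanSpace ℝ (Fin n) → ℝ, ContDiff ℝ (⊤ : ℕ∞) u ∧ HasCompactSupport u ∧
      tsupport u ⊆ (Metric.closedBall (0 : EuclideanSpace ℝ (Fin n)) 1)ᶜ ∧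
      (∫ x in (Metric.closedBall (0 : EuclideanSpace ℝ (Fin n)) 1)ᶜ, ‖gradient u x‖ ^ 2) - (((n : ℝ) - 2) / 2) ^ 2 *
          (∫ x in (Metric.closedBall (0 : EuclideanSpace ℝ (Fin n)) 1)ᶜ, u x ^ 2 / ‖x‖ ^ 2)
        < C *
          (∫ x in (Metric.closedBall (0 : EuclideanSpace ℝ (Fin n)) 1)ᶜ,
              (X1 a (1 / ‖x‖)) ^ (2 * ((n : ℝ) - 1) / ((n : ℝ) - 2)) *
                |u x| ^ (2 * (n : ℝ) / ((n : ℝ) - 2)))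
            ^ (((n : ℝ) - 2) / (n : ℝ)) := by
  have hn3 : (3 : ℝ) ≤ n := by exact_mod_cast hn
  have hS : 0 < sobolevConst n := by
    have hG1 : 0 < Gamma ((n : ℝ) / 2) := Gamma_pos_of_pos (by positivity)
    have hG2 : 0 < Gamma (n : ℝ) := Gamma_pos_of_pos (by positivity)
    have : 0 < (n : ℝ) - 2 := by linarith
    unfold sobolevConst
    positivity
  set p : ℝ := 2 * (n : ℝ) / ((n : ℝ) - 2) with hp
  have hp0 : 0 < p := by rw [hp]; exact div_pos (by linarith) (by linarith)
  set q : ℝ := 2 * ((n : ℝ) - 1) / ((n : ℝ) - 2) with hq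
  have hq0 : 0 < q := by rw [hq]; exact div_pos (by linarith) (by linarith)
  set θ : ℝ := ((n : ℝ) - 2) / n with hθ
  have hθ0 : 0 < θ := by rw [hθ]; exact div_pos (by linarith) (by linarith)
  have hqθ : q * θ = 2 * ((n : ℝ) - 1) / n := by
    rw [hq, hθ]; field_simp [show (n : ℝ) - 2 ≠ 0 by linarith]
  rw [← hqθ] at hC
  obtain ⟨δ, hδ, hCδ⟩ : ∃ δ : ℝ, 0 < δ ∧ (a + 2 * δ) ^ (q * θ) * sobolevConst n < C := by
    have hl : Filter.Tendsto (fun δ : ℝ => (a + 2 * δ) ^ (q * θ) * sobolevConst n)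
        (nhdsWithin 0 (Set.Ioi 0)) (nhds (a ^ (q * θ) * sobolevConst n)) := by
      have : ContinuousAt (fun δ : ℝ => (a + 2 * δ) ^ (q * θ) * sobolevConst n) 0 := by
        refine ContinuousAt.mul (ContinuousAt.rpow_const (by fun_prop) (Or.inl ?_)) continuousAt_const
        simpa using ha.ne'
      have h := this.tendsto
      simp only [mul_zero, add_zero] at h
      exact h.mono_left nhdsWithin_le_nhds
    obtain ⟨δ, h1, h2⟩ := ((hl.eventually_lt_const hC).and self_mem_nhdsWithin).exists
    exact ⟨δ, h2, h1⟩
  have hb : 0 < a + 2 * δ := by positivity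
  have hbq : 0 < (a + 2 * δ) ^ (q * θ) := rpow_pos_of_pos hb _
  obtain ⟨φ, hφ, hφc, hφlt⟩ := exists_compactSupport_near_extremal n hn
    (C / (a + 2 * δ) ^ (q * θ)) (by rw [lt_div_iff₀ hbq]; linarith)
  obtain ⟨w, hw, hws, hw1, hw2⟩ := exists_bubble_in_ball hn hφ hφc (half_pos hδ)
  rw [← hw1, ← hw2] at hφlt
  have hwc : HasCompactSupport w :=
    (isCompact_closedBall _ _).of_isClosed_subset (isClosed_tsupport _) hws
  set x₀ : EuclideanSpace ℝ (Fin n) := EuclideanSpace.single ⟨0, by omega⟩ (1 + δ) with hx₀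
  have hx₀n : ‖x₀‖ = 1 + δ := by
    rw [hx₀, PiLp.norm_single, norm_of_nonneg (by positivity)]
  let u : EuclideanSpace ℝ (Fin n) → ℝ := fun x => w (x - x₀)
  have hu : ContDiff ℝ (⊤ : ℕ∞) u := hw.comp (contDiff_id.sub contDiff_const)
  have hus : tsupport u ⊆ Metric.closedBall x₀ (δ / 2) := by
    refine closure_minimal (fun x hx => ?_) Metric.isClosed_closedBall
    have := hws (subset_tsupport _ (show x - x₀ ∈ Function.support w from hx))
    rwa [mem_closedBall_zero_iff, ← dist_eq_norm] at this
  have huc : HasCompactSupport u :=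
    (isCompact_closedBall _ _).of_isClosed_subset (isClosed_tsupport _) hus
  have hnorm : ∀ x ∈ tsupport u, 1 < ‖x‖ ∧ ‖x‖ ≤ 1 + 2 * δ := by
    intro x hx
    have h := hus hx
    rw [Metric.mem_closedBall, dist_eq_norm] at h
    have h1 := norm_sub_norm_le x x₀
    have h2 := norm_sub_norm_le x₀ x
    rw [norm_sub_rev] at h2
    constructor <;> linarith
  have hsub : tsupport u ⊆ (Metric.closedBall (0 : EuclideanSpace ℝ (Fin n)) 1)ᶜ := by
    intro x hx h
    rw [mem_closedBall_zero_iff] at h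
    linarith [(hnorm x hx).1]
  have hgradu : ∀ x, gradient u x = gradient w (x - x₀) := fun x => by
    simp only [gradient]
    rw [show fderiv ℝ u x = fderiv ℝ w (x - x₀) from fderiv_comp_sub x₀]
  have hgi : Integrable fun x => ‖gradient u x‖ ^ 2 := by
    refine (continuous_norm_gradient_sq hu).integrable_of_hasCompactSupport ?_
    refine huc.mono' fun x hx => ?_
    by_contra h
    refine hx ?_
    simp only [gradient]
    rw [image_eq_zero_of_notMem_tsupport (fun h' => h (tsupport_fderiv_subset ℝ h'))]
    simp
  have hI1 : (∫ x in (Metric.closedBall (0 : EuclideanSpace ℝ (Fin n)) 1)ᶜ, ‖gradient u x‖ ^ 2)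
      ≤ ∫ x, ‖gradient w x‖ ^ 2 := by
    refine (setIntegral_le_integral hgi (.of_forall fun x => sq_nonneg _)).trans_eq ?_
    simp_rw [hgradu]
    exact integral_sub_right_eq_self (fun x => ‖gradient w x‖ ^ 2) x₀
  have hI2 : 0 ≤ ∫ x in (Metric.closedBall (0 : EuclideanSpace ℝ (Fin n)) 1)ᶜ, u x ^ 2 / ‖x‖ ^ 2 :=
    integral_nonneg fun x => by positivity
  have hui : Integrable fun x => |u x| ^ p := by
    refine (hu.continuous.abs.rpow_const fun t => Or.inr hp0.le).integrable_of_hasCompactSupport ?_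
    exact huc.comp_left (g := fun s => |s| ^ p) (by simp [zero_rpow hp0.ne'])
  have hI3 : ∫ x, |w x| ^ p =
      ∫ x in (Metric.closedBall (0 : EuclideanSpace ℝ (Fin n)) 1)ᶜ, |u x| ^ p := by
    rw [setIntegral_eq_integral_of_forall_compl_eq_zero]
    · exact (integral_sub_right_eq_self (fun x => |w x| ^ p) x₀).symm
    · intro x hx
      rw [image_eq_zero_of_notMem_tsupport (fun h => hx (hsub h)), abs_zero, zero_rpow hp0.ne']
  have hX : ∀ x : EuclideanSpace ℝ (Fin n), X1 a (1 / ‖x‖) = (a + log ‖x‖)⁻¹ := fun x => by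
    rw [X1, one_div, log_inv, sub_neg_eq_add]
  have hI4 : ∫ x, |w x| ^ p ≤ (a + 2 * δ) ^ q *
      ∫ x in (Metric.closedBall (0 : EuclideanSpace ℝ (Fin n)) 1)ᶜ,
        X1 a (1 / ‖x‖) ^ q * |u x| ^ p := by
    rw [hI3, ← integral_const_mul]
    have hms := (Metric.isClosed_closedBall (x := (0 : EuclideanSpace ℝ (Fin n))) (ε := 1)).measurableSet.compl
    refine setIntegral_mono_on hui.integrableOn ?_ hms fun x hx => ?_
    · refine Integrable.const_mul ?_ _
      refine ((hui.const_mul (a⁻¹ ^ q)).integrableOn).mono' ?_ ?_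
      · refine AEStronglyMeasurable.mul ?_ hui.aestronglyMeasurable.restrict
        simp_rw [hX]
        exact (by fun_prop : Measurable fun x : EuclideanSpace ℝ (Fin n) =>
          (a + log ‖x‖)⁻¹ ^ q).aestronglyMeasurable
      · refine (ae_restrict_iff' hms).2 (.of_forall fun x hx => ?_)
        rw [Set.mem_compl_iff, mem_closedBall_zero_iff, not_le] at hx
        have hlog := log_pos hx
        rw [hX, norm_of_nonneg (by positivity)]
        gcongr
        linarith
    · by_cases hxs : x ∈ tsupport u
      · obtain ⟨h1, h2⟩ := hnorm x hxs
        have hlog := log_pos h1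
        have hlog2 : log ‖x‖ ≤ 2 * δ := by
          have := log_le_sub_one_of_pos (zero_lt_one.trans h1)
          linarith
        rw [hX, ← mul_assoc, ← mul_rpow hb.le (by positivity)]
        refine le_mul_of_one_le_left (by positivity) (one_le_rpow ?_ hq0.le)
        rw [← div_eq_mul_inv, one_le_div (by positivity)]
        linarith
      · rw [image_eq_zero_of_notMem_tsupport hxs, abs_zero, zero_rpow hp0.ne']
        simp
  refine ⟨u, hu, huc, hsub, ?_⟩
  have hI0 : 0 ≤ ∫ x, |w x| ^ p := integral_nonneg fun x => by positivity
  have hC0 : 0 < C := (mul_pos hbq hS).trans hCδ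
  set I := ∫ x in (Metric.closedBall (0 : EuclideanSpace ℝ (Fin n)) 1)ᶜ,
        X1 a (1 / ‖x‖) ^ q * |u x| ^ p
  have hI : 0 ≤ I := by
    by_contra h
    have := mul_neg_of_pos_of_neg (rpow_pos_of_pos hb q) (not_le.1 h)
    linarith
  calc _ ≤ ∫ x, ‖gradient w x‖ ^ 2 := by
        have := mul_nonneg (sq_nonneg (((n : ℝ) - 2) / 2)) hI2
        linarith
    _ < C / (a + 2 * δ) ^ (q * θ) * (∫ x, |w x| ^ p) ^ θ := hφlt
    _ ≤ C / (a + 2 * δ) ^ (q * θ) * ((a + 2 * δ) ^ q * I) ^ θ := by gcongr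
    _ = C * I ^ θ := by
        rw [mul_rpow (by positivity) hI, ← rpow_mul hb.le]
        field_simp

/-- The radial estimate: a bubble in the variable `log (a + log ‖x‖)`, spreading to infinity. -/
lemma exists_test_function_radial {n : ℕ} (hn : 3 ≤ n) {a : ℝ} (ha : 0 < a) {C : ℝ}
    (hC : ((n : ℝ) - 2) ^ (-(2 * ((n : ℝ) - 1)) / (n : ℝ)) * sobolevConst n < C) :
    ∃ u : EuclideanSpace ℝ (Fin n) → ℝ, ContDiff ℝ (⊤ : ℕ∞) u ∧ HasCompactSupport u ∧
      tsupport u ⊆ (Metric.closedBall (0 : EuclideanSpace ℝ (Fin n)) 1)ᶜ ∧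
      (∫ x in (Metric.closedBall (0 : EuclideanSpace ℝ (Fin n)) 1)ᶜ, ‖gradient u x‖ ^ 2) - (((n : ℝ) - 2) / 2) ^ 2 *
          (∫ x in (Metric.closedBall (0 : EuclideanSpace ℝ (Fin n)) 1)ᶜ, u x ^ 2 / ‖x‖ ^ 2)
        < C *
          (∫ x in (Metric.closedBall (0 : EuclideanSpace ℝ (Fin n)) 1)ᶜ,
              (X1 a (1 / ‖x‖)) ^ (2 * ((n : ℝ) - 1) / ((n : ℝ) - 2)) *
                |u x| ^ (2 * (n : ℝ) / ((n : ℝ) - 2)))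
            ^ (((n : ℝ) - 2) / (n : ℝ)) := by
  have hn3 : (3 : ℝ) ≤ n := by exact_mod_cast hn
  have hn2 : (n : ℝ) - 2 ≠ 0 := by linarith
  set k : ℝ := ((n : ℝ) - 2) / 2 with hk
  have hk1 : 0 < k := by rw [hk]; linarith
  have h2k : 0 < 2 * k := by positivity
  have hnk : (n : ℝ) = 2 * k + 2 := by rw [hk]; ring
  have hnk' : (n : ℝ) - 2 = 2 * k := by rw [hk]; ring
  set p : ℝ := 2 * (n : ℝ) / ((n : ℝ) - 2) with hp
  have hp0 : 0 < p := by rw [hp]; exact div_pos (by linarith) (by linarith)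
  have hkp : k * p = n := by rw [hk, hp]; field_simp
  set q : ℝ := 2 * ((n : ℝ) - 1) / ((n : ℝ) - 2) with hq
  have hqp : q = p / 2 + 1 := by rw [hq, hp]; field_simp; ring
  set θ : ℝ := ((n : ℝ) - 2) / n with hθ
  have hcast : ((n - 1 : ℕ) : ℝ) = 2 * k + 1 := by
    rw [Nat.cast_sub (by omega), hk]; push_cast; ring
  have hexp : -(2 * ((n : ℝ) - 1)) / (n : ℝ) = -(1 + θ) := by rw [hθ]; field_simp; ring
  rw [hexp, hnk', rpow_neg h2k.le, inv_mul_lt_iff₀ (by positivity)] at hC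
  obtain ⟨φ, hφ, hφc, hφlt⟩ := exists_compactSupport_near_extremal n hn _ hC
  obtain ⟨M, hM⟩ := exists_forall_lt_abs_eq_zero hφc
  set T : ℝ := log (a + 1) + 2 * k * M with hT
  let g : ℝ → ℝ := fun r =>
    r ^ (-k) * (√(a + log r) * φ ((log (a + log r) - T) / (2 * k)))
  have h0 : ∀ r, 0 ≤ r → r < exp 1 → g r = 0 := by
    intro r hr hr'
    have hlog : log r < 1 := by
      rcases hr.eq_or_lt with rfl | hr
      · simp
      · rwa [log_lt_iff_lt_exp hr]
    rcases le_or_gt (a + log r) 0 with h | h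
    · simp [g, sqrt_eq_zero_of_nonpos h]
    · have h2 : log (a + log r) < log (a + 1) := log_lt_log h (by linarith)
      simp only [g]
      rw [hM, mul_zero, mul_zero]
      rw [lt_abs]
      right
      rw [← neg_div, lt_div_iff₀ h2k]
      linarith
  have h1 : ∀ r, exp (exp (T + 2 * k * M)) < r → g r = 0 := by
    intro r hr
    have hr0 : 0 < r := (exp_pos _).trans hr
    have hlog : exp (T + 2 * k * M) < log r := (lt_log_iff_exp_lt hr0).2 hr
    have hlog0 : 0 < log r := (exp_pos _).trans hlog
    have h2 : T + 2 * k * M < log (a + log r) :=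
      (lt_log_iff_exp_lt (by positivity)).2 (by linarith)
    simp only [g]
    rw [hM, mul_zero, mul_zero]
    rw [lt_abs]
    left
    rw [lt_div_iff₀ h2k]
    linarith
  have hgs : ∀ r, 0 < r → ContDiffAt ℝ (⊤ : ℕ∞) g r := by
    intro r hr
    rcases lt_or_ge r (exp 1) with h | h
    · have : g =ᶠ[nhds r] fun _ => 0 := by
        filter_upwards [Ioo_mem_nhds hr h] with s hs
        exact h0 s hs.1.le hs.2
      exact contDiffAt_const.congr_of_eventuallyEq this
    · have hlog : 1 ≤ log r := (le_log_iff_exp_le hr).2 h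
      have hal : a + log r ≠ 0 := by positivity
      have hL : ContDiffAt ℝ (⊤ : ℕ∞) (fun r => a + log r) r :=
        contDiffAt_const.add (contDiffAt_id.log hr.ne')
      exact (contDiffAt_id.rpow_const_of_ne hr.ne').mul
        ((hL.sqrt hal).mul (hφ.contDiffAt.comp r
          (((hL.log hal).sub contDiffAt_const).div_const _)))
  let E : ℝ → ℝ := fun t => exp (2 * k * t + T)
  have hE0 : ∀ t, 0 < E t := fun t => exp_pos _
  have hEd : ∀ t, HasDerivAt E (E t * (2 * k)) t := fun t => by
    simpa using (((hasDerivAt_id t).const_mul (2 * k)).add_const T).exp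
  have hEc : Continuous E := by fun_prop
  let ρ : ℝ → ℝ := fun t => exp (E t - a)
  have hρ0 : ∀ t, 0 < ρ t := fun t => exp_pos _
  have hρ : ∀ t, HasDerivAt ρ (ρ t * (E t * (2 * k))) t := fun t =>
    ((hEd t).sub_const a).exp
  have hρ' : ∀ t, 0 < ρ t * (E t * (2 * k)) := fun t =>
    mul_pos (hρ0 t) (mul_pos (hE0 t) h2k)
  have hrange : ∀ y : ℝ, 0 < y → y ∉ Set.range ρ → y < 1 := by
    intro y hy h
    by_contra h'
    have hlog := log_nonneg (not_lt.1 h')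
    refine h ⟨(log (a + log y) - T) / (2 * k), ?_⟩
    simp only [ρ, E]
    rw [mul_div_cancel₀ _ h2k.ne', sub_add_cancel, exp_log (by positivity), add_sub_cancel_left,
      exp_log hy]
  have hlogρ : ∀ t, a + log (ρ t) = E t := fun t => by
    simp only [ρ, log_exp]; ring
  have hgρ : ∀ t, g (ρ t) = exp (-k * (E t - a) + (2 * k * t + T) / 2) * φ t := fun t => by
    simp only [g]
    rw [hlogρ]
    simp only [E, ρ]
    rw [log_exp, add_sub_cancel_right, mul_div_cancel_left₀ _ h2k.ne', ← exp_mul, ← exp_half,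
      mul_comm _ (-k), exp_add (-k * (exp (2 * k * t + T) - a))]
    ring
  have hφd : ∀ t, HasDerivAt φ (deriv φ t) t := fun t =>
    (hφ.differentiable (by simp)).differentiableAt.hasDerivAt
  have hφdc : Continuous (deriv φ) := hφ.continuous_deriv (by simp)
  have hφcont : Continuous φ := hφ.continuous
  have hgd : ∀ t, deriv g (ρ t) * (ρ t * (E t * (2 * k))) =
      exp (-k * (E t - a) + (2 * k * t + T) / 2) *
        (k * φ t + deriv φ t - 2 * k ^ 2 * E t * φ t) := by
    intro t
    have a1 := ((hgs _ (hρ0 t)).differentiableAt (by simp)).hasDerivAt.comp t (hρ t)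
    have a2 : HasDerivAt (fun t => exp (-k * (E t - a) + (2 * k * t + T) / 2))
        (exp (-k * (E t - a) + (2 * k * t + T) / 2) * (-k * (E t * (2 * k)) + 2 * k / 2)) t := by
      have b1 : HasDerivAt (fun t => (2 * k * t + T) / 2) (2 * k / 2) t := by
        simpa using (((hasDerivAt_id t).const_mul (2 * k)).add_const T).div_const 2
      exact ((((hEd t).sub_const a).const_mul (-k)).add b1).exp
    have a3 := a2.mul (hφd t)
    have e : g ∘ ρ = fun t => exp (-k * (E t - a) + (2 * k * t + T) / 2) * φ t := funext hgρ
    rw [e] at a1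
    rw [a1.unique a3]
    ring
  have hsupp := tsupport_radial_subset (n := n) h0 h1
  have hsub : tsupport (fun x : EuclideanSpace ℝ (Fin n) => g ‖x‖) ⊆
      (Metric.closedBall (0 : EuclideanSpace ℝ (Fin n)) 1)ᶜ := by
    intro x hx h
    rw [mem_closedBall_zero_iff] at h
    have h3 := (hsupp hx).1
    have h4 := add_one_le_exp (1 : ℝ)
    linarith
  have hge1 : ∀ r : ℝ, 0 ≤ r → r ≤ 1 → g r = 0 := fun r h h' =>
    h0 r h (by have := add_one_le_exp (1 : ℝ); linarith)
  have hdg : ∀ r : ℝ, 0 < r → r ≤ 1 → deriv g r = 0 := by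
    intro r h h'
    have : g =ᶠ[nhds r] fun _ => 0 := by
      filter_upwards [Ioo_mem_nhds h (show r < exp 1 by
        have := add_one_le_exp (1 : ℝ); linarith)] with s hs
      exact h0 s hs.1.le hs.2
    rw [this.deriv_eq, deriv_const]
  have hconv : ∀ F : ℝ → ℝ, (∀ r, 0 ≤ r → r ≤ 1 → F r = 0) →
      ∫ x in (Metric.closedBall (0 : EuclideanSpace ℝ (Fin n)) 1)ᶜ, F ‖x‖ =
        sphereArea n * ∫ t, ρ t * (E t * (2 * k)) * (ρ t ^ (n - 1) * F (ρ t)) := by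
    intro F hF
    rw [setIntegral_eq_integral_of_forall_compl_eq_zero,
      integral_radial_comp hn hρ hρ' hρ0 fun y hy h => hF y hy.le (hrange y hy h).le]
    intro x hx
    rw [Set.notMem_compl_iff, mem_closedBall_zero_iff] at hx
    exact hF _ (norm_nonneg _) hx
  have hms := (Metric.isClosed_closedBall
    (x := (0 : EuclideanSpace ℝ (Fin n))) (ε := 1)).measurableSet.compl
  have hpw : ∀ t, ρ t ^ (n - 1) = exp ((2 * k + 1) * (E t - a)) := fun t => by
    simp only [ρ]
    rw [← exp_nat_mul, hcast]
  have hI1 : ∫ x in (Metric.closedBall (0 : EuclideanSpace ℝ (Fin n)) 1)ᶜ,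
      ‖gradient (fun x : EuclideanSpace ℝ (Fin n) => g ‖x‖) x‖ ^ 2 =
      sphereArea n * ∫ t, (k * φ t + deriv φ t - 2 * k ^ 2 * E t * φ t) ^ 2 / (2 * k) := by
    rw [setIntegral_congr_fun hms (g := fun x =>
      (fun r => if r ≤ 1 then 0 else deriv g r ^ 2) ‖x‖)]
    · rw [hconv (fun r => if r ≤ 1 then 0 else deriv g r ^ 2) fun r _ hr => if_pos hr]
      congr 2 with t
      have e1 : (if ρ t ≤ 1 then 0 else deriv g (ρ t) ^ 2) = deriv g (ρ t) ^ 2 := by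
        split_ifs with h
        · rw [hdg _ (hρ0 t) h]; simp
        · rfl
      rw [e1, eq_div_iff h2k.ne']
      have e2 : ρ t * (E t * (2 * k)) * (ρ t ^ (n - 1) * deriv g (ρ t) ^ 2) * (2 * k) =
          ρ t ^ (n - 1) * (ρ t)⁻¹ * (E t)⁻¹ * (deriv g (ρ t) * (ρ t * (E t * (2 * k)))) ^ 2 := by
        have := (hρ0 t).ne'
        have := (hE0 t).ne'
        field_simp
      rw [e2, hgd, hpw, mul_pow, ← mul_assoc, ← exp_nat_mul]
      conv_lhs =>
        simp only [ρ]
        rw [← exp_neg, show (E t)⁻¹ = exp (-(2 * k * t + T)) from (exp_neg _).symm, ← exp_add,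
          ← exp_add, ← exp_add]
      rw [show (2 * k + 1) * (E t - a) + -(E t - a) + -(2 * k * t + T) +
        ((2 : ℕ) : ℝ) * (-k * (E t - a) + (2 * k * t + T) / 2) = 0 by push_cast; ring, exp_zero,
        one_mul]
    · intro x hx
      rw [Set.mem_compl_iff, mem_closedBall_zero_iff] at hx
      have hx0 : x ≠ 0 := by rintro rfl; simp at hx
      simp only [if_neg hx]
      exact norm_gradient_radial_sq_s13 hn hgs hx0
  have hI2 : ∫ x in (Metric.closedBall (0 : EuclideanSpace ℝ (Fin n)) 1)ᶜ, g ‖x‖ ^ 2 / ‖x‖ ^ 2 =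
      sphereArea n * ∫ t, 2 * k * (E t ^ 2 * φ t ^ 2) := by
    rw [hconv (fun r => g r ^ 2 / r ^ 2) fun r hr hr' => by simp [hge1 r hr hr']]
    congr 2 with t
    rw [hgρ, hpw, mul_pow, ← exp_nat_mul]
    have e3 : exp ((2 * k + 1) * (E t - a)) *
        exp (((2 : ℕ) : ℝ) * (-k * (E t - a) + (2 * k * t + T) / 2)) = ρ t * E t := by
      simp only [ρ]
      conv_rhs => rw [show E t = exp (2 * k * t + T) from rfl, ← exp_add]
      rw [← exp_add]
      congr 1
      push_cast
      ring
    calc _ = ρ t * E t * (2 * k) * ((exp ((2 * k + 1) * (E t - a)) *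
        exp (((2 : ℕ) : ℝ) * (-k * (E t - a) + (2 * k * t + T) / 2))) * φ t ^ 2 / ρ t ^ 2) := by ring
      _ = _ := by
        rw [e3]
        have := (hρ0 t).ne'
        field_simp
  have hI3 : ∫ x in (Metric.closedBall (0 : EuclideanSpace ℝ (Fin n)) 1)ᶜ,
      X1 a (1 / ‖x‖) ^ q * |g ‖x‖| ^ p = sphereArea n * ∫ t, 2 * k * |φ t| ^ p := by
    rw [hconv (fun r => X1 a (1 / r) ^ q * |g r| ^ p) fun r hr hr' => by
      simp [hge1 r hr hr', zero_rpow hp0.ne']]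
    congr 2 with t
    rw [hgρ, hpw, X1, one_div, log_inv, sub_neg_eq_add, hlogρ, abs_mul, abs_of_pos (exp_pos _),
      mul_rpow (exp_pos _).le (abs_nonneg _), ← exp_mul,
      show (E t)⁻¹ = exp (-(2 * k * t + T)) from (exp_neg _).symm, ← exp_mul]
    have e4 : exp (E t - a) * exp (2 * k * t + T) * exp ((2 * k + 1) * (E t - a)) *
        exp (-(2 * k * t + T) * q) * exp ((-k * (E t - a) + (2 * k * t + T) / 2) * p) = 1 := by
      rw [← exp_add, ← exp_add, ← exp_add, ← exp_add, exp_eq_one_iff, hqp]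
      linear_combination (-(E t - a)) * hkp - (E t - a) * hnk
    calc _ = (exp (E t - a) * exp (2 * k * t + T) * exp ((2 * k + 1) * (E t - a)) *
        exp (-(2 * k * t + T) * q) * exp ((-k * (E t - a) + (2 * k * t + T) / 2) * p)) *
          (2 * k * |φ t| ^ p) := by
          simp only [ρ, E]
          ring
      _ = _ := by rw [e4, one_mul]
  refine ⟨fun x => g ‖x‖, contDiff_radial (exp_pos 1) hgs h0, hasCompactSupport_radial h1, hsub, ?_⟩
  rw [hI1, hI2, hI3, integral_const_mul]
  have hz := integral_eq_zero_of_hasDerivAt_of_hasCompactSupport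
    (H := fun t => φ t * (φ t * (1 / 2 - k * E t)))
    (H' := fun t => deriv φ t * (φ t * (1 / 2 - k * E t)) +
      φ t * (deriv φ t * (1 / 2 - k * E t) + φ t * (-(k * (E t * (2 * k))))))
    (fun t => (hφd t).mul ((hφd t).mul (((hEd t).const_mul k).const_sub (1 / 2))))
    hφc.mul_right (by fun_prop)
  have hint1 : Integrable fun t => (k * φ t + deriv φ t - 2 * k ^ 2 * E t * φ t) ^ 2 / (2 * k) := by
    refine Continuous.integrable_of_hasCompactSupport (by fun_prop) ?_
    have hs := (hφc.mul_left (f' := φ) (f := fun _ => k)).add hφc.deriv |>.sub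
      (hφc.mul_left (f := fun t => 2 * k ^ 2 * E t))
    exact hs.comp_left (g := fun s => s ^ 2 / (2 * k)) (by simp)
  have hint2 : Integrable fun t => E t ^ 2 * φ t ^ 2 := by
    refine Continuous.integrable_of_hasCompactSupport (by fun_prop) (HasCompactSupport.mul_left ?_)
    exact hφc.comp_left (g := fun s => s ^ 2) (by simp)
  have hint3 : Integrable fun t => deriv φ t * (φ t * (1 / 2 - k * E t)) +
      φ t * (deriv φ t * (1 / 2 - k * E t) + φ t * (-(k * (E t * (2 * k))))) :=
    Continuous.integrable_of_hasCompactSupport (by fun_prop)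
      (hφc.deriv.mul_right.add hφc.mul_right)
  have hmain : ∫ t, (k * φ t + deriv φ t - 2 * k ^ 2 * E t * φ t) ^ 2 / (2 * k) =
      (∫ t, (deriv φ t ^ 2 + k ^ 2 * φ t ^ 2)) / (2 * k) + 2 * k ^ 3 * ∫ t, E t ^ 2 * φ t ^ 2 := by
    have e : ∀ t, (deriv φ t ^ 2 + k ^ 2 * φ t ^ 2) / (2 * k) =
        ((k * φ t + deriv φ t - 2 * k ^ 2 * E t * φ t) ^ 2 / (2 * k) -
          2 * k ^ 3 * (E t ^ 2 * φ t ^ 2)) -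
        (deriv φ t * (φ t * (1 / 2 - k * E t)) +
          φ t * (deriv φ t * (1 / 2 - k * E t) + φ t * (-(k * (E t * (2 * k)))))) := by
      intro t
      field_simp
      ring
    rw [← integral_div]
    simp_rw [e]
    have hint4 : Integrable fun t => (k * φ t + deriv φ t - 2 * k ^ 2 * E t * φ t) ^ 2 / (2 * k) -
        2 * k ^ 3 * (E t ^ 2 * φ t ^ 2) := hint1.sub (hint2.const_mul _)
    rw [integral_sub hint4 hint3,
      integral_sub hint1 (hint2.const_mul _), hz, integral_const_mul]
    ring
  rw [hmain, integral_const_mul]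
  have hσ := sphereArea_pos n hn
  have hB : 0 ≤ sphereArea n * ∫ t, |φ t| ^ p :=
    mul_nonneg hσ.le (integral_nonneg fun t => by positivity)
  rw [mul_left_comm (sphereArea n) (2 * k) (∫ t, |φ t| ^ p), mul_rpow h2k.le hB]
  have hφlt' : sphereArea n * (∫ t, (deriv φ t ^ 2 + k ^ 2 * φ t ^ 2)) / (2 * k) <
      C * ((2 * k) ^ θ * (sphereArea n * ∫ t, |φ t| ^ p) ^ θ) := by
    rw [div_lt_iff₀ h2k]
    refine hφlt.trans_eq ?_
    rw [rpow_add h2k, rpow_one]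
    ring
  refine lt_of_eq_of_lt ?_ hφlt'
  ring

theorem stmt13 (n : ℕ) (hn : 3 ≤ n) (a : ℝ) (ha0 : 0 < a)
    (Cna : ℝ)
    (hCna : Cna = if 1 / ((n : ℝ) - 2) ≤ a then ((n : ℝ) - 2) ^ (-(2 * ((n : ℝ) - 1)) / (n : ℝ)) * sobolevConst n else a ^ (2 * ((n : ℝ) - 1) / (n : ℝ)) * sobolevConst n)
    (C : ℝ) (hC : C > Cna) :
    ∃ u : EuclideanSpace ℝ (Fin n) → ℝ, u ≠ 0 ∧ ContDiff ℝ (⊤ : ℕ∞) u ∧ HasCompactSupport u ∧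
      tsupport u ⊆ (Metric.closedBall (0 : EuclideanSpace ℝ (Fin n)) 1)ᶜ ∧
      (∫ x in (Metric.closedBall (0 : EuclideanSpace ℝ (Fin n)) 1)ᶜ, ‖gradient u x‖ ^ 2) - (((n : ℝ) - 2) / 2) ^ 2 *
          (∫ x in (Metric.closedBall (0 : EuclideanSpace ℝ (Fin n)) 1)ᶜ, u x ^ 2 / ‖x‖ ^ 2)
        < C *
          (∫ x in (Metric.closedBall (0 : EuclideanSpace ℝ (Fin n)) 1)ᶜ,
              (X1 a (1 / ‖x‖)) ^ (2 * ((n : ℝ) - 1) / ((n : ℝ) - 2)) *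
                |u x| ^ (2 * (n : ℝ) / ((n : ℝ) - 2)))
            ^ (((n : ℝ) - 2) / (n : ℝ)) := by
  suffices h : ∃ u : EuclideanSpace ℝ (Fin n) → ℝ, ContDiff ℝ (⊤ : ℕ∞) u ∧ HasCompactSupport u ∧
      tsupport u ⊆ (Metric.closedBall (0 : EuclideanSpace ℝ (Fin n)) 1)ᶜ ∧
      (∫ x in (Metric.closedBall (0 : EuclideanSpace ℝ (Fin n)) 1)ᶜ, ‖gradient u x‖ ^ 2) - (((n : ℝ) - 2) / 2) ^ 2 *
          (∫ x in (Metric.closedBall (0 : EuclideanSpace ℝ (Fin n)) 1)ᶜ, u x ^ 2 / ‖x‖ ^ 2)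
        < C *
          (∫ x in (Metric.closedBall (0 : EuclideanSpace ℝ (Fin n)) 1)ᶜ,
              (X1 a (1 / ‖x‖)) ^ (2 * ((n : ℝ) - 1) / ((n : ℝ) - 2)) *
                |u x| ^ (2 * (n : ℝ) / ((n : ℝ) - 2)))
            ^ (((n : ℝ) - 2) / (n : ℝ)) by
    obtain ⟨u, hu, huc, hus, hlt⟩ := h
    refine ⟨u, ?_, hu, huc, hus, hlt⟩
    rintro rfl
    have hn3 : (3 : ℝ) ≤ n := by exact_mod_cast hn
    have hp : 2 * (n : ℝ) / ((n : ℝ) - 2) ≠ 0 := (div_pos (by linarith) (by linarith)).ne'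
    have hθ : ((n : ℝ) - 2) / n ≠ 0 := (div_pos (by linarith) (by linarith)).ne'
    have hg : ∀ x, gradient (0 : EuclideanSpace ℝ (Fin n) → ℝ) x = 0 := fun x => by
      simp [gradient]
    simp [hg, zero_rpow hp, zero_rpow hθ] at hlt
  split_ifs at hCna
  · exact exists_test_function_radial hn ha0 (hCna ▸ hC)
  · exact exists_test_function_concentrating hn ha0 (hCna ▸ hC)
end
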